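/- arXiv:2111.09291 — 4 statements merged into one kernel-verified Lean document; each statement's English description precedes it below -/
import Mathlib

section
/- There exists a universal constant C > 0 such that for every complex-valued Schwartz function f ∈ 𝒮(ℝ) and every α ∈ ℝ, ∫_ℝ |f(α) − f(β)|²/(α − β)² dβ ≤ C·‖f'‖_{L²(ℝ)}². -/
open MeasureTheory Complex
open scoped ENNReal NNReal

lemma hardy_scale (G : ℝ → ℝ≥0∞) (hG : Measurable G) (α s : ℝ) (hs : 0 < s) :
    ∫⁻ β : ℝ, G (α + (β - α) * s) = ENNReal.ofReal s⁻¹ * ∫⁻ x, G x := by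
  have h1 : ∀ β : ℝ, α + (β - α) * s = s * β + (α - α * s) := fun β => by ring
  simp_rw [h1]
  have h2 : Measurable (fun x => G (x + (α - α * s))) := hG.comp (by fun_prop)
  have h3 := lintegral_map (μ := volume) h2 (measurable_const_mul s)
  rw [← h3, Real.map_volume_mul_left hs.ne', lintegral_smul_measure,
    lintegral_add_right_eq_self (fun x => G x), abs_of_pos (by positivity), smul_eq_mul]

lemma hardy_cs (g : ℝ → ℝ≥0∞) (hg : Measurable g) :
    (∫⁻ s in Set.Ioc (0 : ℝ) 1, g s) ^ 2 ≤
      (∫⁻ s in Set.Ioc (0 : ℝ) 1, ENNReal.ofReal (s ^ (-(1 / 2) : ℝ))) *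
        ∫⁻ s in Set.Ioc (0 : ℝ) 1, ENNReal.ofReal (s ^ (1 / 2 : ℝ)) * g s ^ 2 := by
  have hw : Measurable (fun s : ℝ => ENNReal.ofReal (s ^ (-(1 / 4) : ℝ))) := by fun_prop
  have hv : Measurable (fun s : ℝ => ENNReal.ofReal (s ^ (1 / 4 : ℝ)) * g s) := by fun_prop
  have H := ENNReal.lintegral_mul_le_Lp_mul_Lq (volume.restrict (Set.Ioc (0 : ℝ) 1))
    Real.HolderConjugate.two_two hw.aemeasurable hv.aemeasurable
  have e1 : ∫⁻ s in Set.Ioc (0 : ℝ) 1, g s = ∫⁻ s in Set.Ioc (0 : ℝ) 1,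
      ((fun s : ℝ => ENNReal.ofReal (s ^ (-(1 / 4) : ℝ))) *
        (fun s : ℝ => ENNReal.ofReal (s ^ (1 / 4 : ℝ)) * g s)) s := by
    refine setLIntegral_congr_fun measurableSet_Ioc fun s hs => ?_
    simp only [Pi.mul_apply]
    rw [← mul_assoc, ← ENNReal.ofReal_mul (Real.rpow_nonneg hs.1.le _), ← Real.rpow_add hs.1]
    norm_num
  have e2 : ∫⁻ s in Set.Ioc (0 : ℝ) 1, ENNReal.ofReal (s ^ (-(1 / 4) : ℝ)) ^ (2 : ℝ) =
      ∫⁻ s in Set.Ioc (0 : ℝ) 1, ENNReal.ofReal (s ^ (-(1 / 2) : ℝ)) := by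
    refine setLIntegral_congr_fun measurableSet_Ioc fun s hs => ?_
    rw [ENNReal.ofReal_rpow_of_nonneg (Real.rpow_nonneg hs.1.le _) (by norm_num),
      ← Real.rpow_mul hs.1.le]
    norm_num
  have e3 : ∫⁻ s in Set.Ioc (0 : ℝ) 1, (ENNReal.ofReal (s ^ (1 / 4 : ℝ)) * g s) ^ (2 : ℝ) =
      ∫⁻ s in Set.Ioc (0 : ℝ) 1, ENNReal.ofReal (s ^ (1 / 2 : ℝ)) * g s ^ 2 := by
    refine setLIntegral_congr_fun measurableSet_Ioc fun s hs => ?_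
    rw [ENNReal.mul_rpow_of_nonneg _ _ (by norm_num),
      ENNReal.ofReal_rpow_of_nonneg (Real.rpow_nonneg hs.1.le _) (by norm_num),
      ← Real.rpow_mul hs.1.le, ENNReal.rpow_two]
    norm_num
  rw [← e1, e2, e3] at H
  refine (pow_le_pow_left' H 2).trans (le_of_eq ?_)
  rw [mul_pow, ← ENNReal.rpow_two, ← ENNReal.rpow_two, ← ENNReal.rpow_mul, ← ENNReal.rpow_mul]
  norm_num

lemma hardy_pt (f : SchwartzMap ℝ ℂ) (α β : ℝ) :
    ENNReal.ofReal (‖f α - f β‖ ^ 2 / (α - β) ^ 2) ≤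
      (∫⁻ s in Set.Ioc (0 : ℝ) 1, ‖deriv (⇑f) (α + (β - α) * s)‖ₑ) ^ 2 := by
  rcases eq_or_ne α β with rfl | hne
  · simp
  have hc : Continuous (deriv (⇑f)) := (f.smooth 1).continuous_deriv (by norm_num)
  have hd : ∀ s ∈ Set.uIcc (0 : ℝ) 1, HasDerivAt (fun s : ℝ => f (α + (β - α) * s))
      ((β - α) • deriv (⇑f) (α + (β - α) * s)) s := by
    intro s _
    have h1 : HasDerivAt (fun s : ℝ => α + (β - α) * s) (β - α) s := by
      simpa using ((hasDerivAt_id s).const_mul (β - α)).const_add α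
    exact (f.differentiableAt (x := α + (β - α) * s)).hasDerivAt.scomp s h1
  have hI := intervalIntegral.integral_eq_sub_of_hasDerivAt hd
    (Continuous.intervalIntegrable (by fun_prop) _ _)
  rw [intervalIntegral.integral_smul, intervalIntegral.integral_of_le zero_le_one] at hI
  simp only [mul_one, mul_zero, add_zero, add_sub_cancel] at hI
  have hba : β - α ≠ 0 := sub_ne_zero.mpr hne.symm
  have e : ‖f α - f β‖ ^ 2 / (α - β) ^ 2 =
      ‖∫ s in Set.Ioc (0 : ℝ) 1, deriv (⇑f) (α + (β - α) * s)‖ ^ 2 := by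
    rw [norm_sub_rev, ← hI, norm_smul, mul_pow, Real.norm_eq_abs, sq_abs, ← neg_sub β α, neg_sq]
    field_simp
  rw [e, ENNReal.ofReal_pow (norm_nonneg _), ofReal_norm]
  exact pow_le_pow_left' (enorm_integral_le_lintegral_enorm _) 2

/-- Hardy-type inequality: there is a universal `C > 0` with
`∫ |f(α) − f(β)|²/(α − β)² dβ ≤ C‖f'‖_{L²}²` for every Schwartz `f` and every `α`. -/
theorem statement3 : ∃ C : ℝ, 0 < C ∧ ∀ (f : SchwartzMap ℝ ℂ) (α : ℝ),
    (∫⁻ β : ℝ, ENNReal.ofReal (‖f α - f β‖ ^ 2 / (α - β) ^ 2))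
      ≤ ENNReal.ofReal C * eLpNorm (deriv (⇑f)) 2 volume ^ 2 := by
  set K : ℝ≥0∞ := ∫⁻ s in Set.Ioc (0 : ℝ) 1, ENNReal.ofReal (s ^ (-(1 / 2) : ℝ)) with hK
  have hKtop : K ≠ ∞ := by
    have h := (intervalIntegral.intervalIntegrable_rpow' (a := 0) (b := 1)
      (r := -(1 / 2)) (by norm_num)).1
    exact (hasFiniteIntegral_iff_ofReal ((ae_restrict_mem measurableSet_Ioc).mono
      fun s hs => Real.rpow_nonneg hs.1.le _)).1 h.2 |>.ne
  refine ⟨(K * K).toReal + 1, by positivity, fun f α => ?_⟩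
  have hc : Continuous (deriv (⇑f)) := (f.smooth 1).continuous_deriv (by norm_num)
  set G : ℝ → ℝ≥0∞ := fun x => ‖deriv (⇑f) x‖ₑ ^ 2 with hGdef
  have hG : Measurable G := by
    have := hc.enorm.measurable
    fun_prop
  have hN : eLpNorm (deriv (⇑f)) 2 volume ^ 2 = ∫⁻ x, G x := by
    have := eLpNorm_nnreal_pow_eq_lintegral (f := deriv (⇑f)) (μ := volume) (p := 2) (by norm_num)
    simpa using this
  rw [hN]
  calc (∫⁻ β : ℝ, ENNReal.ofReal (‖f α - f β‖ ^ 2 / (α - β) ^ 2))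
      ≤ ∫⁻ β : ℝ, K * ∫⁻ s in Set.Ioc (0 : ℝ) 1,
          ENNReal.ofReal (s ^ (1 / 2 : ℝ)) * G (α + (β - α) * s) := by
        refine lintegral_mono fun β => (hardy_pt f α β).trans ?_
        refine hardy_cs (fun s => ‖deriv (⇑f) (α + (β - α) * s)‖ₑ) ?_
        exact (hc.comp (by fun_prop : Continuous fun s : ℝ => α + (β - α) * s)).enorm.measurable
    _ = K * ∫⁻ s in Set.Ioc (0 : ℝ) 1, ∫⁻ β : ℝ,
          ENNReal.ofReal (s ^ (1 / 2 : ℝ)) * G (α + (β - α) * s) := by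
        rw [lintegral_const_mul' _ _ hKtop, lintegral_lintegral_swap]
        refine Measurable.aemeasurable ?_
        simp only [Function.uncurry_def]
        exact Measurable.mul (by fun_prop) (hG.comp (by fun_prop))
    _ = K * ∫⁻ s in Set.Ioc (0 : ℝ) 1, ENNReal.ofReal (s ^ (-(1 / 2) : ℝ)) * ∫⁻ x, G x := by
        congr 1
        refine setLIntegral_congr_fun measurableSet_Ioc fun s hs => ?_
        rw [lintegral_const_mul' _ _ ENNReal.ofReal_ne_top, hardy_scale G hG α s hs.1, ← mul_assoc,
          ← ENNReal.ofReal_mul (Real.rpow_nonneg hs.1.le _), ← Real.rpow_neg_one,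
          ← Real.rpow_add hs.1]
        norm_num
    _ = K * K * ∫⁻ x, G x := by
        rw [lintegral_mul_const _ (by fun_prop), mul_assoc]
    _ ≤ _ := by
        gcongr
        rw [ENNReal.le_ofReal_iff_toReal_le (ENNReal.mul_ne_top hKtop hKtop) (by positivity)]
        linarith
end

section
/- Let f ∈ 𝒮(ℝ) be a complex-valued Schwartz function and let f̂(ξ) = (1/√(2π)) ∫_ℝ e^{−iαξ} f(α) dα denote its Fourier transform. Then ∫_ℝ |ξ|·|f̂(ξ)|² dξ = (1/(2π)) ∫_ℝ ∫_ℝ |f(α) − f(β)|²/(α − β)² dβ dα, both sides being finite. -/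
open MeasureTheory Complex
open scoped ENNReal NNReal

/-- The Fourier transform with the convention `f̂(ξ) = (1/√(2π)) ∫ e^{−iαξ} f(α) dα`. -/
noncomputable def fourierT (f : ℝ → ℂ) (ξ : ℝ) : ℂ :=
  ((1 / Real.sqrt (2 * Real.pi) : ℝ) : ℂ) *
    ∫ α : ℝ, Complex.exp (-(Complex.I * (α : ℂ) * (ξ : ℂ))) * f α

lemma aux_ftc {g g' : ℝ → ℝ} {l : ℝ} (hd : ∀ x ∈ Set.Ici (0:ℝ), HasDerivAt g (g' x) x)
    (hpos : ∀ x ∈ Set.Ioi (0:ℝ), 0 ≤ g' x) (hl : Filter.Tendsto g Filter.atTop (nhds l)) :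
    ∫⁻ x in Set.Ioi (0:ℝ), ENNReal.ofReal (g' x) = ENNReal.ofReal (l - g 0) := by
  rw [← integral_Ioi_of_hasDerivAt_of_nonneg' hd hpos hl]
  rw [ofReal_integral_eq_lintegral_ofReal (integrableOn_Ioi_deriv_of_nonneg' hd hpos hl)]
  exact (ae_restrict_iff' measurableSet_Ioi).2 (Filter.Eventually.of_forall hpos)

lemma aux_exp {t : ℝ} (ht : 0 < t) :
    Filter.Tendsto (fun u : ℝ => Real.exp (-t * u)) Filter.atTop (nhds 0) := by
  apply Real.tendsto_exp_atBot.comp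
  exact Filter.tendsto_id.const_mul_atTop_of_neg (by linarith)

lemma aux1 {u : ℝ} (hu : 0 < u) :
    ∫⁻ t in Set.Ioi (0:ℝ), ENNReal.ofReal (t * Real.exp (-u * t)) = ENNReal.ofReal (1 / u ^ 2) := by
  rw [aux_ftc (g := fun t => -(t / u + 1 / u ^ 2) * Real.exp (-u * t)) (l := 0)]
  · simp
  · intro t _
    have h1 : HasDerivAt (fun t : ℝ => -(t / u + 1 / u ^ 2)) (-(1 / u)) t :=
      (((hasDerivAt_id t).div_const u).add_const _).neg
    have h2 : HasDerivAt (fun t : ℝ => Real.exp (-u * t)) (Real.exp (-u * t) * (-u * 1)) t :=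
      ((hasDerivAt_id t).const_mul (-u)).exp
    refine (h1.mul h2).congr_deriv ?_
    field_simp
    ring
  · intro t ht
    have : 0 < t := ht
    positivity
  · have h1 : Filter.Tendsto (fun t : ℝ => t * Real.exp (-u * t)) Filter.atTop (nhds 0) := by
      have := Real.tendsto_pow_mul_exp_neg_atTop_nhds_zero 1
      have h := (this.comp (Filter.tendsto_id.const_mul_atTop hu)).const_mul (1 / u)
      simp only [mul_zero] at h
      refine h.congr fun t => ?_
      simp
      field_simp
    have h := ((h1.const_mul (1/u)).add ((aux_exp hu).const_mul (1 / u ^ 2))).neg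
    simp only [mul_zero, add_zero, neg_zero] at h
    refine h.congr fun t => ?_
    ring

lemma aux2 {b t : ℝ} (hb : 0 < b) (ht : 0 < t) :
    ∫⁻ u in Set.Ioi (0:ℝ), ENNReal.ofReal ((1 - Real.cos (b * u)) * Real.exp (-t * u))
      = ENNReal.ofReal (b ^ 2 / (t * (t ^ 2 + b ^ 2))) := by
  rw [aux_ftc (g := fun u => (-(1 / t) + (t * Real.cos (b * u) - b * Real.sin (b * u))
    / (t ^ 2 + b ^ 2)) * Real.exp (-t * u)) (l := 0)]
  · congr 1
    simp
    field_simp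
    ring
  · intro u _
    have hbu : HasDerivAt (fun u : ℝ => b * u) (b * 1) u := (hasDerivAt_id u).const_mul b
    have h1 : HasDerivAt (fun u => -(1 / t) + (t * Real.cos (b * u) - b * Real.sin (b * u))
        / (t ^ 2 + b ^ 2)) ((t * (-Real.sin (b * u) * (b * 1))
        - b * (Real.cos (b * u) * (b * 1))) / (t ^ 2 + b ^ 2)) u :=
      (((hbu.cos.const_mul t).sub (hbu.sin.const_mul b)).div_const
      (t ^ 2 + b ^ 2)).const_add (-(1 / t))
    have h2 : HasDerivAt (fun u : ℝ => Real.exp (-t * u)) (Real.exp (-t * u) * (-t * 1)) u :=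
      ((hasDerivAt_id u).const_mul (-t)).exp
    refine (h1.mul h2).congr_deriv ?_
    field_simp
    ring
  · intro u _
    have := Real.cos_le_one (b * u)
    exact mul_nonneg (by linarith) (Real.exp_pos _).le
  · refine Filter.isBoundedUnder_le_mul_tendsto_zero ?_ (aux_exp ht)
    refine Filter.isBoundedUnder_of ⟨1 / t + (t + b) / (t ^ 2 + b ^ 2), fun u => ?_⟩
    have hc := Real.abs_cos_le_one (b * u)
    have hs := Real.abs_sin_le_one (b * u)
    simp only [Function.comp]
    refine (norm_add_le _ _).trans ?_
    rw [norm_neg, Real.norm_of_nonneg (show 0 ≤ 1 / t by positivity), norm_div,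
      Real.norm_of_nonneg (show 0 ≤ t ^ 2 + b ^ 2 by positivity)]
    gcongr
    refine (norm_sub_le _ _).trans ?_
    rw [norm_mul, norm_mul, Real.norm_of_nonneg ht.le, Real.norm_of_nonneg hb.le]
    simp only [Real.norm_eq_abs]
    nlinarith
  
lemma aux3 {b : ℝ} (hb : 0 < b) :
    ∫⁻ t in Set.Ioi (0:ℝ), ENNReal.ofReal (2 * b ^ 2 / (t ^ 2 + b ^ 2))
      = ENNReal.ofReal (Real.pi * b) := by
  rw [aux_ftc (g := fun t => 2 * b * Real.arctan (t / b)) (l := 2 * b * (Real.pi / 2))]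
  · congr 1
    simp
    ring
  · intro t _
    refine (((hasDerivAt_id t).div_const b).arctan.const_mul (2 * b)).congr_deriv ?_
    simp only [id]
    field_simp
    ring
  · intro t _
    positivity
  · apply Filter.Tendsto.const_mul
    exact (tendsto_nhds_of_tendsto_nhdsWithin Real.tendsto_arctan_atTop).comp (Filter.tendsto_id.atTop_div_const hb)

lemma aux4 {b : ℝ} (hb : 0 < b) :
    ∫⁻ u in Set.Ioi (0:ℝ), ENNReal.ofReal (2 * (1 - Real.cos (b * u)) / u ^ 2)
      = ENNReal.ofReal (Real.pi * b) := by
  calc _ = ∫⁻ u in Set.Ioi (0:ℝ), ∫⁻ t in Set.Ioi (0:ℝ),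
        ENNReal.ofReal (2 * (1 - Real.cos (b * u))) * ENNReal.ofReal (t * Real.exp (-u * t)) := by
        refine setLIntegral_congr_fun measurableSet_Ioi fun u hu => ?_
        have := Real.cos_le_one (b * u)
        beta_reduce
        rw [lintegral_const_mul _ (by fun_prop), aux1 hu, ← ENNReal.ofReal_mul (by linarith)]
        congr 1; ring
    _ = ∫⁻ t in Set.Ioi (0:ℝ), ∫⁻ u in Set.Ioi (0:ℝ),
        ENNReal.ofReal (2 * (1 - Real.cos (b * u))) * ENNReal.ofReal (t * Real.exp (-u * t)) := by
        apply lintegral_lintegral_swap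
        apply Measurable.aemeasurable
        fun_prop
    _ = ∫⁻ t in Set.Ioi (0:ℝ), ENNReal.ofReal (2 * b ^ 2 / (t ^ 2 + b ^ 2)) := by
        refine setLIntegral_congr_fun measurableSet_Ioi fun t ht => ?_
        have ht : 0 < t := ht
        beta_reduce
        have : ∀ u, ENNReal.ofReal (2 * (1 - Real.cos (b * u))) * ENNReal.ofReal (t * Real.exp (-u * t))
          = ENNReal.ofReal (2 * t) * ENNReal.ofReal ((1 - Real.cos (b * u)) * Real.exp (-t * u)) := by
          intro u
          have := Real.cos_le_one (b * u)
          rw [← ENNReal.ofReal_mul (by linarith), ← ENNReal.ofReal_mul (by linarith)]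
          congr 1
          rw [show -u * t = -t * u by ring]
          ring
        simp_rw [this]
        rw [lintegral_const_mul _ (by fun_prop), aux2 hb ht, ← ENNReal.ofReal_mul (by linarith)]
        congr 1
        field_simp
    _ = _ := aux3 hb

lemma aux5 (b : ℝ) :
    ∫⁻ u : ℝ, ENNReal.ofReal (2 * (1 - Real.cos (b * u)) / u ^ 2)
      = ENNReal.ofReal (2 * Real.pi * |b|) := by
  rcases eq_or_ne b 0 with rfl | hb
  · simp
  have hb' : 0 < |b| := abs_pos.2 hb
  have key : ∀ u, Real.cos (b * u) = Real.cos (|b| * u) := by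
    intro u
    rcases abs_choice b with h | h <;> rw [h]
    rw [neg_mul, Real.cos_neg]
  simp_rw [key]
  rw [← lintegral_add_compl _ (measurableSet_Ioi (a := (0:ℝ))), Set.compl_Ioi,
    setLIntegral_congr (Iio_ae_eq_Iic (a := (0:ℝ)) (μ := volume)).symm, aux4 hb']
  have h2 : ∫⁻ u in Set.Iio (0:ℝ), ENNReal.ofReal (2 * (1 - Real.cos (|b| * u)) / u ^ 2)
      = ENNReal.ofReal (Real.pi * |b|) := by
    rw [← aux4 hb']
    have h := (Measure.measurePreserving_neg (volume : Measure ℝ)).setLIntegral_comp_preimage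
      (measurableSet_Ioi (a := (0:ℝ)))
      (f := fun u => ENNReal.ofReal (2 * (1 - Real.cos (|b| * u)) / u ^ 2)) (by fun_prop)
    rw [← h]
    simp
  rw [h2, ← ENNReal.ofReal_add (by positivity) (by positivity)]
  congr 1
  ring

open FourierTransform in
lemma aux6 (f : SchwartzMap ℝ ℂ) (h : ℝ) :
    ∫⁻ α : ℝ, ENNReal.ofReal (‖f α - f (α - h)‖ ^ 2)
      = ∫⁻ η : ℝ, ENNReal.ofReal (‖(𝓕 f) η‖ ^ 2 * (2 * (1 - Real.cos (2 * Real.pi * η * h)))) := by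
  have hi : ∀ g : SchwartzMap ℝ ℂ, Integrable (fun x => ‖g x‖ ^ 2) := fun g =>
    (memLp_two_iff_integrable_sq_norm g.continuous.aestronglyMeasurable).1 (g.memLp 2)
  let T : SchwartzMap ℝ ℂ := f.compSubConstCLM ℂ h
  have hT : ∀ η, (𝓕 T) η = Complex.exp (↑(-(2 * Real.pi * η * h)) * I) * (𝓕 f) η := by
    intro η
    rw [SchwartzMap.fourier_coe, SchwartzMap.fourier_coe, Real.fourier_real_eq_integral_exp_smul,
      Real.fourier_real_eq_integral_exp_smul, ← integral_const_mul,
      ← integral_add_right_eq_self _ h]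
    congr 1
    ext x
    simp only [T, SchwartzMap.compSubConstCLM_apply, add_sub_cancel_right, smul_eq_mul]
    rw [← mul_assoc, ← Complex.exp_add]
    congr 2
    push_cast
    ring
  have hP := SchwartzMap.integral_norm_sq_fourier (f - T)
  have e1 := ofReal_integral_eq_lintegral_ofReal (hi (f - T)) (Filter.Eventually.of_forall fun x => by positivity)
  have e2 := ofReal_integral_eq_lintegral_ofReal (hi (𝓕 (f - T))) (Filter.Eventually.of_forall fun x => by positivity)
  rw [hP, e1] at e2
  refine e2.trans (lintegral_congr fun η => congrArg ENNReal.ofReal ?_)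
  have hs : 𝓕 (f - T) = 𝓕 f - 𝓕 T := map_sub (FourierTransform.fourierCLM ℂ (SchwartzMap ℝ ℂ)) f T
  have this : (𝓕 (f - T)) η = (1 - Complex.exp (↑(-(2 * Real.pi * η * h)) * I)) * (𝓕 f) η := by
    rw [sub_mul, ← hT, one_mul, hs, SchwartzMap.sub_apply]
  rw [this, norm_mul, mul_pow, mul_comm]
  congr 1
  rw [← Complex.normSq_eq_norm_sq, Complex.normSq_apply, Complex.exp_mul_I, ← ofReal_cos, ← ofReal_sin, Real.cos_neg, Real.sin_neg]
  generalize 2 * Real.pi * η * h = θ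
  simp only [sub_re, add_re, mul_re, sub_im, add_im, mul_im, ofReal_re, ofReal_im, I_re, I_im,
    one_re, one_im]
  nlinarith [Real.sin_sq_add_cos_sq θ]

open FourierTransform in
lemma aux7 (f : SchwartzMap ℝ ℂ) :
    (∫⁻ ξ : ℝ, ENNReal.ofReal (|ξ| * ‖fourierT (⇑f) ξ‖ ^ 2))
      = ENNReal.ofReal (2 * Real.pi) * ∫⁻ η : ℝ, ENNReal.ofReal (|η| * ‖(𝓕 f) η‖ ^ 2) := by
  have hpi := Real.pi_pos
  have h1 : ∀ η : ℝ, fourierT (⇑f) (2 * Real.pi * η)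
      = ((1 / Real.sqrt (2 * Real.pi) : ℝ) : ℂ) * (𝓕 f) η := by
    intro η
    rw [SchwartzMap.fourier_coe, Real.fourier_real_eq_integral_exp_smul, fourierT]
    congr 2
    ext x
    rw [smul_eq_mul]
    congr 2
    push_cast
    ring
  have h2 : ∀ ξ : ℝ, fourierT (⇑f) ξ
      = ((1 / Real.sqrt (2 * Real.pi) : ℝ) : ℂ) * (𝓕 f) (ξ / (2 * Real.pi)) := by
    intro ξ
    rw [← h1]
    congr 1
    field_simp
  have hm : Measurable fun ξ : ℝ => ENNReal.ofReal (|ξ| * ‖fourierT (⇑f) ξ‖ ^ 2) := by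
    have := (𝓕 f).continuous
    simp_rw [h2]
    fun_prop
  have h3 := Real.smul_map_volume_mul_left (a := 2 * Real.pi) (by positivity)
  conv_lhs => rw [← h3]
  rw [lintegral_smul_measure, lintegral_map hm (by fun_prop), abs_of_pos (by positivity), smul_eq_mul]
  congr 1
  refine lintegral_congr fun η => congrArg ENNReal.ofReal ?_
  rw [h1, norm_mul, mul_pow, abs_mul, abs_of_pos (show 0 < 2 * Real.pi by positivity), Complex.norm_real,
    Real.norm_of_nonneg (by positivity), div_pow, Real.sq_sqrt (by positivity)]
  field_simp

open FourierTransform in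
lemma aux8 (f : SchwartzMap ℝ ℂ) :
    (∫⁻ α : ℝ, ∫⁻ β : ℝ, ENNReal.ofReal (‖f α - f β‖ ^ 2 / (α - β) ^ 2))
      = ENNReal.ofReal (4 * Real.pi ^ 2) * ∫⁻ η : ℝ, ENNReal.ofReal (|η| * ‖(𝓕 f) η‖ ^ 2) := by
  have hpi := Real.pi_pos
  have hf := f.continuous
  have hF := (𝓕 f).continuous
  calc _ = ∫⁻ α : ℝ, ∫⁻ h : ℝ, ENNReal.ofReal (‖f α - f (α - h)‖ ^ 2 / h ^ 2) := by
        refine lintegral_congr fun α => ?_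
        rw [← lintegral_sub_left_eq_self _ α]
        simp
    _ = ∫⁻ h : ℝ, ∫⁻ α : ℝ, ENNReal.ofReal (‖f α - f (α - h)‖ ^ 2 / h ^ 2) := by
        apply lintegral_lintegral_swap
        apply Measurable.aemeasurable
        fun_prop
    _ = ∫⁻ h : ℝ, ∫⁻ η : ℝ, ENNReal.ofReal (‖(𝓕 f) η‖ ^ 2) *
          ENNReal.ofReal (2 * (1 - Real.cos (2 * Real.pi * η * h)) / h ^ 2) := by
        refine lintegral_congr fun h => ?_
        have e1 : ∀ α, ENNReal.ofReal (‖f α - f (α - h)‖ ^ 2 / h ^ 2)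
            = ENNReal.ofReal (1 / h ^ 2) * ENNReal.ofReal (‖f α - f (α - h)‖ ^ 2) := by
          intro α
          rw [← ENNReal.ofReal_mul (by positivity)]
          congr 1; ring
        simp_rw [e1]
        rw [lintegral_const_mul _ (by fun_prop), aux6, ← lintegral_const_mul _ (by fun_prop)]
        refine lintegral_congr fun η => ?_
        rw [← ENNReal.ofReal_mul (by positivity), ← ENNReal.ofReal_mul (by positivity)]
        congr 1; ring
    _ = ∫⁻ η : ℝ, ∫⁻ h : ℝ, ENNReal.ofReal (‖(𝓕 f) η‖ ^ 2) *
          ENNReal.ofReal (2 * (1 - Real.cos (2 * Real.pi * η * h)) / h ^ 2) := by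
        apply lintegral_lintegral_swap
        apply Measurable.aemeasurable
        fun_prop
    _ = _ := by
        rw [← lintegral_const_mul _ (by fun_prop)]
        refine lintegral_congr fun η => ?_
        rw [lintegral_const_mul _ (by fun_prop), aux5, ← ENNReal.ofReal_mul (by positivity),
          ← ENNReal.ofReal_mul (by positivity), abs_mul,
          abs_of_pos (show 0 < 2 * Real.pi by positivity)]
        congr 1; ring

open FourierTransform in
lemma aux9 (F : SchwartzMap ℝ ℂ) :
    (∫⁻ η : ℝ, ENNReal.ofReal (|η| * ‖F η‖ ^ 2)) < ⊤ := by
  have hF := F.continuous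
  have h1 := F.integrable_pow_mul volume 1
  have h2 : Integrable fun η : ℝ => |η| * ‖F η‖ ^ 2 := by
    refine (h1.mul_const (SchwartzMap.seminorm ℝ 0 0 F)).mono'
      (by fun_prop) (Filter.Eventually.of_forall fun x => ?_)
    have := SchwartzMap.norm_le_seminorm ℝ F x
    rw [Real.norm_of_nonneg (by positivity), pow_one, Real.norm_eq_abs, pow_two, ← mul_assoc]
    gcongr
  exact h2.lintegral_lt_top

/-- for Schwartz `f`,
`∫ |ξ||f̂(ξ)|² dξ = (1/(2π)) ∫∫ |f(α) − f(β)|²/(α − β)² dβ dα`, both sides being finite. -/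
theorem statement5 (f : SchwartzMap ℝ ℂ) :
    (∫⁻ ξ : ℝ, ENNReal.ofReal (|ξ| * ‖fourierT (⇑f) ξ‖ ^ 2))
      = ENNReal.ofReal (1 / (2 * Real.pi)) *
        (∫⁻ α : ℝ, ∫⁻ β : ℝ, ENNReal.ofReal (‖f α - f β‖ ^ 2 / (α - β) ^ 2)) ∧
    (∫⁻ ξ : ℝ, ENNReal.ofReal (|ξ| * ‖fourierT (⇑f) ξ‖ ^ 2)) < ⊤ := by
  have hpi := Real.pi_pos
  refine ⟨?_, ?_⟩
  · rw [aux7, aux8, ← mul_assoc, ← ENNReal.ofReal_mul (by positivity)]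
    congr 2
    field_simp
    ring
  · rw [aux7]
    exact ENNReal.mul_lt_top ENNReal.ofReal_lt_top (aux9 _)
end

section
/- There exists a universal constant C > 0 such that for all complex-valued Schwartz functions f, g, h ∈ 𝒮(ℝ), the function [f, g; h](α) := (1/(iπ)) ∫_ℝ ((f(α) − f(β))/(α − β))·((g(α) − g(β))/(α − β))·h(β) dβ satisfies ‖[f, g; h]‖_{L²(ℝ)} ≤ C·‖f'‖_{L²(ℝ)}·‖g'‖_{L²(ℝ)}·‖h‖_{L²(ℝ)}. -/
open MeasureTheory Complex
open scoped ENNReal NNReal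

lemma aux_cs {μ : Measure ℝ} {u v : ℝ → ℝ≥0∞} (hu : AEMeasurable u μ) (hv : AEMeasurable v μ) :
    (∫⁻ x, u x * v x ∂μ) ^ 2 ≤ (∫⁻ x, u x ^ 2 ∂μ) * ∫⁻ x, v x ^ 2 ∂μ := by
  have h := ENNReal.lintegral_mul_le_Lp_mul_Lq μ Real.HolderConjugate.two_two hu hv
  have h2 := pow_le_pow_left₀ zero_le h 2
  refine h2.trans (le_of_eq ?_)
  rw [mul_pow, ← ENNReal.rpow_mul_natCast, ← ENNReal.rpow_mul_natCast]
  norm_num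

lemma aux_scale (G : ℝ → ℝ≥0∞) (hG : Measurable G) (b t : ℝ) (ht : 0 < t) :
    ∫⁻ a, G (b + t * (a - b)) = ENNReal.ofReal (t⁻¹) * ∫⁻ a, G a := by
  rw [lintegral_sub_right_eq_self (fun a => G (b + t * a)) b]
  have h := Real.map_volume_mul_left ht.ne'
  have h2 : ∫⁻ a, G (b + t * a) = ∫⁻ y, G (b + y) ∂(Measure.map (t * ·) volume) := by
    rw [lintegral_map (by fun_prop) (by fun_prop)]
  rw [h2, h, lintegral_smul_measure, lintegral_add_left_eq_self, abs_of_pos (by positivity)]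
  rfl

lemma aux_rpow : ∫⁻ t in Set.Ioc (0:ℝ) 1, ENNReal.ofReal (t ^ (-(1/2) : ℝ)) = 2 := by
  rw [← ofReal_integral_eq_lintegral_ofReal]
  · rw [← intervalIntegral.integral_of_le zero_le_one, integral_rpow (by left; norm_num)]
    norm_num
  · rw [← IntegrableOn, ← intervalIntegrable_iff_integrableOn_Ioc_of_le zero_le_one]
    exact intervalIntegral.intervalIntegrable_rpow' (by norm_num)
  · filter_upwards [ae_restrict_mem measurableSet_Ioc] with t ht
    exact Real.rpow_nonneg ht.1.le _

lemma aux_point (f : SchwartzMap ℝ ℂ) (a b : ℝ) :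
    ‖(f a - f b) / ((a - b : ℝ) : ℂ)‖ₑ ≤
      ∫⁻ t in Set.Ioc (0:ℝ) 1, ‖deriv f (b + t * (a - b))‖ₑ := by
  rcases eq_or_ne a b with rfl | hab
  · simp
  have hc : Continuous (deriv f) := (f.smooth 1).continuous_deriv le_rfl
  have h1 : ∫ t in (0:ℝ)..1, ((a - b : ℝ) : ℂ) * deriv f (b + t * (a - b)) = f a - f b := by
    rw [intervalIntegral.integral_eq_sub_of_hasDerivAt (f := fun t : ℝ => f (b + t * (a - b)))]
    · simp
    · intro t _
      have h2 : HasDerivAt (fun t : ℝ => b + t * (a - b)) (a - b) t := by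
        simpa using ((hasDerivAt_id t).mul_const (a - b)).const_add b
      have h3 := (f.differentiable.differentiableAt (x := b + t * (a - b))).hasDerivAt.scomp t h2
      simpa [Function.comp_def] using h3
    · exact Continuous.intervalIntegrable (by fun_prop) _ _
  have hne : ((a - b : ℝ) : ℂ) ≠ 0 := by
    exact_mod_cast sub_ne_zero.2 hab
  rw [intervalIntegral.integral_const_mul] at h1
  rw [← h1, mul_div_cancel_left₀ _ hne, intervalIntegral.integral_of_le zero_le_one]
  exact enorm_integral_le_lintegral_enorm _

lemma aux_hardy (f : SchwartzMap ℝ ℂ) (b : ℝ) :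
    ∫⁻ a, ‖(f a - f b) / ((a - b : ℝ) : ℂ)‖ₑ ^ 2 ≤ 4 * ∫⁻ a, ‖deriv f a‖ₑ ^ 2 := by
  have hc : Continuous (deriv f) := (f.smooth 1).continuous_deriv le_rfl
  have hm : Measurable (deriv f) := hc.measurable
  have hp : ∀ a, ‖(f a - f b) / ((a - b : ℝ) : ℂ)‖ₑ ^ 2 ≤
      2 * ∫⁻ t in Set.Ioc (0:ℝ) 1,
        ENNReal.ofReal (t ^ (1/2 : ℝ)) * ‖deriv f (b + t * (a - b))‖ₑ ^ 2 := by
    intro a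
    refine (pow_le_pow_left₀ zero_le (aux_point f a b) 2).trans ?_
    have e1 : ∫⁻ t in Set.Ioc (0:ℝ) 1, ‖deriv f (b + t * (a - b))‖ₑ =
        ∫⁻ t in Set.Ioc (0:ℝ) 1, ENNReal.ofReal (t ^ (-(1/4) : ℝ)) *
          (ENNReal.ofReal (t ^ (1/4 : ℝ)) * ‖deriv f (b + t * (a - b))‖ₑ) := by
      refine setLIntegral_congr_fun measurableSet_Ioc ?_
      intro t ht
      have h0 : 0 < t := ht.1
      simp only
      rw [← mul_assoc, ← ENNReal.ofReal_mul (by positivity), ← Real.rpow_add h0]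
      norm_num
    rw [e1]
    refine (aux_cs (by fun_prop) (by fun_prop)).trans (le_of_eq ?_)
    congr 1
    · rw [← aux_rpow]
      refine setLIntegral_congr_fun measurableSet_Ioc ?_
      intro t ht
      have h0 : 0 < t := ht.1
      simp only
      rw [← ENNReal.ofReal_pow (by positivity), ← Real.rpow_mul_natCast h0.le]
      norm_num
    · refine setLIntegral_congr_fun measurableSet_Ioc ?_
      intro t ht
      have h0 : 0 < t := ht.1
      simp only
      rw [mul_pow, ← ENNReal.ofReal_pow (by positivity), ← Real.rpow_mul_natCast h0.le]
      norm_num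
  refine (lintegral_mono hp).trans (le_of_eq ?_)
  rw [lintegral_const_mul' _ _ (by norm_num), lintegral_lintegral_swap (by fun_prop)]
  have e2 : ∫⁻ t in Set.Ioc (0:ℝ) 1, ∫⁻ a,
        ENNReal.ofReal (t ^ (1/2 : ℝ)) * ‖deriv f (b + t * (a - b))‖ₑ ^ 2 =
      ∫⁻ t in Set.Ioc (0:ℝ) 1, ENNReal.ofReal (t ^ (-(1/2) : ℝ)) *
        ∫⁻ a, ‖deriv f a‖ₑ ^ 2 := by
    refine setLIntegral_congr_fun measurableSet_Ioc ?_
    intro t ht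
    have h0 : 0 < t := ht.1
    simp only
    rw [lintegral_const_mul' _ _ ENNReal.ofReal_ne_top,
      aux_scale (fun x => ‖deriv f x‖ₑ ^ 2) (by fun_prop) b t h0, ← mul_assoc,
      ← ENNReal.ofReal_mul (by positivity), ← Real.rpow_neg_one, ← Real.rpow_add h0]
    norm_num
  rw [e2, lintegral_mul_const _ (by fun_prop), aux_rpow, ← mul_assoc]
  norm_num

lemma aux_norm (F : ℝ → ℂ) : eLpNorm F 2 volume ^ 2 = ∫⁻ a, ‖F a‖ₑ ^ 2 := by
  have := eLpNorm_nnreal_pow_eq_lintegral (f := F) (μ := volume) (p := 2) (by norm_num)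
  simpa using this

lemma aux_symm (f : SchwartzMap ℝ ℂ) (a b : ℝ) :
    (f a - f b) / ((a - b : ℝ) : ℂ) = (f b - f a) / ((b - a : ℝ) : ℂ) := by
  rw [← neg_sub (f b), ← neg_sub b, Complex.ofReal_neg, neg_div_neg_eq]

/-- there is a universal `C > 0` so that for Schwartz `f, g, h`, the triple
bracket `[f, g; h](α) = (1/(iπ)) ∫ ((f(α)−f(β))/(α−β))((g(α)−g(β))/(α−β)) h(β) dβ`
satisfies `‖[f, g; h]‖_{L²} ≤ C‖f'‖_{L²}‖g'‖_{L²}‖h‖_{L²}`. -/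
theorem statement10 : ∃ C : ℝ, 0 < C ∧ ∀ f g h : SchwartzMap ℝ ℂ,
    eLpNorm (fun α : ℝ => (1 / (Complex.I * (Real.pi : ℂ))) *
        ∫ β : ℝ, ((f α - f β) / ((α - β : ℝ) : ℂ)) *
          ((g α - g β) / ((α - β : ℝ) : ℂ)) * h β) 2 volume
      ≤ ENNReal.ofReal C * eLpNorm (deriv (⇑f)) 2 volume *
          eLpNorm (deriv (⇑g)) 2 volume * eLpNorm (⇑h) 2 volume := by
  refine ⟨4, by norm_num, fun f g h => ?_⟩
  have hf : Measurable f := f.continuous.measurable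
  have hg : Measurable g := g.continuous.measurable
  have hh : Measurable h := h.continuous.measurable
  rw [← ENNReal.pow_le_pow_left_iff (n := 2) (by norm_num)]
  simp only [mul_pow, aux_norm]
  have hpi : ‖1 / (Complex.I * (Real.pi : ℂ))‖ₑ ≤ 1 := by
    rw [← ofReal_norm, ENNReal.ofReal_le_one]
    simp only [norm_div, norm_mul, norm_one, Complex.norm_I, Complex.norm_real, one_mul,
      Real.norm_eq_abs, abs_of_pos Real.pi_pos]
    rw [div_le_one Real.pi_pos]
    linarith [Real.pi_gt_three]
  have hp : ∀ α : ℝ, ‖(1 / (Complex.I * (Real.pi : ℂ))) *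
        ∫ β : ℝ, ((f α - f β) / ((α - β : ℝ) : ℂ)) *
          ((g α - g β) / ((α - β : ℝ) : ℂ)) * h β‖ₑ ^ 2 ≤
      (4 * ∫⁻ a, ‖deriv f a‖ₑ ^ 2) *
        ∫⁻ β, ‖h β‖ₑ ^ 2 * ‖(g α - g β) / ((α - β : ℝ) : ℂ)‖ₑ ^ 2 := by
    intro α
    have h1 : ‖(1 / (Complex.I * (Real.pi : ℂ))) *
        ∫ β : ℝ, ((f α - f β) / ((α - β : ℝ) : ℂ)) *
          ((g α - g β) / ((α - β : ℝ) : ℂ)) * h β‖ₑ ≤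
        ∫⁻ β, ‖(f α - f β) / ((α - β : ℝ) : ℂ)‖ₑ *
          (‖h β‖ₑ * ‖(g α - g β) / ((α - β : ℝ) : ℂ)‖ₑ) := by
      rw [enorm_mul]
      refine (mul_le_of_le_one_left zero_le hpi).trans ?_
      refine (enorm_integral_le_lintegral_enorm _).trans (le_of_eq ?_)
      congr 1 with β
      rw [enorm_mul, enorm_mul]
      ring
    refine (pow_le_pow_left₀ zero_le h1 2).trans ?_
    refine (aux_cs (by fun_prop) (by fun_prop)).trans ?_
    simp only [mul_pow]
    gcongr
    simp only [aux_symm f α]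
    exact aux_hardy f α
  refine (lintegral_mono hp).trans ?_
  have hmm : Measurable (fun α : ℝ =>
      ∫⁻ β, ‖h β‖ₑ ^ 2 * ‖(g α - g β) / ((α - β : ℝ) : ℂ)‖ₑ ^ 2) :=
    Measurable.lintegral_prod_right' (f := fun p : ℝ × ℝ =>
      ‖h p.2‖ₑ ^ 2 * ‖(g p.1 - g p.2) / ((p.1 - p.2 : ℝ) : ℂ)‖ₑ ^ 2) (by fun_prop)
  rw [lintegral_const_mul _ hmm,
    lintegral_lintegral_swap (by fun_prop)]
  have h3 : ∫⁻ β, ∫⁻ α, ‖h β‖ₑ ^ 2 * ‖(g α - g β) / ((α - β : ℝ) : ℂ)‖ₑ ^ 2 ≤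
      ∫⁻ β, ‖h β‖ₑ ^ 2 * (4 * ∫⁻ a, ‖deriv g a‖ₑ ^ 2) := by
    refine lintegral_mono fun β => ?_
    simp only
    rw [lintegral_const_mul _ (by fun_prop)]
    gcongr
    exact aux_hardy g β
  rw [lintegral_mul_const _ (by fun_prop)] at h3
  refine (mul_le_mul_right h3 _).trans (le_of_eq ?_)
  rw [ENNReal.ofReal_ofNat]
  ring
end

section
/- There exists a universal constant C > 0 such that for all complex-valued Schwartz functions f, g, h ∈ 𝒮(ℝ), the function [f, g; h'](α) := (1/(iπ)) ∫_ℝ ((f(α) − f(β))/(α − β))·((g(α) − g(β))/(α − β))·h'(β) dβ satisfies ‖[f, g; h']‖_{L²(ℝ)} ≤ C·‖f'‖_{L^∞(ℝ)}·‖g'‖_{L^∞(ℝ)}·‖h‖_{L²(ℝ)}. -/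
open MeasureTheory Complex
open scoped ENNReal NNReal

section
open MeasureTheory Set Filter Topology

namespace CC

/-- Continuous on `s > 0`, with decay `1/(1+z^2)`, locally uniformly in `s`. -/
structure Nice (u : ℝ → ℝ → ℝ) : Prop where
  cont : ContinuousOn (fun p : ℝ × ℝ => u p.1 p.2) (Ioi 0 ×ˢ univ)
  bd : ∀ a b : ℝ, 0 < a → ∃ C : ℝ, ∀ s ∈ Icc a b, ∀ z, |u s z| ≤ C * (1 + z ^ 2)⁻¹

theorem Nice.add {u v : ℝ → ℝ → ℝ} (hu : Nice u) (hv : Nice v) :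
    Nice (fun s z => u s z + v s z) := by
  refine ⟨hu.cont.add hv.cont, fun a b ha => ?_⟩
  obtain ⟨C, hC⟩ := hu.bd a b ha
  obtain ⟨D, hD⟩ := hv.bd a b ha
  refine ⟨C + D, fun s hs z => ?_⟩
  rw [add_mul]
  exact (abs_add_le _ _).trans (add_le_add (hC s hs z) (hD s hs z))

theorem Nice.neg {u : ℝ → ℝ → ℝ} (hu : Nice u) : Nice (fun s z => - u s z) := by
  refine ⟨hu.cont.neg, fun a b ha => ?_⟩
  obtain ⟨C, hC⟩ := hu.bd a b ha
  exact ⟨C, fun s hs z => by rw [abs_neg]; exact hC s hs z⟩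

theorem Nice.sub {u v : ℝ → ℝ → ℝ} (hu : Nice u) (hv : Nice v) :
    Nice (fun s z => u s z - v s z) := by
  simpa [sub_eq_add_neg] using hu.add hv.neg

theorem Nice.mul {u v : ℝ → ℝ → ℝ} (hu : Nice u) (hv : Nice v) :
    Nice (fun s z => u s z * v s z) := by
  refine ⟨hu.cont.mul hv.cont, fun a b ha => ?_⟩
  obtain ⟨C, hC⟩ := hu.bd a b ha
  obtain ⟨D, hD⟩ := hv.bd a b ha
  refine ⟨C * D, fun s hs z => ?_⟩
  have h1 := hC s hs z
  have h2 := hD s hs z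
  have hp : (0:ℝ) < 1 + z ^ 2 := by positivity
  have h0 : 0 ≤ C * (1 + z ^ 2)⁻¹ := (abs_nonneg _).trans h1
  have h0' : 0 ≤ D * (1 + z ^ 2)⁻¹ := (abs_nonneg _).trans h2
  have hC0 : 0 ≤ C := by
    by_contra h
    have := mul_neg_of_neg_of_pos (not_le.1 h) (inv_pos.2 hp)
    linarith
  have hD0 : 0 ≤ D := by
    by_contra h
    have := mul_neg_of_neg_of_pos (not_le.1 h) (inv_pos.2 hp)
    linarith
  have hi : (1 + z ^ 2)⁻¹ ≤ 1 := inv_le_one_of_one_le₀ (by nlinarith [sq_nonneg z])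
  rw [abs_mul]
  calc |u s z| * |v s z| ≤ (C * (1 + z ^ 2)⁻¹) * (D * (1 + z ^ 2)⁻¹) :=
        mul_le_mul h1 h2 (abs_nonneg _) h0
    _ ≤ (C * (1 + z ^ 2)⁻¹) * (D * 1) := by gcongr
    _ = _ := by ring

theorem Nice.tmul {u : ℝ → ℝ → ℝ} (τ : ℝ → ℝ) (hτ : ContinuousOn τ (Ioi 0)) (hu : Nice u) :
    Nice (fun s z => τ s * u s z) := by
  refine ⟨ContinuousOn.mul (hτ.comp continuousOn_fst (fun p hp => hp.1)) hu.cont, fun a b ha => ?_⟩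
  obtain ⟨C, hC⟩ := hu.bd a b ha
  obtain ⟨D, hD⟩ := (isCompact_Icc (a := a) (b := b)).exists_bound_of_continuousOn
    (hτ.mono (fun s hs => lt_of_lt_of_le ha hs.1))
  refine ⟨D * C, fun s hs z => ?_⟩
  rw [abs_mul, mul_assoc]
  exact mul_le_mul (hD s hs) (hC s hs z) (abs_nonneg _) ((norm_nonneg _).trans (hD s hs))

theorem Nice.cmul {u : ℝ → ℝ → ℝ} (c : ℝ) (hu : Nice u) : Nice (fun s z => c * u s z) :=
  hu.tmul (fun _ => c) continuousOn_const

theorem Nice.spow {u : ℝ → ℝ → ℝ} (n : ℕ) (hu : Nice u) : Nice (fun s z => s ^ n * u s z) :=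
  hu.tmul (fun s => s ^ n) (by fun_prop)

theorem Nice.smul' {u : ℝ → ℝ → ℝ} (hu : Nice u) : Nice (fun s z => s * u s z) :=
  hu.tmul (fun s => s) (by fun_prop)

theorem Nice.sinv {u : ℝ → ℝ → ℝ} (n : ℕ) (hu : Nice u) : Nice (fun s z => s⁻¹ ^ n * u s z) :=
  hu.tmul (fun s => s⁻¹ ^ n)
    ((continuousOn_inv₀.mono (fun _ hs => ne_of_gt hs)).pow n)

theorem Nice.sq {u : ℝ → ℝ → ℝ} (hu : Nice u) : Nice (fun s z => u s z ^ 2) := by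
  simpa [pow_two] using hu.mul hu

theorem Nice.congr {u v : ℝ → ℝ → ℝ} (hu : Nice u) (h : ∀ s > 0, ∀ z, v s z = u s z) : Nice v := by
  refine ⟨hu.cont.congr (fun p hp => h p.1 hp.1 p.2), fun a b ha => ?_⟩
  obtain ⟨C, hC⟩ := hu.bd a b ha
  exact ⟨C, fun s hs z => by rw [h s (lt_of_lt_of_le ha hs.1)]; exact hC s hs z⟩

theorem Nice.continuous {u : ℝ → ℝ → ℝ} (hu : Nice u) {s : ℝ} (hs : 0 < s) : Continuous (u s) := by
  have : ContinuousOn (fun z : ℝ => u s z) univ :=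
    hu.cont.comp (f := fun z : ℝ => (s, z)) (by fun_prop) (fun z _ => ⟨hs, mem_univ _⟩)
  exact continuousOn_univ.1 this

theorem Nice.integrable {u : ℝ → ℝ → ℝ} (hu : Nice u) {s : ℝ} (hs : 0 < s) : Integrable (u s) := by
  obtain ⟨C, hC⟩ := hu.bd s s hs
  refine (integrable_inv_one_add_sq.const_mul C).mono' (hu.continuous hs).aestronglyMeasurable ?_
  exact Eventually.of_forall (fun z => hC s ⟨le_rfl, le_rfl⟩ z)

theorem Nice.contInt {u : ℝ → ℝ → ℝ} (hu : Nice u) :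
    ContinuousOn (fun s => ∫ z, u s z) (Ioi 0) := by
  intro s hs
  have hs : 0 < s := hs
  obtain ⟨C, hC⟩ := hu.bd (s / 2) (2 * s) (by positivity)
  have hmem : Icc (s / 2) (2 * s) ∈ 𝓝 s := Icc_mem_nhds (by linarith) (by linarith)
  refine ContinuousAt.continuousWithinAt ?_
  refine continuousAt_of_dominated (bound := fun z => C * (1 + z ^ 2)⁻¹) ?_ ?_
    (integrable_inv_one_add_sq.const_mul C) ?_
  · filter_upwards [Ioi_mem_nhds hs] with r hr
    exact (hu.continuous hr).aestronglyMeasurable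
  · filter_upwards [hmem] with r hr
    exact Eventually.of_forall (fun z => hC r hr z)
  · refine Eventually.of_forall (fun z => ?_)
    have h1 : ContinuousAt (fun p : ℝ × ℝ => u p.1 p.2) (s, z) :=
      hu.cont.continuousAt ((isOpen_Ioi.prod isOpen_univ).mem_nhds ⟨hs, mem_univ _⟩)
    exact ContinuousAt.comp (f := fun r : ℝ => (r, z)) h1 (by fun_prop)

/-- Space-time integral over `[ε,T] × ℝ`. -/
noncomputable def II (ε T : ℝ) (u : ℝ → ℝ → ℝ) : ℝ := ∫ s in ε..T, ∫ z, u s z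

variable {ε T : ℝ}

theorem Nice.ii (hε : 0 < ε) (hT : ε ≤ T) {u : ℝ → ℝ → ℝ} (hu : Nice u) :
    IntervalIntegrable (fun s => ∫ z, u s z) volume ε T := by
  apply ContinuousOn.intervalIntegrable
  rw [uIcc_of_le hT]
  exact hu.contInt.mono (fun s hs => lt_of_lt_of_le hε hs.1)

theorem II_add (hε : 0 < ε) (hT : ε ≤ T) {u v : ℝ → ℝ → ℝ} (hu : Nice u) (hv : Nice v) :
    II ε T (fun s z => u s z + v s z) = II ε T u + II ε T v := by
  unfold II
  rw [← intervalIntegral.integral_add (hu.ii hε hT) (hv.ii hε hT)]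
  refine intervalIntegral.integral_congr (fun s hs => ?_)
  rw [uIcc_of_le hT] at hs
  have : 0 < s := lt_of_lt_of_le hε hs.1
  exact integral_add (hu.integrable this) (hv.integrable this)

theorem II_cmul (c : ℝ) (u : ℝ → ℝ → ℝ) :
    II ε T (fun s z => c * u s z) = c * II ε T u := by
  unfold II
  simp_rw [integral_const_mul]
  exact intervalIntegral.integral_const_mul _ _

theorem II_neg (u : ℝ → ℝ → ℝ) : II ε T (fun s z => - u s z) = - II ε T u := by
  have := II_cmul (ε := ε) (T := T) (-1) u
  simpa using this

theorem II_sub (hε : 0 < ε) (hT : ε ≤ T) {u v : ℝ → ℝ → ℝ} (hu : Nice u) (hv : Nice v) :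
    II ε T (fun s z => u s z - v s z) = II ε T u - II ε T v := by
  simp only [sub_eq_add_neg]
  rw [II_add hε hT hu hv.neg, II_neg]

theorem II_congr (hε : 0 < ε) (hT : ε ≤ T) {u v : ℝ → ℝ → ℝ} (h : ∀ s > 0, ∀ z, u s z = v s z) :
    II ε T u = II ε T v := by
  unfold II
  refine intervalIntegral.integral_congr (fun s hs => ?_)
  rw [uIcc_of_le hT] at hs
  have : 0 < s := lt_of_lt_of_le hε hs.1
  exact integral_congr_ae (Eventually.of_forall (fun z => h s this z))

theorem II_mono (hε : 0 < ε) (hT : ε ≤ T) {u v : ℝ → ℝ → ℝ} (hu : Nice u) (hv : Nice v)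
    (h : ∀ s > 0, ∀ z, u s z ≤ v s z) : II ε T u ≤ II ε T v := by
  unfold II
  refine intervalIntegral.integral_mono_on hT (hu.ii hε hT) (hv.ii hε hT) (fun s hs => ?_)
  have : 0 < s := lt_of_lt_of_le hε hs.1
  exact integral_mono (hu.integrable this) (hv.integrable this) (h s this)

theorem II_nonneg (hε : 0 < ε) (hT : ε ≤ T) {u : ℝ → ℝ → ℝ}
    (h : ∀ s > 0, ∀ z, 0 ≤ u s z) : 0 ≤ II ε T u := by
  unfold II
  refine intervalIntegral.integral_nonneg hT (fun s hs => integral_nonneg (h s ?_))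
  exact lt_of_lt_of_le hε hs.1

/-- `u` with its `z`-derivative. -/
structure DX (u ux : ℝ → ℝ → ℝ) : Prop where
  n : Nice u
  nx : Nice ux
  dx : ∀ s > 0, ∀ z, HasDerivAt (u s) (ux s z) z

/-- `u` with its `z`- and `s`-derivatives. -/
structure HD (u ux us : ℝ → ℝ → ℝ) : Prop extends DX u ux where
  ns : Nice us
  ds : ∀ s > 0, ∀ z, HasDerivAt (fun r => u r z) (us s z) s

theorem DX.add {u ux v vx : ℝ → ℝ → ℝ} (hu : DX u ux) (hv : DX v vx) :
    DX (fun s z => u s z + v s z) (fun s z => ux s z + vx s z) :=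
  ⟨hu.n.add hv.n, hu.nx.add hv.nx, fun s hs z => (hu.dx s hs z).add (hv.dx s hs z)⟩

theorem DX.sub {u ux v vx : ℝ → ℝ → ℝ} (hu : DX u ux) (hv : DX v vx) :
    DX (fun s z => u s z - v s z) (fun s z => ux s z - vx s z) :=
  ⟨hu.n.sub hv.n, hu.nx.sub hv.nx, fun s hs z => (hu.dx s hs z).sub (hv.dx s hs z)⟩

theorem DX.mul {u ux v vx : ℝ → ℝ → ℝ} (hu : DX u ux) (hv : DX v vx) :
    DX (fun s z => u s z * v s z) (fun s z => ux s z * v s z + u s z * vx s z) :=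
  ⟨hu.n.mul hv.n, (hu.nx.mul hv.n).add (hu.n.mul hv.nx),
    fun s hs z => (hu.dx s hs z).mul (hv.dx s hs z)⟩

theorem DX.tmul {u ux : ℝ → ℝ → ℝ} (τ : ℝ → ℝ) (hτ : ContinuousOn τ (Ioi 0)) (hu : DX u ux) :
    DX (fun s z => τ s * u s z) (fun s z => τ s * ux s z) :=
  ⟨hu.n.tmul τ hτ, hu.nx.tmul τ hτ, fun s hs z => (hu.dx s hs z).const_mul (τ s)⟩

theorem DX.cmul {u ux : ℝ → ℝ → ℝ} (c : ℝ) (hu : DX u ux) :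
    DX (fun s z => c * u s z) (fun s z => c * ux s z) := hu.tmul (fun _ => c) continuousOn_const

theorem DX.smul' {u ux : ℝ → ℝ → ℝ} (hu : DX u ux) :
    DX (fun s z => s * u s z) (fun s z => s * ux s z) := hu.tmul (fun s => s) (by fun_prop)

theorem DX.spow {u ux : ℝ → ℝ → ℝ} (n : ℕ) (hu : DX u ux) :
    DX (fun s z => s ^ n * u s z) (fun s z => s ^ n * ux s z) :=
  hu.tmul (fun s => s ^ n) (by fun_prop)

theorem DX.sinv {u ux : ℝ → ℝ → ℝ} (n : ℕ) (hu : DX u ux) :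
    DX (fun s z => s⁻¹ ^ n * u s z) (fun s z => s⁻¹ ^ n * ux s z) :=
  hu.tmul (fun s => s⁻¹ ^ n) ((continuousOn_inv₀.mono (fun _ hs => ne_of_gt hs)).pow n)

theorem HD.add {u ux us v vx vs : ℝ → ℝ → ℝ} (hu : HD u ux us) (hv : HD v vx vs) :
    HD (fun s z => u s z + v s z) (fun s z => ux s z + vx s z) (fun s z => us s z + vs s z) :=
  ⟨hu.toDX.add hv.toDX, hu.ns.add hv.ns, fun s hs z => (hu.ds s hs z).add (hv.ds s hs z)⟩

theorem HD.sub {u ux us v vx vs : ℝ → ℝ → ℝ} (hu : HD u ux us) (hv : HD v vx vs) :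
    HD (fun s z => u s z - v s z) (fun s z => ux s z - vx s z) (fun s z => us s z - vs s z) :=
  ⟨hu.toDX.sub hv.toDX, hu.ns.sub hv.ns, fun s hs z => (hu.ds s hs z).sub (hv.ds s hs z)⟩

theorem HD.mul {u ux us v vx vs : ℝ → ℝ → ℝ} (hu : HD u ux us) (hv : HD v vx vs) :
    HD (fun s z => u s z * v s z) (fun s z => ux s z * v s z + u s z * vx s z)
      (fun s z => us s z * v s z + u s z * vs s z) :=
  ⟨hu.toDX.mul hv.toDX, (hu.ns.mul hv.n).add (hu.n.mul hv.ns),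
    fun s hs z => (hu.ds s hs z).mul (hv.ds s hs z)⟩

theorem HD.tmul {u ux us : ℝ → ℝ → ℝ} (τ τ' : ℝ → ℝ) (hτ : ContinuousOn τ (Ioi 0))
    (hτ' : ContinuousOn τ' (Ioi 0)) (hd : ∀ s > 0, HasDerivAt τ (τ' s) s) (hu : HD u ux us) :
    HD (fun s z => τ s * u s z) (fun s z => τ s * ux s z)
      (fun s z => τ' s * u s z + τ s * us s z) :=
  ⟨hu.toDX.tmul τ hτ, (hu.n.tmul τ' hτ').add (hu.ns.tmul τ hτ),
    fun s hs z => (hd s hs).mul (hu.ds s hs z)⟩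

theorem HD.cmul {u ux us : ℝ → ℝ → ℝ} (c : ℝ) (hu : HD u ux us) :
    HD (fun s z => c * u s z) (fun s z => c * ux s z) (fun s z => c * us s z) :=
  ⟨hu.toDX.cmul c, hu.ns.cmul c, fun s hs z => (hu.ds s hs z).const_mul c⟩

theorem HD.spow {u ux us : ℝ → ℝ → ℝ} (n : ℕ) (hu : HD u ux us) :
    HD (fun s z => s ^ n * u s z) (fun s z => s ^ n * ux s z)
      (fun s z => (n * s ^ (n - 1)) * u s z + s ^ n * us s z) :=
  hu.tmul (fun s => s ^ n) (fun s => n * s ^ (n - 1)) (by fun_prop) (by fun_prop)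
    (fun s _ => hasDerivAt_pow n s)

theorem HD.sinv {u ux us : ℝ → ℝ → ℝ} (n : ℕ) (hu : HD u ux us) :
    HD (fun s z => s⁻¹ ^ n * u s z) (fun s z => s⁻¹ ^ n * ux s z)
      (fun s z => (n * s⁻¹ ^ (n - 1) * (-(s ^ 2)⁻¹)) * u s z + s⁻¹ ^ n * us s z) := by
  have hc : ContinuousOn (fun s : ℝ => s⁻¹) (Ioi 0) :=
    continuousOn_inv₀.mono (fun _ hs => ne_of_gt hs)
  refine hu.tmul (fun s => s⁻¹ ^ n) (fun s => n * s⁻¹ ^ (n - 1) * (-(s ^ 2)⁻¹)) (hc.pow n) ?_ ?_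
  · refine (continuousOn_const.mul (hc.pow _)).mul (ContinuousOn.neg ?_)
    exact (hc.pow 2).congr (fun s _ => by simp)
  · intro s hs
    exact (hasDerivAt_inv (ne_of_gt hs)).pow n

theorem DX.int_zero {u ux : ℝ → ℝ → ℝ} (hu : DX u ux) {s : ℝ} (hs : 0 < s) :
    ∫ z, ux s z = 0 :=
  integral_eq_zero_of_hasDerivAt_of_integrable (hu.dx s hs) (hu.nx.integrable hs)
    (hu.n.integrable hs)

theorem II_dx (hε : 0 < ε) (hT : ε ≤ T) {u ux : ℝ → ℝ → ℝ} (hu : DX u ux) : II ε T ux = 0 := by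
  unfold II
  have : ∫ s in ε..T, ∫ z, ux s z = ∫ s in ε..T, (0:ℝ) := by
    refine intervalIntegral.integral_congr (fun s hs => ?_)
    rw [uIcc_of_le hT] at hs
    exact hu.int_zero (lt_of_lt_of_le hε hs.1)
  rw [this]; simp

theorem II_ds (hε : 0 < ε) (hT : ε ≤ T) {u ux us : ℝ → ℝ → ℝ} (hu : HD u ux us) :
    II ε T us = (∫ z, u T z) - ∫ z, u ε z := by
  unfold II
  refine intervalIntegral.integral_eq_sub_of_hasDerivAt (f := fun s => ∫ z, u s z) ?_
    (hu.ns.ii hε hT)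
  intro s hs
  rw [uIcc_of_le hT] at hs
  have hs : 0 < s := lt_of_lt_of_le hε hs.1
  obtain ⟨C, hC⟩ := hu.ns.bd (s / 2) (2 * s) (by positivity)
  refine (hasDerivAt_integral_of_dominated_loc_of_deriv_le (F := u) (F' := us)
    (bound := fun z => C * (1 + z ^ 2)⁻¹)
    (Icc_mem_nhds (by linarith : s / 2 < s) (by linarith : s < 2 * s)) ?_ (hu.n.integrable hs)
    (hu.ns.continuous hs).aestronglyMeasurable ?_ (integrable_inv_one_add_sq.const_mul C) ?_).2
  · filter_upwards [Ioi_mem_nhds hs] with r hr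
    exact (hu.n.continuous hr).aestronglyMeasurable
  · exact Eventually.of_forall (fun z r hr => hC r hr z)
  · refine Eventually.of_forall (fun z r hr => hu.ds r ?_ z)
    exact lt_of_lt_of_le (by positivity) hr.1

/-- basic energy identity -/
theorem key_eq (hε : 0 < ε) (hT : ε ≤ T) {X Xx Xs G Gx Y R : ℝ → ℝ → ℝ} (hX : HD X Xx Xs)
    (hG : DX G Gx) (hR : Nice R)
    (h : ∀ s > 0, ∀ z, Y s z = R s z - Xs s z + Gx s z) :
    II ε T Y = II ε T R + (∫ z, X ε z) - ∫ z, X T z := by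
  rw [II_congr hε hT h, II_add hε hT (hR.sub hX.ns) hG.nx, II_sub hε hT hR hX.ns,
    II_ds hε hT hX, II_dx hε hT hG]
  ring

/-- basic energy inequality -/
theorem key_le (hε : 0 < ε) (hT : ε ≤ T) {X Xx Xs G Gx Y R : ℝ → ℝ → ℝ} (hX : HD X Xx Xs)
    (hG : DX G Gx) (hY : Nice Y) (hR : Nice R)
    (h : ∀ s > 0, ∀ z, Y s z ≤ R s z - Xs s z + Gx s z) :
    II ε T Y ≤ II ε T R + (∫ z, X ε z) - ∫ z, X T z := by
  refine (II_mono hε hT hY ((hR.sub hX.ns).add hG.nx) h).trans ?_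
  rw [II_add hε hT (hR.sub hX.ns) hG.nx, II_sub hε hT hR hX.ns,
    II_ds hε hT hX, II_dx hε hT hG]
  linarith

theorem II_abs_le (hε : 0 < ε) (hT : ε ≤ T) {u v : ℝ → ℝ → ℝ} (hu : Nice u) (hv : Nice v)
    (h : ∀ s > 0, ∀ z, |u s z| ≤ v s z) : |II ε T u| ≤ II ε T v := by
  rw [abs_le]
  constructor
  · rw [← II_neg]
    exact II_mono hε hT hv.neg hu (fun s hs z => (abs_le.1 (h s hs z)).1)
  · exact II_mono hε hT hu hv (fun s hs z => (abs_le.1 (h s hs z)).2)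

end CC

open MeasureTheory Set Filter Topology

namespace CC

/-- standard Gaussian density -/
noncomputable def G (y : ℝ) : ℝ := (√(2 * Real.pi))⁻¹ * Real.exp (-(1 / 2) * y ^ 2)

theorem G_nonneg (y : ℝ) : 0 ≤ G y := by unfold G; positivity

theorem G_cont : Continuous G := by unfold G; fun_prop

theorem G_deriv (y : ℝ) : HasDerivAt G (-y * G y) y := by
  unfold G
  have h1 : HasDerivAt (fun y : ℝ => -(1 / 2) * y ^ 2) (-y) y := by
    have := ((hasDerivAt_pow 2 y).const_mul (-(1 / 2) : ℝ))
    refine this.congr_deriv ?_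
    norm_num
    ring
  refine ((h1.exp).const_mul ((√(2 * Real.pi))⁻¹)).congr_deriv ?_
  ring

theorem G_pow (n : ℕ) : Integrable (fun y => y ^ n * G y) := by
  have h := integrable_rpow_mul_exp_neg_mul_sq (b := 1 / 2) (by norm_num) (s := (n : ℝ))
    (by have : (0:ℝ) ≤ n := n.cast_nonneg
        linarith)
  simp only [Real.rpow_natCast] at h
  refine (h.const_mul ((√(2 * Real.pi))⁻¹)).congr (Eventually.of_forall (fun y => ?_))
  simp only [G]; ring

theorem G_int : Integrable G := by simpa using G_pow 0

theorem G_one : ∫ y, G y = 1 := by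
  unfold G
  rw [integral_const_mul, integral_gaussian]
  have : Real.pi / (1 / 2) = 2 * Real.pi := by ring
  rw [this]
  exact inv_mul_cancel₀ (by positivity)

theorem G_wt : Integrable (fun y => (1 + y ^ 2) ^ 2 * G y) := by
  refine (((G_pow 0).add ((G_pow 2).const_mul 2)).add (G_pow 4)).congr
    (Eventually.of_forall (fun y => ?_))
  simp only [Pi.add_apply]; ring

/-- fourth-moment constant -/
noncomputable def M : ℝ := ∫ y, (1 + y ^ 2) ^ 2 * G y

theorem M_one : 1 ≤ M := by
  rw [← G_one]
  refine integral_mono G_int G_wt (fun y => ?_)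
  have : (1:ℝ) ≤ (1 + y ^ 2) ^ 2 := by nlinarith [sq_nonneg y, sq_nonneg (y ^ 2)]
  simpa using mul_le_mul_of_nonneg_right this (G_nonneg y)

theorem intG {m : ℝ → ℝ} (hm : Continuous m) (c : ℝ) (h : ∀ y, |m y| ≤ c * (1 + y ^ 2) ^ 2) :
    Integrable (fun y => m y * G y) := by
  refine (G_wt.const_mul c).mono' (hm.mul G_cont).aestronglyMeasurable
    (Eventually.of_forall (fun y => ?_))
  rw [Real.norm_eq_abs, abs_mul, abs_of_nonneg (G_nonneg y), ← mul_assoc]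
  exact mul_le_mul_of_nonneg_right (h y) (G_nonneg y)

theorem absG {m : ℝ → ℝ} (hm : Continuous m) (c : ℝ) (h : ∀ y, |m y| ≤ c * (1 + y ^ 2) ^ 2) :
    |∫ y, m y * G y| ≤ c * M := by
  unfold M
  rw [← integral_const_mul, ← Real.norm_eq_abs]
  refine norm_integral_le_of_norm_le (G_wt.const_mul c) (Eventually.of_forall (fun y => ?_))
  rw [Real.norm_eq_abs, abs_mul, abs_of_nonneg (G_nonneg y), ← mul_assoc]
  exact mul_le_mul_of_nonneg_right (h y) (G_nonneg y)

theorem one_le_wt (y : ℝ) : (1:ℝ) ≤ (1 + y ^ 2) ^ 2 := by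
  nlinarith [sq_nonneg y, sq_nonneg (y ^ 2)]

theorem wt_le_wt (y : ℝ) : (1 + y ^ 2) ≤ (1 + y ^ 2) ^ 2 := by
  nlinarith [sq_nonneg y, sq_nonneg (y ^ 2)]

theorem abs_le_wt (y : ℝ) : |y| ≤ 1 + y ^ 2 := by
  rw [abs_le]; constructor <;> nlinarith [sq_nonneg (y - 1), sq_nonneg (y + 1), sq_nonneg y]

abbrev S := SchwartzMap ℝ ℝ

/-- product of Schwartz functions -/
noncomputable def mu (φ ψ : S) : S := SchwartzMap.smulLeftCLM ℝ (⇑φ) ψ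

theorem mu_apply (φ ψ : S) (x : ℝ) : mu φ ψ x = φ x * ψ x := by
  unfold mu
  rw [SchwartzMap.smulLeftCLM_apply_apply φ.hasTemperateGrowth]; rfl

/-- derivative -/
noncomputable def D (φ : S) : S := SchwartzMap.derivCLM ℝ ℝ φ

theorem D_apply (φ : S) (x : ℝ) : D φ x = deriv φ x := SchwartzMap.derivCLM_apply ℝ φ x

theorem D_has (φ : S) (x : ℝ) : HasDerivAt φ (D φ x) x := by
  rw [D_apply]; exact φ.differentiableAt.hasDerivAt

theorem D_mu (φ ψ : S) : D (mu φ ψ) = mu (D φ) ψ + mu φ (D ψ) := by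
  ext x
  have h : HasDerivAt (mu φ ψ) (D φ x * ψ x + φ x * D ψ x) x := by
    refine ((D_has φ x).mul (D_has ψ x)).congr_of_eventuallyEq (Eventually.of_forall (fun y => ?_))
    exact mu_apply φ ψ y
  rw [D_apply, h.deriv, add_apply, mu_apply, mu_apply]

theorem S_decay (φ : S) : ∃ C : ℝ, 0 ≤ C ∧ ∀ x, |φ x| ≤ C * (1 + x ^ 2)⁻¹ := by
  obtain ⟨A, hA0, hA⟩ := φ.decay 0 0
  obtain ⟨B, hB0, hB⟩ := φ.decay 2 0
  refine ⟨A + B, by positivity, fun x => ?_⟩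
  have h1 := hA x
  have h2 := hB x
  simp only [norm_iteratedFDeriv_zero, Real.norm_eq_abs, pow_zero, one_mul, sq_abs] at h1 h2
  rw [← div_eq_mul_inv, le_div_iff₀ (by positivity)]
  linarith

theorem S_bdd (φ : S) : ∃ C : ℝ, 0 ≤ C ∧ ∀ x, |φ x| ≤ C := by
  obtain ⟨C, h0, h⟩ := S_decay φ
  refine ⟨C, h0, fun x => (h x).trans ?_⟩
  exact mul_le_of_le_one_right h0 (inv_le_one_of_one_le₀ (by nlinarith [sq_nonneg x]))

/-- heat extension -/
noncomputable def U (φ : S) (s z : ℝ) : ℝ := ∫ y, φ (z - s * y) * G y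

theorem U_int (φ : S) (s z : ℝ) : Integrable (fun y => φ (z - s * y) * G y) := by
  obtain ⟨C, h0, h⟩ := S_bdd φ
  have := φ.continuous
  refine intG (by fun_prop) C (fun y => (h _).trans ?_)
  exact le_mul_of_one_le_right h0 (one_le_wt y)

theorem U_add (φ ψ : S) (s z : ℝ) : U (φ + ψ) s z = U φ s z + U ψ s z := by
  unfold U
  rw [← integral_add (U_int φ s z) (U_int ψ s z)]
  congr 1; ext y; simp [add_mul]

theorem U_nice (φ : S) : Nice (U φ) := by
  obtain ⟨C, h0, h⟩ := S_decay φ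
  obtain ⟨B, hB0, hB⟩ := S_bdd φ
  have hc := φ.continuous
  constructor
  · apply Continuous.continuousOn
    unfold U
    refine continuous_of_dominated (bound := fun y => B * G y) ?_ ?_ (G_int.const_mul B) ?_
    · intro p
      exact (U_int φ p.1 p.2).aestronglyMeasurable
    · refine fun p => Eventually.of_forall (fun y => ?_)
      rw [Real.norm_eq_abs, abs_mul, abs_of_nonneg (G_nonneg y)]
      exact mul_le_mul_of_nonneg_right (hB _) (G_nonneg y)
    · refine Eventually.of_forall (fun y => ?_)
      fun_prop
  · intro a b ha
    refine ⟨2 * (1 + b ^ 2) * C * M, fun s hs z => ?_⟩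
    have hp : (0:ℝ) < 1 + z ^ 2 := by positivity
    have key : ∀ y, |φ (z - s * y)| ≤ (2 * (1 + b ^ 2) * C * (1 + z ^ 2)⁻¹) * (1 + y ^ 2) ^ 2 := by
      intro y
      refine (h _).trans ?_
      have hs2 : s ^ 2 ≤ b ^ 2 := by nlinarith [hs.1, hs.2]
      have h1 : 1 + z ^ 2 ≤ 2 * (1 + b ^ 2) * (1 + y ^ 2) ^ 2 * (1 + (z - s * y) ^ 2) := by
        have e1 : 1 + z ^ 2 ≤ 2 * (1 + (z - s * y) ^ 2) * (1 + s ^ 2 * y ^ 2) := by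
          nlinarith [sq_nonneg (z - 2 * (s * y)), sq_nonneg ((z - s * y) * (s * y)), sq_nonneg (z - s * y), sq_nonneg (s*y)]
        have e2 : 1 + s ^ 2 * y ^ 2 ≤ (1 + b ^ 2) * (1 + y ^ 2) ^ 2 := by
          have : s ^ 2 * y ^ 2 ≤ b ^ 2 * y ^ 2 := by gcongr
          have := wt_le_wt y
          nlinarith [sq_nonneg b, sq_nonneg y, mul_nonneg (sq_nonneg b) (sq_nonneg y)]
        calc _ ≤ _ := e1
          _ ≤ 2 * (1 + (z - s * y) ^ 2) * ((1 + b ^ 2) * (1 + y ^ 2) ^ 2) := by gcongr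
          _ = _ := by ring
      have hq : (0:ℝ) < 1 + (z - s * y) ^ 2 := by positivity
      have h2 : (1 + (z - s * y) ^ 2)⁻¹ ≤ 2 * (1 + b ^ 2) * (1 + y ^ 2) ^ 2 * (1 + z ^ 2)⁻¹ := by
        rw [inv_le_iff_one_le_mul₀ hq, mul_right_comm, mul_comm _ ((1 + z ^ 2)⁻¹), ← div_eq_inv_mul,
          le_div_iff₀ hp]
        linarith
      calc C * (1 + (z - s * y) ^ 2)⁻¹ ≤ C * (2 * (1 + b ^ 2) * (1 + y ^ 2) ^ 2 * (1 + z ^ 2)⁻¹) := by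
            gcongr
        _ = _ := by ring
    have := absG (m := fun y => φ (z - s * y)) (by fun_prop) _ key
    calc |U φ s z| ≤ _ := this
      _ = _ := by ring

theorem U_dx (φ : S) (s z : ℝ) : HasDerivAt (U φ s) (U (D φ) s z) z := by
  obtain ⟨B, hB0, hB⟩ := S_bdd (D φ)
  refine (hasDerivAt_integral_of_dominated_loc_of_deriv_le
    (F := fun z y => φ (z - s * y) * G y) (F' := fun z y => D φ (z - s * y) * G y)
    (bound := fun y => B * G y) univ_mem ?_ (U_int φ s z)
    (U_int (D φ) s z).aestronglyMeasurable ?_ (G_int.const_mul B) ?_).2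
  · exact Eventually.of_forall (fun z => (U_int φ s z).aestronglyMeasurable)
  · refine Eventually.of_forall (fun y z _ => ?_)
    rw [Real.norm_eq_abs, abs_mul, abs_of_nonneg (G_nonneg y)]
    exact mul_le_mul_of_nonneg_right (hB _) (G_nonneg y)
  · refine Eventually.of_forall (fun y z _ => ?_)
    have := (D_has φ (z - s * y)).comp z ((hasDerivAt_id z).sub_const (s * y))
    simpa using this.mul_const (G y)

theorem yU_int (φ : S) (s z : ℝ) : Integrable (fun y => φ (z - s * y) * (-y * G y)) := by
  obtain ⟨C, h0, h⟩ := S_bdd φ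
  have := φ.continuous
  have h := intG (m := fun y => φ (z - s * y) * (-y)) (by fun_prop) C (fun y => ?_)
  · simpa [mul_assoc] using h
  · rw [abs_mul, abs_neg]
    exact mul_le_mul (h _) ((abs_le_wt y).trans (wt_le_wt y)) (abs_nonneg _) h0

/-- Gaussian integration by parts -/
theorem U_ibp (φ : S) (s z : ℝ) :
    ∫ y, φ (z - s * y) * (-y * G y) = s * U (D φ) s z := by
  have hd : ∀ y, HasDerivAt (fun y => φ (z - s * y)) (D φ (z - s * y) * (-s)) y := by
    intro y
    have h2 : HasDerivAt (fun y => z - s * y) (-s) y := by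
      simpa using ((hasDerivAt_id y).const_mul s).const_sub z
    exact (D_has φ (z - s * y)).comp y h2
  have h := integral_mul_deriv_eq_deriv_mul_of_integrable (u := fun y => φ (z - s * y))
    (u' := fun y => D φ (z - s * y) * (-s)) (v := G) (v' := fun y => -y * G y)
    (fun y _ => hd y) (fun y _ => G_deriv y) (yU_int φ s z) ?_ (U_int φ s z)
  · rw [h, ← integral_neg]
    unfold U
    rw [← integral_const_mul]
    congr 1; ext y; ring
  · refine ((U_int (D φ) s z).const_mul (-s)).congr (Eventually.of_forall (fun y => ?_))
    simp only [Pi.mul_apply]; ring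

theorem U_ds (φ : S) (s z : ℝ) : HasDerivAt (fun r => U φ r z) (s * U (D (D φ)) s z) s := by
  obtain ⟨B, hB0, hB⟩ := S_bdd (D φ)
  rw [← U_ibp]
  refine (hasDerivAt_integral_of_dominated_loc_of_deriv_le
    (F := fun s y => φ (z - s * y) * G y) (F' := fun s y => D φ (z - s * y) * (-y * G y))
    (bound := fun y => B * ((1 + y ^ 2) ^ 2 * G y)) univ_mem ?_ (U_int φ s z)
    (yU_int (D φ) s z).aestronglyMeasurable ?_ (G_wt.const_mul B) ?_).2
  · exact Eventually.of_forall (fun s => (U_int φ s z).aestronglyMeasurable)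
  · refine Eventually.of_forall (fun y s _ => ?_)
    rw [Real.norm_eq_abs, abs_mul, abs_mul, abs_of_nonneg (G_nonneg y), abs_neg]
    have := (abs_le_wt y).trans (wt_le_wt y)
    have hG := G_nonneg y
    have := hB (z - s * y)
    gcongr
  · refine Eventually.of_forall (fun y s _ => ?_)
    have h2 : HasDerivAt (fun s => z - s * y) (-y) s := by
      simpa using ((hasDerivAt_id s).mul_const y).const_sub z
    have := ((D_has φ (z - s * y)).comp s h2).mul_const (G y)
    simpa [mul_assoc] using this

theorem U_DX (φ : S) : DX (U φ) (U (D φ)) := ⟨U_nice _, U_nice _, fun s _ z => U_dx φ s z⟩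

theorem U_HD (φ : S) : HD (U φ) (U (D φ)) (fun s z => s * U (D (D φ)) s z) :=
  ⟨U_DX φ, (U_nice _).smul', fun s _ z => U_ds φ s z⟩

/-- Cauchy-Schwarz -/
theorem csG (φ : S) (s z c : ℝ) {m : ℝ → ℝ} (hm : Continuous m)
    (h : ∀ y, |m y| ≤ c * (1 + y ^ 2)) :
    (∫ y, m y * φ (z - s * y) * G y) ^ 2 ≤ c ^ 2 * M * U (mu φ φ) s z := by
  obtain ⟨B, hB0, hB⟩ := S_bdd φ
  have hc := φ.continuous
  have hc0 : 0 ≤ c := by simpa using (abs_nonneg _).trans (h 0)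
  have hmm : ∀ y, m y ^ 2 ≤ c ^ 2 * (1 + y ^ 2) ^ 2 := by
    intro y
    rw [← mul_pow, ← sq_abs]
    exact pow_le_pow_left₀ (abs_nonneg _) (h y) 2
  have i1 : Integrable (fun y => m y ^ 2 * G y) :=
    intG (by fun_prop) (c ^ 2) (fun y => by rw [abs_of_nonneg (sq_nonneg _)]; exact hmm y)
  have i2 : Integrable (fun y => m y * φ (z - s * y) * G y) := by
    refine intG (by fun_prop) (c * B) (fun y => ?_)
    rw [abs_mul]
    calc _ ≤ (c * (1 + y ^ 2)) * B := mul_le_mul (h y) (hB _) (abs_nonneg _) (by positivity)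
      _ ≤ (c * (1 + y ^ 2) ^ 2) * B := by have := wt_le_wt y; gcongr
      _ = _ := by ring
  have i3 := U_int (mu φ φ) s z
  have hquad : ∀ x : ℝ, 0 ≤ (∫ y, m y ^ 2 * G y) * (x * x) +
      (-2 * ∫ y, m y * φ (z - s * y) * G y) * x + U (mu φ φ) s z := by
    intro x
    have : 0 ≤ ∫ y, (x * m y - φ (z - s * y)) ^ 2 * G y :=
      integral_nonneg (fun y => mul_nonneg (sq_nonneg _) (G_nonneg y))
    have e : ∫ y, (x * m y - φ (z - s * y)) ^ 2 * G y = (x * x) * (∫ y, m y ^ 2 * G y) +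
        (-2 * x) * (∫ y, m y * φ (z - s * y) * G y) + U (mu φ φ) s z := by
      unfold U
      have i12 : Integrable (fun y => (x * x) * (m y ^ 2 * G y) +
          (-2 * x) * (m y * φ (z - s * y) * G y)) := (i1.const_mul _).add (i2.const_mul _)
      rw [← integral_const_mul, ← integral_const_mul, ← integral_add (i1.const_mul _) (i2.const_mul _),
        ← integral_add i12 i3]
      congr 1; ext y; rw [mu_apply]; ring
    rw [e] at this
    linarith
  have hd := discrim_le_zero hquad
  unfold discrim at hd
  have hA : ∫ y, m y ^ 2 * G y ≤ c ^ 2 * M := by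
    refine (le_abs_self _).trans (absG (by fun_prop) (c ^ 2) (fun y => ?_))
    rw [abs_of_nonneg (sq_nonneg _)]; exact hmm y
  have hU : 0 ≤ U (mu φ φ) s z := by
    refine integral_nonneg (fun y => mul_nonneg ?_ (G_nonneg y))
    rw [mu_apply]; exact mul_self_nonneg _
  nlinarith [mul_le_mul_of_nonneg_right hA hU]

end CC

open MeasureTheory Set Filter Topology

namespace CC

/-- `u` solves `u_s = s (u_zz + r)`, with `u1 = u_z`. -/
structure Ht (u u1 r : ℝ → ℝ → ℝ) : Prop where
  ex : ∃ u2, HD u u1 (fun s z => s * (u2 s z + r s z)) ∧ DX u1 u2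
  nr : Nice r

theorem Ht.n {u u1 r : ℝ → ℝ → ℝ} (h : Ht u u1 r) : Nice u := by
  obtain ⟨_, h1, _⟩ := h.ex
  exact h1.n

theorem Ht.n1 {u u1 r : ℝ → ℝ → ℝ} (h : Ht u u1 r) : Nice u1 := by
  obtain ⟨_, h1, _⟩ := h.ex
  exact h1.nx

theorem Ht.dx {u u1 r : ℝ → ℝ → ℝ} (h : Ht u u1 r) : DX u u1 := by
  obtain ⟨_, h1, _⟩ := h.ex
  exact h1.toDX

theorem HD.congr' {u ux us vx vs : ℝ → ℝ → ℝ} (h : HD u ux us)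
    (h1 : ∀ s > 0, ∀ z, vx s z = ux s z) (h2 : ∀ s > 0, ∀ z, vs s z = us s z) : HD u vx vs :=
  ⟨⟨h.n, h.nx.congr h1, fun s hs z => by rw [h1 s hs]; exact h.dx s hs z⟩, h.ns.congr h2,
    fun s hs z => by rw [h2 s hs]; exact h.ds s hs z⟩

theorem Ht.congr {u u1 r v1 p : ℝ → ℝ → ℝ} (h : Ht u u1 r)
    (h1 : ∀ s > 0, ∀ z, v1 s z = u1 s z) (h2 : ∀ s > 0, ∀ z, p s z = r s z) : Ht u v1 p := by
  obtain ⟨⟨u2, ha, hb⟩, hn⟩ := h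
  refine ⟨⟨u2, ha.congr' h1 (fun s hs z => by rw [h2 s hs]), hb.n.congr h1, hb.nx, ?_⟩, hn.congr h2⟩
  intro s hs z
  have : v1 s = u1 s := funext (h1 s hs)
  rw [this]
  exact hb.dx s hs z

theorem U_Ht (φ : S) : Ht (U φ) (U (D φ)) (fun _ _ => 0) := by
  have h0 : Nice (fun _ _ => (0:ℝ)) := by simpa using (U_nice φ).cmul 0
  exact ⟨⟨U (D (D φ)), (U_HD φ).congr' (fun _ _ _ => rfl) (fun _ _ _ => by simp), U_DX _⟩, h0⟩

theorem Ht.sub {u u1 r v v1 p : ℝ → ℝ → ℝ} (h : Ht u u1 r) (h' : Ht v v1 p) :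
    Ht (fun s z => u s z - v s z) (fun s z => u1 s z - v1 s z) (fun s z => r s z - p s z) := by
  obtain ⟨⟨u2, ha, hb⟩, hn⟩ := h
  obtain ⟨⟨v2, ha', hb'⟩, hn'⟩ := h'
  refine ⟨⟨_, (ha.sub ha').congr' (fun _ _ _ => rfl) (fun _ _ _ => ?_), hb.sub hb'⟩, hn.sub hn'⟩
  ring

theorem Ht.add {u u1 r v v1 p : ℝ → ℝ → ℝ} (h : Ht u u1 r) (h' : Ht v v1 p) :
    Ht (fun s z => u s z + v s z) (fun s z => u1 s z + v1 s z) (fun s z => r s z + p s z) := by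
  obtain ⟨⟨u2, ha, hb⟩, hn⟩ := h
  obtain ⟨⟨v2, ha', hb'⟩, hn'⟩ := h'
  refine ⟨⟨_, (ha.add ha').congr' (fun _ _ _ => rfl) (fun _ _ _ => ?_), hb.add hb'⟩, hn.add hn'⟩
  ring

theorem Ht.cmul {u u1 r : ℝ → ℝ → ℝ} (c : ℝ) (h : Ht u u1 r) :
    Ht (fun s z => c * u s z) (fun s z => c * u1 s z) (fun s z => c * r s z) := by
  obtain ⟨⟨u2, ha, hb⟩, hn⟩ := h
  refine ⟨⟨_, (ha.cmul c).congr' (fun _ _ _ => rfl) (fun _ _ _ => ?_), hb.cmul c⟩, hn.cmul c⟩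
  ring

theorem Ht.mul {u u1 r v v1 p : ℝ → ℝ → ℝ} (h : Ht u u1 r) (h' : Ht v v1 p) :
    Ht (fun s z => u s z * v s z) (fun s z => u1 s z * v s z + u s z * v1 s z)
      (fun s z => r s z * v s z + u s z * p s z - 2 * (u1 s z * v1 s z)) := by
  obtain ⟨⟨u2, ha, hb⟩, hn⟩ := h
  obtain ⟨⟨v2, ha', hb'⟩, hn'⟩ := h'
  refine ⟨⟨_, (ha.mul ha').congr' (fun _ _ _ => rfl) (fun _ _ _ => ?_),
    (hb.mul ha'.toDX).add (ha.toDX.mul hb')⟩,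
    ((hn.mul ha'.n).add (ha.n.mul hn')).sub ((hb.n.mul hb'.n).cmul 2)⟩
  ring

theorem Ht.sinv2 {u u1 r : ℝ → ℝ → ℝ} (h : Ht u u1 r) :
    Ht (fun s z => s⁻¹ ^ 2 * u s z) (fun s z => s⁻¹ ^ 2 * u1 s z)
      (fun s z => s⁻¹ ^ 2 * r s z - 2 * (s⁻¹ ^ 4 * u s z)) := by
  obtain ⟨⟨u2, ha, hb⟩, hn⟩ := h
  refine ⟨⟨_, (ha.sinv 2).congr' (fun _ _ _ => rfl) (fun s hs z => ?_), hb.sinv 2⟩,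
    (hn.sinv 2).sub ((ha.n.sinv 4).cmul 2)⟩
  have : s ≠ 0 := ne_of_gt hs
  norm_num
  field_simp
  ring

/-- Admissible time weight. -/
structure Wt (τ τ' : ℝ → ℝ) : Prop where
  c : ContinuousOn τ (Ioi 0)
  c' : ContinuousOn τ' (Ioi 0)
  d : ∀ s > 0, HasDerivAt τ (τ' s) s

variable {ε T : ℝ}

theorem Ht_le (hε : 0 < ε) (hT : ε ≤ T) {X X1 ρ Y R V : ℝ → ℝ → ℝ} {τ τ' : ℝ → ℝ} {c B : ℝ}
    (hX : Ht X X1 ρ) (hτ : Wt τ τ') (hY : Nice Y) (hR : Nice R) (hV : Nice V) (hc : 0 ≤ c)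
    (hVB : ∀ s > 0, ∫ z, V s z ≤ B)
    (hb : ∀ s > 0, ∀ z, |τ s * X s z| ≤ c * V s z)
    (h : ∀ s > 0, ∀ z, Y s z ≤ R s z - (τ' s * X s z + s * τ s * ρ s z)) :
    II ε T Y ≤ II ε T R + 2 * (c * B) := by
  obtain ⟨⟨X2, ha, hx⟩, hn⟩ := hX
  have hk := key_le hε hT (ha.tmul τ τ' hτ.c hτ.c' hτ.d) ((hx.tmul τ hτ.c).smul') hY hR
    (fun s hs z => by
      have := h s hs z
      linarith)
  have hbd : ∀ s > 0, |∫ z, τ s * X s z| ≤ c * B := by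
    intro s hs
    refine (abs_integral_le_integral_abs).trans ?_
    refine (integral_mono_of_nonneg (Eventually.of_forall (fun z => abs_nonneg _))
      ((hV.integrable hs).const_mul c) (Eventually.of_forall (hb s hs))).trans ?_
    rw [integral_const_mul]
    exact mul_le_mul_of_nonneg_left (hVB s hs) hc
  have h1 := abs_le.1 (hbd ε hε)
  have h2 := abs_le.1 (hbd T (lt_of_lt_of_le hε hT))
  linarith [h1.1, h1.2, h2.1, h2.2]

theorem Ht_abs (hε : 0 < ε) (hT : ε ≤ T) {X X1 ρ Y R V : ℝ → ℝ → ℝ} {τ τ' : ℝ → ℝ} {c B : ℝ}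
    (hX : Ht X X1 ρ) (hτ : Wt τ τ') (hY : Nice Y) (hR : Nice R) (hV : Nice V) (hc : 0 ≤ c)
    (hVB : ∀ s > 0, ∫ z, V s z ≤ B)
    (hb : ∀ s > 0, ∀ z, |τ s * X s z| ≤ c * V s z)
    (h : ∀ s > 0, ∀ z, |Y s z + (τ' s * X s z + s * τ s * ρ s z)| ≤ R s z) :
    |II ε T Y| ≤ II ε T R + 2 * (c * B) := by
  rw [abs_le']
  constructor
  · refine Ht_le hε hT hX hτ hY hR hV hc hVB hb (fun s hs z => ?_)
    linarith [(abs_le.1 (h s hs z)).2]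
  · rw [← II_neg]
    refine Ht_le hε hT (hX.cmul (-1)) hτ hY.neg hR hV hc hVB (fun s hs z => ?_) (fun s hs z => ?_)
    · have := hb s hs z
      rw [← abs_neg] at this
      convert this using 2; ring
    · linarith [(abs_le.1 (h s hs z)).1]

theorem Wt_one : Wt (fun _ => 1) (fun _ => 0) :=
  ⟨continuousOn_const, continuousOn_const, fun s _ => hasDerivAt_const s 1⟩

theorem Wt_s : Wt (fun s => s) (fun _ => 1) :=
  ⟨continuousOn_id, continuousOn_const, fun s _ => hasDerivAt_id s⟩

theorem Wt_sq : Wt (fun s => s ^ 2) (fun s => 2 * s) :=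
  ⟨by fun_prop, by fun_prop, fun s _ => by simpa using hasDerivAt_pow 2 s⟩

theorem Wt_inv (n : ℕ) : Wt (fun s => s⁻¹ ^ n) (fun s => -n * s⁻¹ ^ (n + 1)) := by
  have hc : ContinuousOn (fun s : ℝ => s⁻¹) (Ioi 0) :=
    continuousOn_inv₀.mono (fun _ hs => ne_of_gt hs)
  refine ⟨hc.pow n, continuousOn_const.mul (hc.pow _), fun s hs => ?_⟩
  have h := (hasDerivAt_inv (ne_of_gt hs)).fun_pow n
  refine h.congr_deriv ?_
  rcases n with _ | n
  · simp
  · have : s ≠ 0 := ne_of_gt hs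
    simp only [Nat.add_sub_cancel]
    rw [← inv_pow]
    ring

end CC

open MeasureTheory Set Filter Topology

namespace CC

theorem U_total (φ : S) (s : ℝ) : ∫ z, U φ s z = ∫ x, φ x := by
  have hφ : Integrable φ := φ.integrable
  have hc := φ.continuous
  have hG := G_cont
  have hi : Integrable (fun p : ℝ × ℝ => φ (p.1 - s * p.2) * G p.2) (volume.prod volume) := by
    rw [integrable_prod_iff' (by fun_prop)]
    constructor
    · exact Eventually.of_forall (fun y => (hφ.comp_sub_right (s * y)).mul_const (G y))
    · have : (fun y => ∫ x, ‖φ (x - s * y) * G y‖) = fun y => (∫ x, ‖φ x‖) * G y := by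
        ext y
        simp_rw [norm_mul, integral_mul_const]
        rw [integral_sub_right_eq_self (fun x => ‖φ x‖) (s * y), Real.norm_of_nonneg (G_nonneg y)]
      rw [this]
      exact G_int.const_mul _
  unfold U
  rw [integral_integral_swap hi]
  simp_rw [integral_mul_const, integral_sub_right_eq_self (fun x => φ x), integral_const_mul, G_one,
    mul_one]

theorem U_sq_nonneg (φ : S) (s z : ℝ) : 0 ≤ U (mu φ φ) s z := by
  refine integral_nonneg (fun y => mul_nonneg ?_ (G_nonneg y))
  rw [mu_apply]; exact mul_self_nonneg _

theorem b1 {f : S} (hf : ∀ x, |D f x| ≤ 1) (s z : ℝ) : U (D f) s z ^ 2 ≤ 1 := by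
  have : |U (D f) s z| ≤ 1 := by
    rw [← G_one, ← Real.norm_eq_abs]
    refine norm_integral_le_of_norm_le G_int (Eventually.of_forall (fun y => ?_))
    rw [Real.norm_eq_abs, abs_mul, abs_of_nonneg (G_nonneg y)]
    exact mul_le_of_le_one_left (G_nonneg y) (hf _)
  exact (sq_le_one_iff_abs_le_one _).2 this

theorem b2 {f : S} (hf : ∀ x, |D f x| ≤ 1) (s z : ℝ) : (s * U (D (D f)) s z) ^ 2 ≤ M ^ 2 := by
  have hc := (D f).continuous
  rw [← U_ibp]
  have := absG (m := fun y => D f (z - s * y) * (-y)) (by fun_prop) 1 (fun y => by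
    rw [abs_mul, abs_neg]
    exact mul_le_mul (hf _) ((abs_le_wt y).trans (wt_le_wt y)) (abs_nonneg _) zero_le_one)
  simp only [mul_assoc] at this
  rw [← sq_abs]
  exact pow_le_pow_left₀ (abs_nonneg _) (by linarith) 2

theorem b3 (φ : S) (s z : ℝ) : (s * U (D φ) s z) ^ 2 ≤ M * U (mu φ φ) s z := by
  have := csG φ s z 1 (m := fun y => -y) (by fun_prop) (fun y => by
    rw [abs_neg]; linarith [abs_le_wt y])
  rw [← U_ibp]
  have e : ∫ y, φ (z - s * y) * (-y * G y) = ∫ y, -y * φ (z - s * y) * G y := by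
    congr 1; ext y; ring
  rw [e]
  simpa using this

theorem b5 (φ : S) (s z : ℝ) : (U φ s z) ^ 2 ≤ M * U (mu φ φ) s z := by
  have := csG φ s z 1 (m := fun y => 1) (by fun_prop) (fun y => by
    rw [abs_one]; nlinarith [sq_nonneg y])
  simpa [U] using this

theorem lip {f : S} (hf : ∀ x, |D f x| ≤ 1) (x y : ℝ) : |f x - f y| ≤ |x - y| := by
  have := Convex.norm_image_sub_le_of_norm_hasDerivWithin_le (f := f) (f' := D f) (C := 1)
    (s := univ) (x := y) (y := x) (fun x _ => (D_has f x).hasDerivWithinAt)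
    (fun x _ => hf x) convex_univ (mem_univ _) (mem_univ _)
  simpa using this

theorem dev {f : S} (hf : ∀ x, |D f x| ≤ 1) {s : ℝ} (hs : 0 < s) (z y : ℝ) :
    |f (z - s * y) - U f s z| ≤ s * (|y| + M) := by
  have hc := f.continuous
  have e : f (z - s * y) - U f s z = ∫ x, (f (z - s * y) - f (z - s * x)) * G x := by
    have h1 : Integrable (fun x => f (z - s * y) * G x) := G_int.const_mul _
    have : (fun x => (f (z - s * y) - f (z - s * x)) * G x) =
        fun x => f (z - s * y) * G x - f (z - s * x) * G x := by ext x; ring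
    rw [this, integral_sub h1 (U_int f s z), integral_const_mul, G_one, mul_one]
    rfl
  have h2 : Integrable (fun x => s * |y| * G x + s * ((1 + x ^ 2) ^ 2 * G x)) :=
    (G_int.const_mul _).add (G_wt.const_mul s)
  have e2 : ∫ x, (s * |y| * G x + s * ((1 + x ^ 2) ^ 2 * G x)) = s * (|y| + M) := by
    rw [integral_add (G_int.const_mul _) (G_wt.const_mul s), integral_const_mul, integral_const_mul,
      G_one]
    unfold M; ring
  rw [e, ← e2, ← Real.norm_eq_abs]
  refine norm_integral_le_of_norm_le h2 (Eventually.of_forall (fun x => ?_))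
  rw [Real.norm_eq_abs, abs_mul, abs_of_nonneg (G_nonneg x)]
  have h3 : |f (z - s * y) - f (z - s * x)| ≤ s * (|y| + (1 + x ^ 2) ^ 2) := by
    refine (lip hf _ _).trans ?_
    have : z - s * y - (z - s * x) = s * (x - y) := by ring
    rw [this, abs_mul, abs_of_pos hs]
    refine mul_le_mul_of_nonneg_left ?_ hs.le
    have := abs_sub x y
    have := (abs_le_wt x).trans (wt_le_wt x)
    linarith
  calc _ ≤ s * (|y| + (1 + x ^ 2) ^ 2) * G x := mul_le_mul_of_nonneg_right h3 (G_nonneg x)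
    _ = _ := by ring

theorem dev' {f : S} (hf : ∀ x, |D f x| ≤ 1) {s : ℝ} (hs : 0 < s) (z y : ℝ) :
    |f (z - s * y) - U f s z| ≤ (2 * s * M) * (1 + y ^ 2) := by
  refine (dev hf hs z y).trans ?_
  have h1 := abs_le_wt y
  have hM := M_one
  have : |y| + M ≤ 2 * M * (1 + y ^ 2) := by nlinarith [sq_nonneg y, mul_nonneg (sub_nonneg.2 hM) (sq_nonneg y)]
  calc _ ≤ s * (2 * M * (1 + y ^ 2)) := mul_le_mul_of_nonneg_left this hs.le
    _ = _ := by ring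

/-- covariance -/
noncomputable def H (f φ : S) (s z : ℝ) : ℝ := U (mu f φ) s z - U f s z * U φ s z

noncomputable def H1 (f φ : S) (s z : ℝ) : ℝ :=
  U (D (mu f φ)) s z - (U (D f) s z * U φ s z + U f s z * U (D φ) s z)

theorem H_eq (f φ : S) (s z : ℝ) :
    H f φ s z = ∫ y, (f (z - s * y) - U f s z) * φ (z - s * y) * G y := by
  have : (fun y => (f (z - s * y) - U f s z) * φ (z - s * y) * G y) =
      fun y => mu f φ (z - s * y) * G y - U f s z * (φ (z - s * y) * G y) := by
    ext y; rw [mu_apply]; ring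
  rw [this, integral_sub (U_int _ s z) ((U_int φ s z).const_mul _), integral_const_mul]
  rfl

theorem b8 {f : S} (hf : ∀ x, |D f x| ≤ 1) (φ : S) {s : ℝ} (hs : 0 < s) (z : ℝ) :
    H f φ s z ^ 2 ≤ 4 * M ^ 3 * s ^ 2 * U (mu φ φ) s z := by
  have hc := f.continuous
  rw [H_eq]
  have := csG φ s z (2 * s * M) (m := fun y => f (z - s * y) - U f s z) (by fun_prop)
    (dev' hf hs z)
  refine this.trans (le_of_eq ?_)
  ring

theorem b6 {f : S} (hf : ∀ x, |D f x| ≤ 1) {s : ℝ} (hs : 0 < s) (z : ℝ) :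
    |H f f s z| ≤ 4 * M ^ 3 * s ^ 2 := by
  have hc := f.continuous
  have e : H f f s z = ∫ y, (f (z - s * y) - U f s z) ^ 2 * G y := by
    have : (fun y => (f (z - s * y) - U f s z) ^ 2 * G y) =
        fun y => (f (z - s * y) - U f s z) * f (z - s * y) * G y
          - U f s z * (f (z - s * y) * G y - U f s z * G y) := by ext y; ring
    have i1 : Integrable (fun y => f (z - s * y) * G y - U f s z * G y) :=
      (U_int f s z).sub (G_int.const_mul _)
    have i2 : Integrable (fun y => (f (z - s * y) - U f s z) * f (z - s * y) * G y) := by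
      refine ((U_int (mu f f) s z).sub ((U_int f s z).const_mul (U f s z))).congr
        (Eventually.of_forall (fun y => ?_))
      simp only [Pi.sub_apply, mu_apply]; ring
    rw [this, integral_sub i2 (i1.const_mul _), integral_const_mul,
      integral_sub (U_int f s z) (G_int.const_mul _), integral_const_mul, G_one, ← H_eq]
    simp [U]
  rw [e]
  refine (absG (by fun_prop) (4 * s ^ 2 * M ^ 2) (fun y => ?_)).trans (le_of_eq (by ring))
  rw [abs_of_nonneg (sq_nonneg _), ← sq_abs]
  refine (pow_le_pow_left₀ (abs_nonneg _) (dev' hf hs z y) 2).trans (le_of_eq (by ring))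

theorem H1_ff (f : S) (s z : ℝ) : H1 f f s z = 2 * H f (D f) s z := by
  unfold H1 H
  have : U (mu (D f) f) s z = U (mu f (D f)) s z := by
    congr 1; ext x; rw [mu_apply, mu_apply]; ring
  rw [D_mu, U_add, this]; ring

theorem b7 {f : S} (hf : ∀ x, |D f x| ≤ 1) {s : ℝ} (hs : 0 < s) (z : ℝ) :
    H1 f f s z ^ 2 ≤ 16 * M ^ 4 * s ^ 2 := by
  have hc := f.continuous
  have hc' := (D f).continuous
  have hM := M_one
  rw [H1_ff, H_eq]
  have : |∫ y, (f (z - s * y) - U f s z) * D f (z - s * y) * G y| ≤ 2 * s * M * M := by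
    refine absG (by fun_prop) _ (fun y => ?_)
    rw [abs_mul]
    calc _ ≤ (2 * s * M) * (1 + y ^ 2) * 1 :=
          mul_le_mul (dev' hf hs z y) (hf _) (abs_nonneg _) (by positivity)
      _ ≤ _ := by rw [mul_one]; have := wt_le_wt y; gcongr
  rw [mul_pow, ← sq_abs (∫ y, _)]
  have := pow_le_pow_left₀ (abs_nonneg _) this 2
  nlinarith

/-- second-order cumulant -/
noncomputable def ka (f φ : S) (s z : ℝ) : ℝ :=
  U (mu f (mu f φ)) s z - 2 * (U f s z * U (mu f φ) s z) - U (mu f f) s z * U φ s z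
    + 2 * (U f s z * U f s z * U φ s z)

theorem ka_eq (f φ : S) (s z : ℝ) :
    ka f φ s z = ∫ y, ((f (z - s * y) - U f s z) ^ 2 - H f f s z) * φ (z - s * y) * G y := by
  have : (fun y => ((f (z - s * y) - U f s z) ^ 2 - H f f s z) * φ (z - s * y) * G y) =
      fun y => (mu f (mu f φ) (z - s * y) * G y - (2 * U f s z) * (mu f φ (z - s * y) * G y))
        + (U f s z ^ 2 - H f f s z) * (φ (z - s * y) * G y) := by
    ext y; simp only [mu_apply]; ring
  have i1 : Integrable (fun y => mu f (mu f φ) (z - s * y) * G y -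
    (2 * U f s z) * (mu f φ (z - s * y) * G y)) := (U_int _ s z).sub ((U_int _ s z).const_mul _)
  rw [this, integral_add i1 ((U_int φ s z).const_mul _),
    integral_sub (U_int _ s z) ((U_int _ s z).const_mul _), integral_const_mul, integral_const_mul]
  change _ = U (mu f (mu f φ)) s z - (2 * U f s z) * U (mu f φ) s z + (U f s z ^ 2 - H f f s z) * U φ s z
  unfold ka H
  ring

theorem b9 {f : S} (hf : ∀ x, |D f x| ≤ 1) (φ : S) {s : ℝ} (hs : 0 < s) (z : ℝ) :
    ka f φ s z ^ 2 ≤ 36 * M ^ 7 * s ^ 4 * U (mu φ φ) s z := by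
  have hc := f.continuous
  have hM := M_one
  rw [ka_eq]
  have := csG φ s z (6 * s ^ 2 * M ^ 3) (m := fun y => (f (z - s * y) - U f s z) ^ 2 - H f f s z)
    (by fun_prop) (fun y => by
      have h1 : (f (z - s * y) - U f s z) ^ 2 ≤ 2 * s ^ 2 * M ^ 2 * (1 + y ^ 2) := by
        rw [← sq_abs]
        refine (pow_le_pow_left₀ (abs_nonneg _) (dev hf hs z y) 2).trans ?_
        rw [mul_pow]
        have : (|y| + M) ^ 2 ≤ 2 * M ^ 2 * (1 + y ^ 2) := by
          have h2 : (|y| + M) ^ 2 ≤ 2 * (y ^ 2 + M ^ 2) := by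
            rw [← sq_abs y]; nlinarith [sq_nonneg (|y| - M)]
          nlinarith [sq_nonneg y, mul_nonneg (sub_nonneg.2 (one_le_pow₀ hM : 1 ≤ M ^ 2)) (sq_nonneg y)]
        calc _ ≤ s ^ 2 * (2 * M ^ 2 * (1 + y ^ 2)) := by gcongr
          _ = _ := by ring
      have h2 := abs_le.1 (b6 hf hs z)
      have h3 : 2 * s ^ 2 * M ^ 2 * (1 + y ^ 2) ≤ 2 * s ^ 2 * M ^ 3 * (1 + y ^ 2) := by
        gcongr <;> norm_num
      have h4 : 4 * M ^ 3 * s ^ 2 ≤ 4 * M ^ 3 * s ^ 2 * (1 + y ^ 2) := by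
        refine le_mul_of_one_le_right (by positivity) (by nlinarith [sq_nonneg y])
      rw [abs_le]
      constructor
      · nlinarith [h2.1, h2.2, sq_nonneg (f (z - s * y) - U f s z), mul_nonneg (by positivity : 0 ≤ 2 * s ^ 2 * M ^ 3) (by positivity : 0 ≤ 1 + y ^ 2)]
      · nlinarith [h2.1, h2.2])
  refine this.trans (le_of_eq ?_)
  ring

theorem H_Ht (f φ : S) : Ht (H f φ) (H1 f φ) (fun s z => 2 * (U (D f) s z * U (D φ) s z)) :=
  ((U_Ht (mu f φ)).sub ((U_Ht f).mul (U_Ht φ))).congr (fun _ _ _ => rfl)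
    (fun s _ z => by ring)

/-- `z`-derivative of `ka` -/
noncomputable def ka1 (f φ : S) (s z : ℝ) : ℝ :=
  U (D (mu f (mu f φ))) s z
    - 2 * (U (D f) s z * U (mu f φ) s z + U f s z * U (D (mu f φ)) s z)
    - (U (D (mu f f)) s z * U φ s z + U (mu f f) s z * U (D φ) s z)
    + 2 * ((U (D f) s z * U f s z + U f s z * U (D f) s z) * U φ s z
      + U f s z * U f s z * U (D φ) s z)

theorem ka_Ht (f φ : S) : Ht (ka f φ) (ka1 f φ)
    (fun s z => 4 * (U (D f) s z * H1 f φ s z) + 2 * (H1 f f s z * U (D φ) s z)) :=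
  ((((U_Ht (mu f (mu f φ))).sub (((U_Ht f).mul (U_Ht (mu f φ))).cmul 2)).sub
    ((U_Ht (mu f f)).mul (U_Ht φ))).add ((((U_Ht f).mul (U_Ht f)).mul (U_Ht φ)).cmul 2)).congr
    (fun _ _ _ => rfl) (fun s _ z => by unfold H1; ring)

end CC

open MeasureTheory Set Filter Topology

namespace CC

/-- universal constant -/
noncomputable def K : ℝ := 36 * M ^ 7

theorem K_M (n : ℕ) (hn : n ≤ 7) {c : ℝ} (hc : 0 ≤ c) (hc' : c ≤ 36) : c * M ^ n ≤ K := by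
  have hM := M_one
  have : M ^ n ≤ M ^ 7 := pow_le_pow_right₀ hM hn
  have h0 : 0 ≤ M ^ n := by positivity
  unfold K
  exact mul_le_mul hc' this h0 (by norm_num)

theorem K_one : 1 ≤ K := by simpa using K_M 0 (by norm_num) zero_le_one (by norm_num)

theorem K_pos : 0 < K := lt_of_lt_of_le one_pos K_one


theorem k2 {f : S} (hf : ∀ x, |D f x| ≤ 1) {s : ℝ} (z : ℝ) : (s * U (D (D f)) s z) ^ 2 ≤ K :=
  (b2 hf s z).trans (by simpa using K_M 2 (by norm_num) zero_le_one (by norm_num))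

theorem k3 {s : ℝ} (φ : S) (z : ℝ) : (s * U (D φ) s z) ^ 2 ≤ K * U (mu φ φ) s z :=
  (b3 φ s z).trans (mul_le_mul_of_nonneg_right
    (by simpa using K_M 1 (by norm_num) zero_le_one (by norm_num)) (U_sq_nonneg φ s z))

theorem k5 {s : ℝ} (φ : S) (z : ℝ) : (U φ s z) ^ 2 ≤ K * U (mu φ φ) s z :=
  (b5 φ s z).trans (mul_le_mul_of_nonneg_right
    (by simpa using K_M 1 (by norm_num) zero_le_one (by norm_num)) (U_sq_nonneg φ s z))


theorem k6 {f : S} (hf : ∀ x, |D f x| ≤ 1) {s : ℝ} (hs : 0 < s) (z : ℝ) : |H f f s z| ≤ K * s ^ 2 :=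
  (b6 hf hs z).trans (mul_le_mul_of_nonneg_right (K_M 3 (by norm_num) (by norm_num) (by norm_num))
    (sq_nonneg s))

theorem k7 {f : S} (hf : ∀ x, |D f x| ≤ 1) {s : ℝ} (hs : 0 < s) (z : ℝ) : H1 f f s z ^ 2 ≤ K * s ^ 2 :=
  (b7 hf hs z).trans (mul_le_mul_of_nonneg_right (K_M 4 (by norm_num) (by norm_num) (by norm_num))
    (sq_nonneg s))

theorem k8 {f : S} (hf : ∀ x, |D f x| ≤ 1) {s : ℝ} (hs : 0 < s) (φ : S) (z : ℝ) : H f φ s z ^ 2 ≤ K * s ^ 2 * U (mu φ φ) s z :=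
  (b8 hf φ hs z).trans (mul_le_mul_of_nonneg_right (mul_le_mul_of_nonneg_right
    (K_M 3 (by norm_num) (by norm_num) (by norm_num)) (sq_nonneg s)) (U_sq_nonneg φ s z))

theorem k9 {f : S} (hf : ∀ x, |D f x| ≤ 1) {s : ℝ} (hs : 0 < s) (φ : S) (z : ℝ) : ka f φ s z ^ 2 ≤ K * s ^ 4 * U (mu φ φ) s z :=
  (b9 hf φ hs z).trans (le_of_eq rfl)


theorem Nice.zero : Nice (fun _ _ => (0:ℝ)) := by simpa using (U_nice 0).cmul 0

theorem Nice.sinv1 {u : ℝ → ℝ → ℝ} (hu : Nice u) : Nice (fun s z => s⁻¹ * u s z) := by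
  simpa using hu.sinv 1

theorem II_zero (ε T : ℝ) : II ε T (fun _ _ => 0) = 0 := by simp [II]

/-- the mass bound -/
theorem mass {φ : S} (hφ : ∫ x, φ x * φ x ≤ 1) : ∀ s > 0, ∫ z, U (mu φ φ) s z ≤ 1 := by
  intro s _
  rw [U_total]
  simpa [mu_apply] using hφ


theorem E0a {ε T : ℝ} (hε : 0 < ε) (hT : ε ≤ T) {φ : S}
    (hφ : ∫ x, φ x * φ x ≤ 1) : II ε T (fun s z => s * U (D φ) s z ^ 2) ≤ K := by
  have h := Ht_le hε hT ((U_Ht φ).mul (U_Ht φ)) Wt_one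
    (((U_nice (D φ)).sq.smul').cmul 2) Nice.zero (U_nice (mu φ φ)) K_pos.le (mass hφ)
    (fun s hs z => by
      have := k5 (s := s) φ z
      rw [one_mul, abs_of_nonneg (mul_self_nonneg _)]
      linarith [this, sq (U φ s z)])
    (fun s hs z => by linarith)
  rw [II_cmul, II_zero] at h
  linarith

theorem E0b {ε T : ℝ} (hε : 0 < ε) (hT : ε ≤ T) {φ : S}
    (hφ : ∫ x, φ x * φ x ≤ 1) : II ε T (fun s z => s ^ 3 * U (D (D φ)) s z ^ 2) ≤ 2 * K := by
  have h := Ht_le hε hT ((U_Ht (D φ)).mul (U_Ht (D φ))) Wt_sq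
    (((U_nice (D (D φ))).sq.spow 3).cmul 2) (((U_nice (D φ)).sq.smul').cmul 2)
    (U_nice (mu φ φ)) K_pos.le (mass hφ)
    (fun s hs z => by
      have := k3 (s := s) φ z
      rw [abs_of_nonneg (by positivity [mul_self_nonneg (U (D φ) s z)])]
      nlinarith [this])
    (fun s hs z => by linarith)
  rw [II_cmul, II_cmul] at h
  linarith [E0a hε hT hφ]


theorem E1 {ε T : ℝ} (hε : 0 < ε) (hT : ε ≤ T) {f : S} (hf : ∀ x, |D f x| ≤ 1) {φ : S}
    (hφ : ∫ x, φ x * φ x ≤ 1) {Y : ℝ → ℝ → ℝ} (hY : Nice Y)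
    (h : ∀ s > 0, ∀ z, Y s z ≤ s⁻¹ ^ 3 * H f φ s z ^ 2 + s⁻¹ * H1 f φ s z ^ 2) :
    II ε T Y ≤ 6 * K := by
  have h := Ht_le hε hT ((H_Ht f φ).mul (H_Ht f φ)) (Wt_inv 2)
    hY (((U_nice (D φ)).sq.smul').cmul 4)
    (U_nice (mu φ φ)) K_pos.le (mass hφ)
    (fun s hs z => by
      have := k8 hf hs φ z
      rw [abs_of_nonneg (mul_nonneg (by positivity) (mul_self_nonneg _)), inv_pow,
        inv_mul_le_iff₀ (by positivity)]
      linarith [sq (H f φ s z)])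
    (fun s hs z => by
      refine (h s hs z).trans ?_
      have ha := b1 hf s z
      generalize U (D f) s z = α at *
      generalize U (D φ) s z = v at *
      generalize H f φ s z = a at *
      generalize H1 f φ s z = b at *
      have h1 := mul_nonneg hs.le (sq_nonneg (s⁻¹ ^ 2 * a - 2 * α * v))
      have h2 : s * (s⁻¹ ^ 2 * a - 2 * α * v) ^ 2 = s⁻¹ ^ 3 * a ^ 2 - 4 * (s⁻¹ * (α * a * v)) +
          4 * (s * (α ^ 2 * v ^ 2)) := by field_simp; ring
      have h3 : s * (α ^ 2 * v ^ 2) ≤ s * v ^ 2 :=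
        mul_le_mul_of_nonneg_left (mul_le_of_le_one_left (sq_nonneg v) ha) hs.le
      have h4 : s * s⁻¹ ^ 2 = s⁻¹ := by field_simp
      have h5 : 0 ≤ s⁻¹ * b ^ 2 := by positivity
      rw [h4]
      push_cast
      linarith)
  rw [II_cmul] at h
  linarith [E0a hε hT hφ]

theorem E1a {ε T : ℝ} (hε : 0 < ε) (hT : ε ≤ T) {f : S} (hf : ∀ x, |D f x| ≤ 1) {φ : S}
    (hφ : ∫ x, φ x * φ x ≤ 1) : II ε T (fun s z => s⁻¹ ^ 3 * H f φ s z ^ 2) ≤ 6 * K :=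
  E1 hε hT hf hφ ((H_Ht f φ).n.sq.sinv 3) (fun s hs z => by
    have : 0 ≤ s⁻¹ * H1 f φ s z ^ 2 := by positivity
    linarith)

theorem E1b {ε T : ℝ} (hε : 0 < ε) (hT : ε ≤ T) {f : S} (hf : ∀ x, |D f x| ≤ 1) {φ : S}
    (hφ : ∫ x, φ x * φ x ≤ 1) : II ε T (fun s z => s⁻¹ * H1 f φ s z ^ 2) ≤ 6 * K :=
  E1 hε hT hf hφ ((H_Ht f φ).n1.sq.sinv1) (fun s hs z => by
    have : 0 ≤ s⁻¹ ^ 3 * H f φ s z ^ 2 := by positivity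
    linarith)

theorem E2 {ε T : ℝ} (hε : 0 < ε) (hT : ε ≤ T) {f : S} (hf : ∀ x, |D f x| ≤ 1) {φ : S}
    (hφ : ∫ x, φ x * φ x ≤ 1) : II ε T (fun s z => s⁻¹ ^ 5 * ka f φ s z ^ 2) ≤ 102 * K ^ 2 := by
  have nv : Nice (fun s z => (4 * K) * (s * U (D φ) s z ^ 2)) := ((U_nice (D φ)).sq.smul').cmul _
  have nh : Nice (fun s z => 16 * (s⁻¹ * H1 f φ s z ^ 2)) := ((H_Ht f φ).n1.sq.sinv1).cmul _
  have h := Ht_le hε hT ((ka_Ht f φ).mul (ka_Ht f φ)) (Wt_inv 4)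
    ((ka_Ht f φ).n.sq.sinv 5) (nh.add nv)
    (U_nice (mu φ φ)) K_pos.le (mass hφ)
    (fun s hs z => by
      have := k9 hf hs φ z
      rw [abs_of_nonneg (mul_nonneg (by positivity) (mul_self_nonneg _)), inv_pow,
        inv_mul_le_iff₀ (by positivity)]
      linarith [sq (ka f φ s z)])
    (fun s hs z => by
      have ha := b1 hf s z
      have hq := k7 hf hs z
      generalize U (D f) s z = α at *
      generalize U (D φ) s z = v at *
      generalize ka f φ s z = a at *
      generalize ka1 f φ s z = b at *
      generalize H1 f φ s z = g at *
      generalize H1 f f s z = q at *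
      have e1 := mul_nonneg hs.le (sq_nonneg (s⁻¹ ^ 3 * a - 4 * (s⁻¹ * (α * g))))
      have e2 : s * (s⁻¹ ^ 3 * a - 4 * (s⁻¹ * (α * g))) ^ 2 =
        s⁻¹ ^ 5 * a ^ 2 - 8 * (s⁻¹ ^ 3 * (α * a * g)) + 16 * (s⁻¹ * (α ^ 2 * g ^ 2)) := by
          field_simp; ring
      have e3 : s⁻¹ * (α ^ 2 * g ^ 2) ≤ s⁻¹ * g ^ 2 :=
        mul_le_mul_of_nonneg_left (mul_le_of_le_one_left (sq_nonneg g) ha) (by positivity)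
      have e4 := mul_nonneg hs.le (sq_nonneg (s⁻¹ ^ 3 * a - 2 * (s⁻¹ * (q * v))))
      have e5 : s * (s⁻¹ ^ 3 * a - 2 * (s⁻¹ * (q * v))) ^ 2 =
        s⁻¹ ^ 5 * a ^ 2 - 4 * (s⁻¹ ^ 3 * (a * q * v)) + 4 * (s⁻¹ * (q ^ 2 * v ^ 2)) := by
          field_simp; ring
      have e6 : s⁻¹ * (q ^ 2 * v ^ 2) ≤ K * (s * v ^ 2) := by
        rw [inv_mul_le_iff₀ hs]
        calc _ ≤ K * s ^ 2 * v ^ 2 := by gcongr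
          _ = _ := by ring
      have e7 : 0 ≤ s⁻¹ ^ 3 * b ^ 2 := by positivity
      have e8 : s * s⁻¹ ^ 4 = s⁻¹ ^ 3 := by field_simp
      have e9 : 0 ≤ s⁻¹ ^ 5 * a ^ 2 := by positivity
      rw [e8]
      push_cast
      linarith)
  rw [II_add hε hT nh nv, II_cmul, II_cmul] at h
  have h1 := E0a hε hT hφ
  have h2 := E1b hε hT hf hφ
  have := K_one
  nlinarith

theorem E3 {ε T : ℝ} (hε : 0 < ε) (hT : ε ≤ T) {f : S} (hf : ∀ x, |D f x| ≤ 1) {φ : S}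
    (hφ : ∫ x, φ x * φ x ≤ 1) : II ε T (fun s z => s * (U (D (D f)) s z ^ 2 * U φ s z ^ 2)) ≤ 18 * K := by
  have h := Ht_le hε hT (((U_Ht (D f)).mul (U_Ht φ)).mul ((U_Ht (D f)).mul (U_Ht φ))) Wt_one
    (((U_nice (D (D f))).sq.mul (U_nice φ).sq).smul') (((U_nice (D φ)).sq.smul').cmul 16)
    (U_nice (mu φ φ)) K_pos.le (mass hφ)
    (fun s hs z => by
      have := k5 (s := s) φ z
      have ha := b1 hf s z
      rw [one_mul, abs_of_nonneg (mul_self_nonneg _)]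
      nlinarith [mul_le_of_le_one_left (sq_nonneg (U φ s z)) ha])
    (fun s hs z => by
      have ha := b1 hf s z
      generalize U (D f) s z = α at *
      generalize U (D (D f)) s z = α1 at *
      generalize U φ s z = v at *
      generalize U (D φ) s z = v1 at *
      have e1 := mul_nonneg hs.le (sq_nonneg (α1 * v + 4 * α * v1))
      have e3 : s * (α ^ 2 * v1 ^ 2) ≤ s * v1 ^ 2 :=
        mul_le_mul_of_nonneg_left (mul_le_of_le_one_left (sq_nonneg v1) ha) hs.le
      have e4 : 0 ≤ s * (α ^ 2 * v1 ^ 2) := by positivity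
      nlinarith)
  rw [II_cmul] at h
  linarith [E0a hε hT hφ]


end CC

open MeasureTheory Set Filter Topology

namespace CC

/-- normalized variance -/
noncomputable def cc (f : S) (s z : ℝ) : ℝ := s⁻¹ ^ 2 * H f f s z
noncomputable def cc1 (f : S) (s z : ℝ) : ℝ := s⁻¹ ^ 2 * H1 f f s z
/-- defect -/
noncomputable def ee (f : S) (s z : ℝ) : ℝ := U (D f) s z * U (D f) s z - cc f s z
noncomputable def ee1 (f : S) (s z : ℝ) : ℝ :=
  (U (D (D f)) s z * U (D f) s z + U (D f) s z * U (D (D f)) s z) - cc1 f s z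

theorem cc_Ht (f : S) : Ht (cc f) (cc1 f) (fun s z => 2 * (s⁻¹ ^ 2 * ee f s z)) :=
  (H_Ht f f).sinv2.congr (fun _ _ _ => rfl) (fun s _ z => by unfold ee cc; ring)

theorem ee_Ht (f : S) : Ht (ee f) (ee1 f)
    (fun s z => -2 * U (D (D f)) s z ^ 2 - 2 * (s⁻¹ ^ 2 * ee f s z)) :=
  (((U_Ht (D f)).mul (U_Ht (D f))).sub (cc_Ht f)).congr (fun _ _ _ => rfl)
    (fun s _ z => by ring)

theorem cc_bd {f : S} (hf : ∀ x, |D f x| ≤ 1) {s : ℝ} (hs : 0 < s) (z : ℝ) : |cc f s z| ≤ K := by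
  unfold cc
  rw [abs_mul, abs_of_nonneg (by positivity), inv_pow, inv_mul_le_iff₀ (by positivity)]
  linarith [k6 hf hs z]

theorem ee_bd {f : S} (hf : ∀ x, |D f x| ≤ 1) {s : ℝ} (hs : 0 < s) (z : ℝ) :
    |ee f s z| ≤ 2 * K := by
  have h1 := abs_le.1 (cc_bd hf hs z)
  have h2 := b1 hf s z
  have h3 := K_one
  have h4 := sq_nonneg (U (D f) s z)
  unfold ee
  rw [abs_le]
  constructor <;> nlinarith [h1.1, h1.2]

theorem young {s : ℝ} (hs : 0 < s) (a b : ℝ) : |2 * (s ^ 2 * (a * b))| ≤ s ^ 3 * a ^ 2 + s * b ^ 2 := by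
  have h1 := mul_nonneg hs.le (sq_nonneg (s * a - b))
  have h2 := mul_nonneg hs.le (sq_nonneg (s * a + b))
  rw [abs_le]
  constructor <;> linarith


theorem E4 {ε T : ℝ} (hε : 0 < ε) (hT : ε ≤ T) {f : S} (hf : ∀ x, |D f x| ≤ 1) {φ : S}
    (hφ : ∫ x, φ x * φ x ≤ 1) {Y : ℝ → ℝ → ℝ} (hY : Nice Y)
    (h : ∀ s > 0, ∀ z, Y s z ≤ s * (ee1 f s z ^ 2 * U φ s z ^ 2)
      + s⁻¹ * (ee f s z ^ 2 * U φ s z ^ 2)) :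
    II ε T Y ≤ 216 * K ^ 3 := by
  have n1 : Nice (fun s z => (64 * K ^ 2) * (s * U (D φ) s z ^ 2)) := ((U_nice (D φ)).sq.smul').cmul _
  have n2 : Nice (fun s z => (8 * K) * (s * (U (D (D f)) s z ^ 2 * U φ s z ^ 2))) :=
    (((U_nice (D (D f))).sq.mul (U_nice φ).sq).smul').cmul _
  have hK := K_one
  have h := Ht_le hε hT (((ee_Ht f).mul (U_Ht φ)).mul ((ee_Ht f).mul (U_Ht φ))) Wt_one hY
    (n1.add n2) (U_nice (mu φ φ)) (c := 4 * K ^ 3) (by positivity) (mass hφ)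
    (fun s hs z => by
      have h1 := k5 (s := s) φ z
      have h2 := pow_le_pow_left₀ (abs_nonneg _) (ee_bd hf hs z) 2
      rw [sq_abs] at h2
      rw [one_mul, abs_of_nonneg (mul_self_nonneg _)]
      calc _ = ee f s z ^ 2 * U φ s z ^ 2 := by ring
        _ ≤ (2 * K) ^ 2 * (K * U (mu φ φ) s z) := mul_le_mul h2 h1 (sq_nonneg _) (by positivity)
        _ = _ := by ring)
    (fun s hs z => by
      refine (h s hs z).trans ?_
      have he := ee_bd hf hs z
      generalize U (D f) s z = α at *
      generalize U (D (D f)) s z = α1 at *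
      generalize U φ s z = v at *
      generalize U (D φ) s z = v1 at *
      generalize ee f s z = e at *
      generalize ee1 f s z = e1 at *
      have he2 := pow_le_pow_left₀ (abs_nonneg _) he 2
      rw [sq_abs] at he2
      have y1 := mul_nonneg hs.le (sq_nonneg (e1 * v + 4 * e * v1))
      have y2 : s * (e ^ 2 * v1 ^ 2) ≤ (4 * K ^ 2) * (s * v1 ^ 2) := by
        calc _ ≤ s * ((2 * K) ^ 2 * v1 ^ 2) := by gcongr
          _ = _ := by ring
      have y3 : -(2 * K * (s * (α1 ^ 2 * v ^ 2))) ≤ e * (s * (α1 ^ 2 * v ^ 2)) := by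
        rw [← neg_mul]
        exact mul_le_mul_of_nonneg_right (abs_le.1 he).1 (by positivity)
      have y4 : s * s⁻¹ ^ 2 = s⁻¹ := by field_simp
      have y5 : 0 ≤ s⁻¹ * (e ^ 2 * v ^ 2) := by positivity
      have y6 : 0 ≤ s * (e ^ 2 * v1 ^ 2) := by positivity
      have y7 : s * s⁻¹ ^ 2 * (e ^ 2 * v ^ 2) = s⁻¹ * (e ^ 2 * v ^ 2) := by rw [y4]
      linarith)
  rw [II_add hε hT n1 n2, II_cmul, II_cmul] at h
  have h1 := E0a hε hT hφ
  have h2 := E3 hε hT hf hφ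
  have h3 : 64 * K ^ 2 * (II ε T fun s z => s * U (D φ) s z ^ 2) ≤ 64 * K ^ 2 * K := by gcongr
  have h4 : 8 * K * (II ε T fun s z => s * (U (D (D f)) s z ^ 2 * U φ s z ^ 2)) ≤ 8 * K * (18 * K) := by
    gcongr
  nlinarith [pow_pos K_pos 2]

theorem E4a {ε T : ℝ} (hε : 0 < ε) (hT : ε ≤ T) {f : S} (hf : ∀ x, |D f x| ≤ 1) {φ : S}
    (hφ : ∫ x, φ x * φ x ≤ 1) : II ε T (fun s z => s * (ee1 f s z ^ 2 * U φ s z ^ 2)) ≤ 216 * K ^ 3 :=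
  E4 hε hT hf hφ (((ee_Ht f).n1.sq.mul (U_nice φ).sq).smul') (fun s hs z => by
    have : 0 ≤ s⁻¹ * (ee f s z ^ 2 * U φ s z ^ 2) := by positivity
    linarith)

theorem E4b {ε T : ℝ} (hε : 0 < ε) (hT : ε ≤ T) {f : S} (hf : ∀ x, |D f x| ≤ 1) {φ : S}
    (hφ : ∫ x, φ x * φ x ≤ 1) : II ε T (fun s z => s⁻¹ * (ee f s z ^ 2 * U φ s z ^ 2)) ≤ 216 * K ^ 3 :=
  E4 hε hT hf hφ (((ee_Ht f).n.sq.mul (U_nice φ).sq).sinv1) (fun s hs z => by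
    have : 0 ≤ s * (ee1 f s z ^ 2 * U φ s z ^ 2) := by positivity
    linarith)

/-- Wronskian -/
noncomputable def W (φ ψ : S) (s z : ℝ) : ℝ := U ψ s z * U (D φ) s z - U φ s z * U (D ψ) s z

theorem W_Ht (φ ψ : S) : Ht (W φ ψ)
    (fun s z => U ψ s z * U (D (D φ)) s z - U φ s z * U (D (D ψ)) s z)
    (fun s z => 2 * (U (D (D ψ)) s z * U (D φ) s z - U (D ψ) s z * U (D (D φ)) s z)) :=
  (((U_Ht ψ).mul (U_Ht (D φ))).sub ((U_Ht φ).mul (U_Ht (D ψ)))).congr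
    (fun s _ z => by ring) (fun s _ z => by ring)

theorem Blem {ε T : ℝ} (hε : 0 < ε) (hT : ε ≤ T) {φ ψ : S}
    (hφ : ∫ x, φ x * φ x ≤ 1) (hψ : ∫ x, ψ x * ψ x ≤ 1) {γ γ1 ρ R0 : ℝ → ℝ → ℝ} {c A : ℝ} (hγ : Ht γ γ1 ρ) (hc : 0 ≤ c)
    (hγc : ∀ s > 0, ∀ z, |γ s z| ≤ c) (n0 : Nice R0)
    (hρ : ∀ s > 0, ∀ z, |s ^ 2 * (ρ s z * W φ ψ s z)| ≤ R0 s z)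
    (h0 : II ε T R0 ≤ A)
    (h1 : II ε T (fun s z => s * (γ1 s z ^ 2 * U φ s z ^ 2)) ≤ A)
    (h2 : II ε T (fun s z => s * (γ1 s z ^ 2 * U ψ s z ^ 2)) ≤ A) :
    |II ε T (fun s z => γ s z * W φ ψ s z)| ≤ 3 * A + (10 * c + 4) * K := by
  have n1 : Nice (fun s z => s * (γ1 s z ^ 2 * U φ s z ^ 2)) :=
    ((hγ.n1.sq.mul (U_nice φ).sq).smul')
  have n2 : Nice (fun s z => s * (γ1 s z ^ 2 * U ψ s z ^ 2)) :=
    ((hγ.n1.sq.mul (U_nice ψ).sq).smul')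
  have n3 : Nice (fun s z => (c + 1) * (s ^ 3 * U (D (D φ)) s z ^ 2)) :=
    ((U_nice _).sq.spow 3).cmul _
  have n4 : Nice (fun s z => (c + 1) * (s ^ 3 * U (D (D ψ)) s z ^ 2)) :=
    ((U_nice _).sq.spow 3).cmul _
  have n5 : Nice (fun s z => c * (s * U (D φ) s z ^ 2)) := ((U_nice _).sq.smul').cmul _
  have n6 : Nice (fun s z => c * (s * U (D ψ) s z ^ 2)) := ((U_nice _).sq.smul').cmul _
  have hW := W_Ht φ ψ
  have h := Ht_abs hε hT (hγ.mul hW) Wt_s (hγ.n.mul hW.n).neg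
    ((((((n0.add n1).add n2).add n3).add n4).add n5).add n6)
    ((U_nice (mu φ φ)).add (U_nice (mu ψ ψ))) (mul_nonneg hc K_pos.le) (B := 2)
    (fun s hs => by
      rw [integral_add ((U_nice _).integrable hs) ((U_nice _).integrable hs)]
      linarith [mass hφ s hs, mass hψ s hs])
    (fun s hs z => by
      have a1 := k5 (s := s) φ z
      have a2 := k5 (s := s) ψ z
      have a3 := k3 (s := s) φ z
      have a4 := k3 (s := s) ψ z
      have hg := hγc s hs z
      have : s * (γ s z * W φ ψ s z) = γ s z * (s * W φ ψ s z) := by ring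
      rw [this, abs_mul, mul_assoc]
      refine mul_le_mul hg ?_ (abs_nonneg _) hc
      unfold W
      generalize U φ s z = v at *
      generalize U ψ s z = w at *
      generalize U (D φ) s z = v1 at *
      generalize U (D ψ) s z = w1 at *
      rw [abs_le]
      constructor <;> nlinarith [sq_nonneg (w - s * v1), sq_nonneg (w + s * v1), sq_nonneg (v - s * w1), sq_nonneg (v + s * w1)])
    (fun s hs z => by
      have hr := hρ s hs z
      have hg := hγc s hs z
      have y1 := young hs (U (D (D ψ)) s z) (U (D φ) s z)
      have y2 := young hs (U (D (D φ)) s z) (U (D ψ) s z)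
      have y3 := young hs (U (D (D φ)) s z) (γ1 s z * U ψ s z)
      have y4 := young hs (U (D (D ψ)) s z) (γ1 s z * U φ s z)
      have x1 : |γ s z * (2 * (s ^ 2 * (U (D (D ψ)) s z * U (D φ) s z)))| ≤ c * (s ^ 3 * U (D (D ψ)) s z ^ 2 + s * U (D φ) s z ^ 2) := by
        rw [abs_mul]; exact mul_le_mul hg y1 (abs_nonneg _) hc
      have x2 : |γ s z * (2 * (s ^ 2 * (U (D (D φ)) s z * U (D ψ) s z)))| ≤ c * (s ^ 3 * U (D (D φ)) s z ^ 2 + s * U (D ψ) s z ^ 2) := by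
        rw [abs_mul]; exact mul_le_mul hg y2 (abs_nonneg _) hc
      rw [abs_le] at *
      constructor <;> linarith [hr.1, hr.2, x1.1, x1.2, x2.1, x2.2, y3.1, y3.2, y4.1, y4.2])
  rw [II_add hε hT (((((n0.add n1).add n2).add n3).add n4).add n5) n6,
    II_add hε hT ((((n0.add n1).add n2).add n3).add n4) n5,
    II_add hε hT (((n0.add n1).add n2).add n3) n4,
    II_add hε hT ((n0.add n1).add n2) n3,
    II_add hε hT (n0.add n1) n2, II_add hε hT n0 n1, II_cmul, II_cmul, II_cmul, II_cmul, II_neg,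
    abs_neg] at h
  have a1 := mul_le_mul_of_nonneg_left (E0a hε hT hφ) hc
  have a2 := mul_le_mul_of_nonneg_left (E0a hε hT hψ) hc
  have a3 := mul_le_mul_of_nonneg_left (E0b hε hT hφ) (by positivity : 0 ≤ c + 1)
  have a4 := mul_le_mul_of_nonneg_left (E0b hε hT hψ) (by positivity : 0 ≤ c + 1)
  linarith


end CC

open MeasureTheory Set Filter Topology

namespace CC


theorem cc1_en {ε T : ℝ} (hε : 0 < ε) (hT : ε ≤ T) {f : S} (hf : ∀ x, |D f x| ≤ 1) {φ : S}
    (hφ : ∫ x, φ x * φ x ≤ 1) : II ε T (fun s z => s * (cc1 f s z ^ 2 * U φ s z ^ 2)) ≤ 576 * K ^ 3 := by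
  have hK := K_one
  have n1 : Nice (fun s z => 8 * (s * (U (D (D f)) s z ^ 2 * U φ s z ^ 2))) :=
    (((U_nice _).sq.mul (U_nice φ).sq).smul').cmul _
  have n2 : Nice (fun s z => 2 * (s * (ee1 f s z ^ 2 * U φ s z ^ 2))) :=
    (((ee_Ht f).n1.sq.mul (U_nice φ).sq).smul').cmul _
  have h := II_mono hε hT (((cc_Ht f).n1.sq.mul (U_nice φ).sq).smul') (n1.add n2) (fun s hs z => by
    have e : cc1 f s z = 2 * U (D f) s z * U (D (D f)) s z - ee1 f s z := by unfold ee1; ring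
    have ha := b1 hf s z
    rw [e]
    generalize U (D f) s z = α at *
    generalize U (D (D f)) s z = α1 at *
    generalize U φ s z = v at *
    generalize ee1 f s z = e1 at *
    have h1 : (2 * α * α1 - e1) ^ 2 ≤ 8 * α1 ^ 2 + 2 * e1 ^ 2 := by
      nlinarith [sq_nonneg (2 * α * α1 + e1), mul_le_of_le_one_left (sq_nonneg α1) ha]
    calc _ ≤ s * ((8 * α1 ^ 2 + 2 * e1 ^ 2) * v ^ 2) := by gcongr
      _ = _ := by ring)
  rw [II_add hε hT n1 n2, II_cmul, II_cmul] at h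
  have h1 := E3 hε hT hf hφ
  have h2 := E4a hε hT hf hφ
  have h3 : K ≤ K ^ 3 := le_self_pow₀ hK (by norm_num)
  linarith


theorem B1 {ε T : ℝ} (hε : 0 < ε) (hT : ε ≤ T) {f : S} (hf : ∀ x, |D f x| ≤ 1) {φ ψ : S}
    (hφ : ∫ x, φ x * φ x ≤ 1) (hψ : ∫ x, ψ x * ψ x ≤ 1) : |II ε T (fun s z => cc f s z * W φ ψ s z)| ≤ 1742 * K ^ 3 := by
  have hK := K_one
  have n1 : Nice (fun s z => s⁻¹ * (ee f s z ^ 2 * U φ s z ^ 2)) :=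
    ((ee_Ht f).n.sq.mul (U_nice φ).sq).sinv1
  have n2 : Nice (fun s z => s⁻¹ * (ee f s z ^ 2 * U ψ s z ^ 2)) :=
    ((ee_Ht f).n.sq.mul (U_nice ψ).sq).sinv1
  have n3 : Nice (fun s z => s * U (D φ) s z ^ 2) := ((U_nice _).sq.smul')
  have n4 : Nice (fun s z => s * U (D ψ) s z ^ 2) := ((U_nice _).sq.smul')
  have h3 : K ≤ K ^ 3 := le_self_pow₀ hK (by norm_num)
  have h4 : K ^ 2 ≤ K ^ 3 := pow_le_pow_right₀ hK (by norm_num)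
  have h := Blem hε hT hφ hψ (cc_Ht f) K_pos.le (fun s hs z => cc_bd hf hs z)
    (((n1.add n2).add n3).add n4) (fun s hs z => by
      unfold W
      generalize U φ s z = v at *
      generalize U ψ s z = w at *
      generalize U (D φ) s z = v1 at *
      generalize U (D ψ) s z = w1 at *
      generalize ee f s z = e at *
      have e1 : s ^ 2 * (2 * (s⁻¹ ^ 2 * e) * (w * v1 - v * w1)) = 2 * (e * w * v1) - 2 * (e * v * w1) := by
        field_simp
      rw [e1]
      have y1 := mul_nonneg hs.le (sq_nonneg (s⁻¹ * (e * w) - v1))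
      have y2 := mul_nonneg hs.le (sq_nonneg (s⁻¹ * (e * w) + v1))
      have y3 := mul_nonneg hs.le (sq_nonneg (s⁻¹ * (e * v) - w1))
      have y4 := mul_nonneg hs.le (sq_nonneg (s⁻¹ * (e * v) + w1))
      have z1 : s * (s⁻¹ * (e * w) - v1) ^ 2 = s⁻¹ * (e ^ 2 * w ^ 2) - 2 * (e * w * v1) + s * v1 ^ 2 := by
        field_simp; ring
      have z2 : s * (s⁻¹ * (e * w) + v1) ^ 2 = s⁻¹ * (e ^ 2 * w ^ 2) + 2 * (e * w * v1) + s * v1 ^ 2 := by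
        field_simp; ring
      have z3 : s * (s⁻¹ * (e * v) - w1) ^ 2 = s⁻¹ * (e ^ 2 * v ^ 2) - 2 * (e * v * w1) + s * w1 ^ 2 := by
        field_simp; ring
      have z4 : s * (s⁻¹ * (e * v) + w1) ^ 2 = s⁻¹ * (e ^ 2 * v ^ 2) + 2 * (e * v * w1) + s * w1 ^ 2 := by
        field_simp; ring
      rw [abs_le]
      constructor <;> linarith)
    (A := 576 * K ^ 3) (by
      rw [II_add hε hT ((n1.add n2).add n3) n4, II_add hε hT (n1.add n2) n3, II_add hε hT n1 n2]
      linarith [E4b hε hT hf hφ, E4b hε hT hf hψ, E0a hε hT hφ, E0a hε hT hψ])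
    (cc1_en hε hT hf hφ) (cc1_en hε hT hf hψ)
  nlinarith

theorem B2 {ε T : ℝ} (hε : 0 < ε) (hT : ε ≤ T) {f : S} (hf : ∀ x, |D f x| ≤ 1) {φ ψ : S}
    (hφ : ∫ x, φ x * φ x ≤ 1) (hψ : ∫ x, ψ x * ψ x ≤ 1) : |II ε T (fun s z => U (D f) s z * U (D f) s z * W φ ψ s z)| ≤ 230 * K ^ 2 := by
  have hK := K_one
  have n1 : Nice (fun s z => s * (U (D (D f)) s z ^ 2 * U φ s z ^ 2)) :=
    ((U_nice _).sq.mul (U_nice φ).sq).smul'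
  have n2 : Nice (fun s z => s * (U (D (D f)) s z ^ 2 * U ψ s z ^ 2)) :=
    ((U_nice _).sq.mul (U_nice ψ).sq).smul'
  have n3 : Nice (fun s z => K * (s * U (D φ) s z ^ 2)) := ((U_nice _).sq.smul').cmul _
  have n4 : Nice (fun s z => K * (s * U (D ψ) s z ^ 2)) := ((U_nice _).sq.smul').cmul _
  have h3 : K ≤ K ^ 2 := le_self_pow₀ hK (by norm_num)
  have aux : ∀ χ : S, ∫ x, χ x * χ x ≤ 1 → II ε T (fun s z => s * ((U (D (D f)) s z * U (D f) s z +
      U (D f) s z * U (D (D f)) s z) ^ 2 * U χ s z ^ 2)) ≤ 72 * K ^ 2 := by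
    intro χ hχ
    have n5 : Nice (fun s z => 4 * (s * (U (D (D f)) s z ^ 2 * U χ s z ^ 2))) :=
      (((U_nice _).sq.mul (U_nice χ).sq).smul').cmul _
    have h := II_mono hε hT (((((U_Ht (D f)).mul (U_Ht (D f))).n1.sq).mul (U_nice χ).sq).smul') n5
      (fun s hs z => by
        have ha := b1 hf s z
        generalize U (D f) s z = α at *
        generalize U (D (D f)) s z = α1 at *
        generalize U χ s z = v at *
        have h1 : (α1 * α + α * α1) ^ 2 ≤ 4 * α1 ^ 2 := by
          nlinarith [mul_le_of_le_one_left (sq_nonneg α1) ha]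
        calc _ ≤ s * ((4 * α1 ^ 2) * v ^ 2) := by gcongr
          _ = _ := by ring)
    rw [II_cmul] at h
    have := E3 hε hT hf hχ
    linarith
  have h := Blem hε hT hφ hψ ((U_Ht (D f)).mul (U_Ht (D f))) zero_le_one
    (fun s hs z => by
      have := b1 hf s z
      rw [abs_of_nonneg (mul_self_nonneg _)]; linarith)
    (((n1.add n2).add n3).add n4) (fun s hs z => by
      unfold W
      have hk := k2 (s := s) hf z
      generalize U φ s z = v at *
      generalize U ψ s z = w at *
      generalize U (D φ) s z = v1 at *
      generalize U (D ψ) s z = w1 at *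
      generalize U (D f) s z = α at *
      generalize U (D (D f)) s z = α1 at *
      have y1 := mul_nonneg hs.le (sq_nonneg (α1 * w - s * α1 * v1))
      have y2 := mul_nonneg hs.le (sq_nonneg (α1 * w + s * α1 * v1))
      have y3 := mul_nonneg hs.le (sq_nonneg (α1 * v - s * α1 * w1))
      have y4 := mul_nonneg hs.le (sq_nonneg (α1 * v + s * α1 * w1))
      have y5 : (s * α1) ^ 2 * (s * v1 ^ 2) ≤ K * (s * v1 ^ 2) := by gcongr
      have y6 : (s * α1) ^ 2 * (s * w1 ^ 2) ≤ K * (s * w1 ^ 2) := by gcongr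
      rw [abs_le]
      constructor <;> nlinarith)
    (A := 72 * K ^ 2) (by
      rw [II_add hε hT ((n1.add n2).add n3) n4, II_add hε hT (n1.add n2) n3, II_add hε hT n1 n2,
        II_cmul, II_cmul]
      have a1 := mul_le_mul_of_nonneg_left (E0a hε hT hφ) K_pos.le
      have a2 := mul_le_mul_of_nonneg_left (E0a hε hT hψ) K_pos.le
      have a3 := E3 hε hT hf hφ
      have a4 := E3 hε hT hf hψ
      nlinarith)
    (aux φ hφ) (aux ψ hψ)
  linarith

theorem B3 {ε T : ℝ} (hε : 0 < ε) (hT : ε ≤ T) {f : S} (hf : ∀ x, |D f x| ≤ 1) {φ ψ : S}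
    (hφ : ∫ x, φ x * φ x ≤ 1) (hψ : ∫ x, ψ x * ψ x ≤ 1) : |II ε T (fun s z => U (D f) s z * W φ ψ s z)| ≤ 68 * K := by
  have hK := K_one
  have h := Blem hε hT hφ hψ (U_Ht (D f)) zero_le_one
    (fun s hs z => (sq_le_one_iff_abs_le_one _).1 (b1 hf s z)) Nice.zero
    (fun s hs z => by simp) (A := 18 * K) (by rw [II_zero]; positivity)
    (E3 hε hT hf hφ) (E3 hε hT hf hψ)
  linarith


end CC

open MeasureTheory Set Filter Topology

namespace CC

theorem yo1 {s : ℝ} (hs : 0 < s) (a b : ℝ) : |2 * (a * b)| ≤ s⁻¹ * a ^ 2 + s * b ^ 2 := by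
  have h1 := mul_nonneg hs.le (sq_nonneg (s⁻¹ * a - b))
  have h2 := mul_nonneg hs.le (sq_nonneg (s⁻¹ * a + b))
  have e1 : s * (s⁻¹ * a - b) ^ 2 = s⁻¹ * a ^ 2 - 2 * (a * b) + s * b ^ 2 := by field_simp; ring
  have e2 : s * (s⁻¹ * a + b) ^ 2 = s⁻¹ * a ^ 2 + 2 * (a * b) + s * b ^ 2 := by field_simp; ring
  rw [abs_le]
  constructor <;> linarith

theorem yo2 {s : ℝ} (hs : 0 < s) (a b : ℝ) : |2 * (s⁻¹ * (a * b))| ≤ s⁻¹ ^ 3 * a ^ 2 + s * b ^ 2 := by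
  have := yo1 hs (s⁻¹ * a) b
  calc _ = |2 * (s⁻¹ * a * b)| := by ring_nf
    _ ≤ _ := this
    _ = _ := by ring

theorem yo3 {s : ℝ} (hs : 0 < s) (a b : ℝ) :
    |2 * (s⁻¹ ^ 2 * (a * b))| ≤ s⁻¹ ^ 3 * a ^ 2 + s⁻¹ * b ^ 2 := by
  have := yo2 hs a (s⁻¹ * b)
  calc _ = |2 * (s⁻¹ * (a * (s⁻¹ * b)))| := by ring_nf
    _ ≤ _ := this
    _ = _ := by field_simp

theorem yo4 {s : ℝ} (hs : 0 < s) (a b : ℝ) :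
    |2 * (s⁻¹ ^ 2 * (a * b))| ≤ s⁻¹ ^ 5 * a ^ 2 + s * b ^ 2 := by
  have := yo2 hs (s⁻¹ * a) b
  calc _ = |2 * (s⁻¹ * (s⁻¹ * a * b))| := by ring_nf
    _ ≤ _ := this
    _ = _ := by ring

theorem abs_mul_le {x y c d : ℝ} (hx : x ^ 2 ≤ c ^ 2) (hc : 0 ≤ c) (hy : |y| ≤ d) : |x * y| ≤ c * d := by
  rw [abs_mul]
  exact mul_le_mul (abs_le_of_sq_le_sq hx hc) hy (abs_nonneg _) hc

/-- antisymmetrized covariance -/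
noncomputable def P (f φ ψ : S) (s z : ℝ) : ℝ := H f φ s z * U ψ s z - H f ψ s z * U φ s z

theorem P_Ht (f φ ψ : S) : Ht (P f φ ψ)
    (fun s z => H1 f φ s z * U ψ s z + H f φ s z * U (D ψ) s z
      - (H1 f ψ s z * U φ s z + H f ψ s z * U (D φ) s z))
    (fun s z => 2 * (U (D f) s z * W φ ψ s z) - 2 * (H1 f φ s z * U (D ψ) s z)
      + 2 * (H1 f ψ s z * U (D φ) s z)) :=
  (((H_Ht f φ).mul (U_Ht ψ)).sub ((H_Ht f ψ).mul (U_Ht φ))).congr (fun _ _ _ => rfl)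
    (fun s _ z => by unfold W; ring)


theorem P_bd {f : S} (hf : ∀ x, |D f x| ≤ 1) {s : ℝ} (hs : 0 < s) (φ ψ : S) (z : ℝ) :
    |s⁻¹ * P f φ ψ s z| ≤ K * (U (mu φ φ) s z + U (mu ψ ψ) s z) := by
  have a1 := k5 (s := s) φ z
  have a2 := k5 (s := s) ψ z
  have a3 := k8 hf hs φ z
  have a4 := k8 hf hs ψ z
  unfold P
  generalize U φ s z = v at *
  generalize U ψ s z = w at *
  generalize H f φ s z = a at *
  generalize H f ψ s z = b at *
  have a5 : (s⁻¹ * a) ^ 2 ≤ K * U (mu φ φ) s z := by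
    rw [mul_pow, inv_pow, inv_mul_le_iff₀ (by positivity)]; linarith
  have a6 : (s⁻¹ * b) ^ 2 ≤ K * U (mu ψ ψ) s z := by
    rw [mul_pow, inv_pow, inv_mul_le_iff₀ (by positivity)]; linarith
  rw [abs_le]
  constructor <;> nlinarith [sq_nonneg (s⁻¹ * a - w), sq_nonneg (s⁻¹ * a + w), sq_nonneg (s⁻¹ * b - v), sq_nonneg (s⁻¹ * b + v)]


theorem X1 {ε T : ℝ} (hε : 0 < ε) (hT : ε ≤ T) {f : S} (hf : ∀ x, |D f x| ≤ 1) {φ ψ : S}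
    (hφ : ∫ x, φ x * φ x ≤ 1) (hψ : ∫ x, ψ x * ψ x ≤ 1) : |II ε T (fun s z => s⁻¹ ^ 2 * P f φ ψ s z)| ≤ 154 * K := by
  have hP := P_Ht f φ ψ
  have n1 : Nice (fun s z => s⁻¹ * H1 f φ s z ^ 2) := (H_Ht f φ).n1.sq.sinv1
  have n2 : Nice (fun s z => s⁻¹ * H1 f ψ s z ^ 2) := (H_Ht f ψ).n1.sq.sinv1
  have n3 : Nice (fun s z => s * U (D φ) s z ^ 2) := ((U_nice _).sq.smul')
  have n4 : Nice (fun s z => s * U (D ψ) s z ^ 2) := ((U_nice _).sq.smul')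
  have m1 : Nice (fun s z => s⁻¹ ^ 2 * P f φ ψ s z) := hP.n.sinv 2
  have m2 : Nice (fun s z => 2 * (U (D f) s z * W φ ψ s z)) := ((U_nice _).mul (W_Ht φ ψ).n).cmul 2
  have h := Ht_abs hε hT hP (Wt_inv 1) (m1.sub m2) (((n1.add n2).add n3).add n4)
    ((U_nice (mu φ φ)).add (U_nice (mu ψ ψ))) K_pos.le (B := 2)
    (fun s hs => by
      rw [integral_add ((U_nice _).integrable hs) ((U_nice _).integrable hs)]
      linarith [mass hφ s hs, mass hψ s hs])
    (fun s hs z => by rw [pow_one]; exact P_bd hf hs φ ψ z)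
    (fun s hs z => by
      have y1 := abs_le.1 (yo1 hs (H1 f φ s z) (U (D ψ) s z))
      have y2 := abs_le.1 (yo1 hs (H1 f ψ s z) (U (D φ) s z))
      have e : s * s⁻¹ ^ 1 = 1 := by field_simp
      rw [e]
      push_cast
      rw [abs_le]
      constructor <;> linarith [y1.1, y1.2, y2.1, y2.2])
  rw [II_sub hε hT m1 m2, II_add hε hT ((n1.add n2).add n3) n4, II_add hε hT (n1.add n2) n3,
    II_add hε hT n1 n2, II_cmul] at h
  have h1 := abs_le.1 (B3 hε hT hf hφ hψ)
  have h2 := E1b hε hT hf hφ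
  have h3 := E1b hε hT hf hψ
  have h4 := E0a hε hT hφ
  have h5 := E0a hε hT hψ
  have h := abs_le.1 h
  rw [abs_le]
  constructor <;> linarith [h.1, h.2, h1.1, h1.2]

theorem X0 {ε T : ℝ} (hε : 0 < ε) (hT : ε ≤ T) {f : S} (hf : ∀ x, |D f x| ≤ 1) {φ ψ : S}
    (hφ : ∫ x, φ x * φ x ≤ 1) (hψ : ∫ x, ψ x * ψ x ≤ 1) : |II ε T (fun s z => s⁻¹ ^ 2 * (U (D f) s z * P f φ ψ s z))| ≤ 540 * K ^ 2 := by
  have hP := (U_Ht (D f)).mul (P_Ht f φ ψ)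
  have hK := K_one
  have n1 : Nice (fun s z => 2 * (s⁻¹ * H1 f φ s z ^ 2)) := (H_Ht f φ).n1.sq.sinv1.cmul 2
  have n2 : Nice (fun s z => 2 * (s⁻¹ * H1 f ψ s z ^ 2)) := (H_Ht f ψ).n1.sq.sinv1.cmul 2
  have n3 : Nice (fun s z => 2 * (s * U (D φ) s z ^ 2)) := ((U_nice _).sq.smul').cmul 2
  have n4 : Nice (fun s z => 2 * (s * U (D ψ) s z ^ 2)) := ((U_nice _).sq.smul').cmul 2
  have n5 : Nice (fun s z => s * (U (D (D f)) s z ^ 2 * U φ s z ^ 2)) :=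
    ((U_nice _).sq.mul (U_nice φ).sq).smul'
  have n6 : Nice (fun s z => s * (U (D (D f)) s z ^ 2 * U ψ s z ^ 2)) :=
    ((U_nice _).sq.mul (U_nice ψ).sq).smul'
  have n7 : Nice (fun s z => K * (s⁻¹ ^ 3 * H f φ s z ^ 2)) := ((H_Ht f φ).n.sq.sinv 3).cmul _
  have n8 : Nice (fun s z => K * (s⁻¹ ^ 3 * H f ψ s z ^ 2)) := ((H_Ht f ψ).n.sq.sinv 3).cmul _
  have m1 : Nice (fun s z => s⁻¹ ^ 2 * (U (D f) s z * P f φ ψ s z)) := hP.n.sinv 2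
  have m2 : Nice (fun s z => 2 * (U (D f) s z * U (D f) s z * W φ ψ s z)) :=
    (((U_nice _).mul (U_nice _)).mul (W_Ht φ ψ).n).cmul 2
  have h := Ht_abs hε hT hP (Wt_inv 1) (m1.sub m2)
    (((((((n1.add n2).add n3).add n4).add n5).add n6).add n7).add n8)
    ((U_nice (mu φ φ)).add (U_nice (mu ψ ψ))) K_pos.le (B := 2)
    (fun s hs => by
      rw [integral_add ((U_nice _).integrable hs) ((U_nice _).integrable hs)]
      linarith [mass hφ s hs, mass hψ s hs])
    (fun s hs z => by
      have h1 := P_bd hf hs φ ψ z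
      have h2 := b1 hf s z
      have := abs_mul_le (c := 1) (by linarith) zero_le_one h1
      rw [one_mul] at this
      convert this using 2; ring)
    (fun s hs z => by
      have hα := b1 hf s z
      have hk := k2 (s := s) hf z
      have hα' : U (D f) s z ^ 2 ≤ 1 ^ 2 := by linarith
      have y1 := abs_le.1 (abs_mul_le hα' zero_le_one (yo1 hs (H1 f φ s z) (U (D ψ) s z)))
      have y2 := abs_le.1 (abs_mul_le hα' zero_le_one (yo1 hs (H1 f ψ s z) (U (D φ) s z)))
      have y3 := abs_le.1 (yo1 hs (H1 f φ s z) (U (D (D f)) s z * U ψ s z))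
      have y4 := abs_le.1 (yo1 hs (H1 f ψ s z) (U (D (D f)) s z * U φ s z))
      have y5 := abs_le.1 (yo2 hs (s * U (D (D f)) s z * H f φ s z) (U (D ψ) s z))
      have y6 := abs_le.1 (yo2 hs (s * U (D (D f)) s z * H f ψ s z) (U (D φ) s z))
      have e5 : 2 * (s⁻¹ * (s * U (D (D f)) s z * H f φ s z * U (D ψ) s z)) =
        2 * (U (D (D f)) s z * H f φ s z * U (D ψ) s z) := by field_simp
      have e6 : 2 * (s⁻¹ * (s * U (D (D f)) s z * H f ψ s z * U (D φ) s z)) =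
        2 * (U (D (D f)) s z * H f ψ s z * U (D φ) s z) := by field_simp
      rw [e5] at y5
      rw [e6] at y6
      have x5 : s⁻¹ ^ 3 * (s * U (D (D f)) s z * H f φ s z) ^ 2 ≤ K * (s⁻¹ ^ 3 * H f φ s z ^ 2) := by
        calc _ = (s * U (D (D f)) s z) ^ 2 * (s⁻¹ ^ 3 * H f φ s z ^ 2) := by ring
          _ ≤ _ := by gcongr
      have x6 : s⁻¹ ^ 3 * (s * U (D (D f)) s z * H f ψ s z) ^ 2 ≤ K * (s⁻¹ ^ 3 * H f ψ s z ^ 2) := by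
        calc _ = (s * U (D (D f)) s z) ^ 2 * (s⁻¹ ^ 3 * H f ψ s z ^ 2) := by ring
          _ ≤ _ := by gcongr
      have e : s * s⁻¹ ^ 1 = 1 := by field_simp
      rw [e]
      push_cast
      rw [abs_le]
      constructor <;> linarith [y1.1, y1.2, y2.1, y2.2, y3.1, y3.2, y4.1, y4.2, y5.1, y5.2, y6.1, y6.2])
  rw [II_sub hε hT m1 m2, II_add hε hT (((((((n1.add n2).add n3).add n4).add n5).add n6).add n7)) n8,
    II_add hε hT ((((((n1.add n2).add n3).add n4).add n5).add n6)) n7,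
    II_add hε hT (((((n1.add n2).add n3).add n4).add n5)) n6,
    II_add hε hT ((((n1.add n2).add n3).add n4)) n5,
    II_add hε hT ((n1.add n2).add n3) n4, II_add hε hT (n1.add n2) n3,
    II_add hε hT n1 n2] at h
  simp only [II_cmul] at h
  have h1 := abs_le.1 (B2 hε hT hf hφ hψ)
  have h2 := E1b hε hT hf hφ
  have h3 := E1b hε hT hf hψ
  have h4 := E0a hε hT hφ
  have h5 := E0a hε hT hψ
  have h6 := E3 hε hT hf hφ
  have h7 := E3 hε hT hf hψ
  have h8 := mul_le_mul_of_nonneg_left (E1a hε hT hf hφ) K_pos.le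
  have h9 := mul_le_mul_of_nonneg_left (E1a hε hT hf hψ) K_pos.le
  have h := abs_le.1 h
  have hKK : K ≤ K ^ 2 := le_self_pow₀ hK (by norm_num)
  rw [abs_le]
  constructor <;> nlinarith [h.1, h.2, h1.1, h1.2]


/-- the bilinear integrand -/
noncomputable def J (f h k : S) (s z : ℝ) : ℝ :=
  U (mu f (mu f k)) s z * U (D h) s z - 2 * (U (mu f k) s z * U (mu f (D h)) s z)
    + U k s z * U (mu f (mu f (D h))) s z

theorem J_nice (f h k : S) : Nice (J f h k) :=
  (((U_nice _).mul (U_nice _)).sub (((U_nice _).mul (U_nice _)).cmul 2)).add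
    ((U_nice _).mul (U_nice _))

theorem J_eq (f h k : S) : ∃ g g1, DX g g1 ∧ ∀ s z, J f h k s z =
    (ka f k s z * U (D h) s z - ka f h s z * U (D k) s z - 2 * (H f k s z * H1 f h s z))
    + H f f s z * W h k s z + 2 * (U (D f) s z * P f h k s z) - 2 * P f (mu (D f) h) k s z
    + g1 s z := by
  refine ⟨_, _, (((U_DX k).mul (U_DX (mu f (mu f h)))).sub
    ((((U_DX f).mul (U_DX (mu f h))).mul (U_DX k)).cmul 2)).add
    (((U_DX f).mul (U_DX f)).mul ((U_DX k).mul (U_DX h))), fun s z => ?_⟩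
  have e1 : U (D (mu f h)) s z = U (mu (D f) h) s z + U (mu f (D h)) s z := by rw [D_mu, U_add]
  have e2 : U (D (mu f (mu f h))) s z =
      U (mu f (mu (D f) h)) s z + U (mu f (mu (D f) h)) s z + U (mu f (mu f (D h))) s z := by
    rw [← U_add, ← U_add]
    congr 1
    ext x
    simp only [D_mu, add_apply, mu_apply]
    ring
  unfold J ka H1 W P H
  rw [e1, e2]
  ring

theorem main_energy : ∃ C : ℝ, 0 ≤ C ∧ ∀ ε T : ℝ, 0 < ε → ε ≤ T → ∀ f h k : S,
    (∀ x, |D f x| ≤ 1) → ∫ x, h x * h x ≤ 1 → ∫ x, k x * k x ≤ 1 →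
    |II ε T (fun s z => s⁻¹ ^ 2 * J f h k s z)| ≤ C := by
  have hK := K_one
  refine ⟨102 * K ^ 2 + 13 * K + 1742 * K ^ 3 + 2 * (540 * K ^ 2) + 2 * (154 * K), by positivity, ?_⟩
  intro ε T hε hT f h k hf hh hk
  obtain ⟨g, g1, hg, hJ⟩ := J_eq f h k
  have hh' : ∫ x, mu (D f) h x * mu (D f) h x ≤ 1 := by
    refine le_trans ?_ hh
    have i1 : Integrable (fun x => mu (mu (D f) h) (mu (D f) h) x) := (mu _ _).integrable
    have i2 : Integrable (fun x => mu h h x) := (mu _ _).integrable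
    simp only [mu_apply] at i1 i2 ⊢
    refine integral_mono i1 i2 (fun x => ?_)
    have h1 : D f x ^ 2 ≤ 1 := (sq_le_one_iff_abs_le_one _).2 (hf x)
    have := mul_le_of_le_one_left (mul_self_nonneg (h x)) h1
    simp only
    linarith
  have n0 : Nice (fun s z => ka f k s z * U (D h) s z - ka f h s z * U (D k) s z
    - 2 * (H f k s z * H1 f h s z)) :=
    (((ka_Ht f k).n.mul (U_nice _)).sub ((ka_Ht f h).n.mul (U_nice _))).sub
      (((H_Ht f k).n.mul (H_Ht f h).n1).cmul 2)
  have m0 : Nice (fun s z => s⁻¹ ^ 2 * (ka f k s z * U (D h) s z - ka f h s z * U (D k) s z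
    - 2 * (H f k s z * H1 f h s z))) := n0.sinv 2
  have m1 : Nice (fun s z => cc f s z * W h k s z) := (cc_Ht f).n.mul (W_Ht h k).n
  have m2 : Nice (fun s z => 2 * (s⁻¹ ^ 2 * (U (D f) s z * P f h k s z))) :=
    (((U_nice _).mul (P_Ht f h k).n).sinv 2).cmul 2
  have m3 : Nice (fun s z => 2 * (s⁻¹ ^ 2 * P f (mu (D f) h) k s z)) := ((P_Ht f _ k).n.sinv 2).cmul 2
  have hg' := hg.sinv 2
  have e : II ε T (fun s z => s⁻¹ ^ 2 * J f h k s z) =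
      II ε T (fun s z => s⁻¹ ^ 2 * (ka f k s z * U (D h) s z - ka f h s z * U (D k) s z
    - 2 * (H f k s z * H1 f h s z))) + II ε T (fun s z => cc f s z * W h k s z)
      + 2 * II ε T (fun s z => s⁻¹ ^ 2 * (U (D f) s z * P f h k s z))
      - 2 * II ε T (fun s z => s⁻¹ ^ 2 * P f (mu (D f) h) k s z) + 0 := by
    rw [← II_dx hε hT hg', ← II_cmul, ← II_cmul, ← II_add hε hT m0 m1, ← II_add hε hT (m0.add m1) m2,
      ← II_sub hε hT ((m0.add m1).add m2) m3, ← II_add hε hT (((m0.add m1).add m2).sub m3) hg'.nx]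
    refine II_congr hε hT (fun s hs z => ?_)
    rw [hJ]
    unfold cc
    ring
  have r1 : Nice (fun s z => s⁻¹ ^ 5 * ka f k s z ^ 2) := (ka_Ht f k).n.sq.sinv 5
  have r2 : Nice (fun s z => s⁻¹ ^ 5 * ka f h s z ^ 2) := (ka_Ht f h).n.sq.sinv 5
  have r3 : Nice (fun s z => s * U (D h) s z ^ 2) := ((U_nice _).sq.smul')
  have r4 : Nice (fun s z => s * U (D k) s z ^ 2) := ((U_nice _).sq.smul')
  have r5 : Nice (fun s z => 2 * (s⁻¹ ^ 3 * H f k s z ^ 2)) := ((H_Ht f k).n.sq.sinv 3).cmul 2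
  have r6 : Nice (fun s z => 2 * (s⁻¹ * H1 f h s z ^ 2)) := (H_Ht f h).n1.sq.sinv1.cmul 2
  have hb := II_abs_le hε hT (m0.cmul 2) (((((r1.add r2).add r3).add r4).add r5).add r6)
    (fun s hs z => by
      have y1 := abs_le.1 (yo4 hs (ka f k s z) (U (D h) s z))
      have y2 := abs_le.1 (yo4 hs (ka f h s z) (U (D k) s z))
      have y3 := abs_le.1 (yo3 hs (H f k s z) (H1 f h s z))
      rw [abs_le]
      constructor <;> linarith [y1.1, y1.2, y2.1, y2.2, y3.1, y3.2])
  rw [II_add hε hT ((((r1.add r2).add r3).add r4).add r5) r6,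
    II_add hε hT (((r1.add r2).add r3).add r4) r5, II_add hε hT ((r1.add r2).add r3) r4,
    II_add hε hT (r1.add r2) r3, II_add hε hT r1 r2, II_cmul, II_cmul, II_cmul] at hb
  have a1 := E2 hε hT hf hh
  have a2 := E2 hε hT hf hk
  have a3 := E0a hε hT hh
  have a4 := E0a hε hT hk
  have a5 := E1a hε hT hf hk
  have a6 := E1b hε hT hf hh
  have a7 := abs_le.1 (B1 hε hT hf hh hk)
  have a8 := abs_le.1 (X0 hε hT hf hh hk)
  have a9 := abs_le.1 (X1 hε hT hf hh' hk)
  have hb := abs_le.1 hb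
  rw [e, abs_le]
  constructor <;> linarith [hb.1, hb.2, a7.1, a7.2, a8.1, a8.2, a9.1, a9.2]

end CC

open MeasureTheory Set Filter Topology

namespace CC

/-- rescaled Gaussian -/
noncomputable def w (s t : ℝ) : ℝ := s⁻¹ * G (s⁻¹ * t)

theorem w_nonneg {s : ℝ} (hs : 0 < s) (t : ℝ) : 0 ≤ w s t :=
  mul_nonneg (inv_nonneg.2 hs.le) (G_nonneg _)

theorem w_cont (s : ℝ) : Continuous (w s) := by
  have := G_cont
  unfold w; fun_prop

theorem U_eq_w (φ : S) {s : ℝ} (hs : 0 < s) (z : ℝ) :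
    U φ s z = ∫ x, φ x * w s (z - x) := by
  unfold U
  have h1 := Measure.integral_comp_mul_left (fun x => φ (z - x) * G (s⁻¹ * x)) s
  have h2 := integral_sub_left_eq_self (fun x => φ x * G (s⁻¹ * (z - x))) volume z
  simp only [sub_sub_cancel] at h2
  have h3 : ∀ y, s⁻¹ * (s * y) = y := fun y => by field_simp
  simp only [h3] at h1
  rw [h1, h2, smul_eq_mul, abs_of_pos (inv_pos.2 hs), ← integral_const_mul]
  congr 1; ext x; unfold w; ring

/-- the heat kernel pairing -/
noncomputable def HK (s σ : ℝ) : ℝ := (2 * √Real.pi * s)⁻¹ * Real.exp (-σ ^ 2 / (4 * s ^ 2))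

theorem ww_eq {s : ℝ} (hs : 0 < s) (α β z : ℝ) :
    w s (z - α) * w s (z - β) = (s⁻¹ ^ 2 * (2 * Real.pi)⁻¹ * Real.exp (-(α - β) ^ 2 / (4 * s ^ 2))) *
      Real.exp (-(s⁻¹ ^ 2) * (z - (α + β) / 2) ^ 2) := by
  have hne := hs.ne'
  unfold w G
  have h2 : ((√(2 * Real.pi))⁻¹) * (√(2 * Real.pi))⁻¹ = (2 * Real.pi)⁻¹ := by
    rw [← mul_inv, Real.mul_self_sqrt (by positivity)]
  rw [← h2]
  have h3 : Real.exp (-(1 / 2) * (s⁻¹ * (z - α)) ^ 2) * Real.exp (-(1 / 2) * (s⁻¹ * (z - β)) ^ 2)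
      = Real.exp (-(α - β) ^ 2 / (4 * s ^ 2)) * Real.exp (-(s⁻¹ ^ 2) * (z - (α + β) / 2) ^ 2) := by
    rw [← Real.exp_add, ← Real.exp_add]
    congr 1
    field_simp
    ring
  linear_combination (s⁻¹ ^ 2 * ((√(2 * Real.pi))⁻¹) * (√(2 * Real.pi))⁻¹) * h3

theorem ww_int {s : ℝ} (hs : 0 < s) (α β : ℝ) :
    Integrable (fun z => w s (z - α) * w s (z - β)) := by
  simp only [ww_eq hs]
  refine Integrable.const_mul ?_ _
  exact (integrable_exp_neg_mul_sq (b := s⁻¹ ^ 2) (by positivity)).comp_sub_right ((α + β) / 2)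

theorem ww_val {s : ℝ} (hs : 0 < s) (α β : ℝ) :
    ∫ z, w s (z - α) * w s (z - β) = HK s (α - β) := by
  simp only [ww_eq hs]
  rw [integral_const_mul, integral_sub_right_eq_self (fun z => Real.exp (-(s⁻¹ ^ 2) * z ^ 2)),
    integral_gaussian, HK]
  have : Real.pi / s⁻¹ ^ 2 = Real.pi * s ^ 2 := by field_simp
  rw [this, Real.sqrt_mul Real.pi_pos.le, Real.sqrt_sq hs.le]
  have hp : √Real.pi * √Real.pi = Real.pi := Real.mul_self_sqrt Real.pi_pos.le
  have hp0 : √Real.pi ≠ 0 := by positivity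
  have hne := hs.ne'
  rw [← hp]
  field_simp
  rw [Real.sqrt_sq (Real.sqrt_nonneg _)]

theorem HK_nonneg {s : ℝ} (hs : 0 < s) (σ : ℝ) : 0 ≤ HK s σ := by unfold HK; positivity

theorem HK_le {s : ℝ} (hs : 0 < s) (σ : ℝ) : HK s σ ≤ (2 * √Real.pi * s)⁻¹ := by
  unfold HK
  refine mul_le_of_le_one_right (by positivity) ?_
  rw [Real.exp_le_one_iff]
  apply div_nonpos_of_nonpos_of_nonneg <;> [nlinarith [sq_nonneg σ]; positivity]

theorem HK_cont (s : ℝ) : Continuous (HK s) := by unfold HK; fun_prop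

theorem prodint (φ ψ : S) : Integrable (fun p : ℝ × ℝ => φ p.1 * ψ p.2) :=
  Integrable.mul_prod φ.integrable ψ.integrable

theorem prodK_int (φ ψ : S) {s : ℝ} (hs : 0 < s) :
    Integrable (fun p : ℝ × ℝ => φ p.1 * ψ p.2 * HK s (p.1 - p.2)) := by
  have h1 := φ.continuous
  have h2 := ψ.continuous
  have h3 := HK_cont s
  refine ((prodint φ ψ).norm.mul_const (2 * √Real.pi * s)⁻¹).mono'
    (by fun_prop) (Eventually.of_forall fun p => ?_)
  rw [norm_mul, Real.norm_of_nonneg (HK_nonneg hs _)]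
  exact mul_le_mul_of_nonneg_left (HK_le hs _) (norm_nonneg _)

theorem UU (φ ψ : S) {s : ℝ} (hs : 0 < s) :
    ∫ z, U φ s z * U ψ s z = ∫ p : ℝ × ℝ, φ p.1 * ψ p.2 * HK s (p.1 - p.2) := by
  have h1 := φ.continuous
  have h2 := ψ.continuous
  have h3 := w_cont s
  have e1 : ∀ z, U φ s z * U ψ s z
      = ∫ p : ℝ × ℝ, φ p.1 * ψ p.2 * (w s (z - p.1) * w s (z - p.2)) := by
    intro z
    rw [U_eq_w φ hs, U_eq_w ψ hs, ← integral_prod_mul]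
    congr 1; ext p; ring
  simp only [e1]
  rw [integral_integral_swap]
  · congr 1; ext p
    rw [integral_const_mul, ww_val hs]
  · rw [integrable_prod_iff' (by simp only [Function.uncurry_def]; fun_prop)]
    simp only [Function.uncurry]
    constructor
    · exact Eventually.of_forall fun p => (ww_int hs _ _).const_mul _
    · refine (prodK_int φ ψ hs).norm.congr (Eventually.of_forall fun p => ?_)
      simp only [norm_mul, Real.norm_of_nonneg (w_nonneg hs _), Real.norm_of_nonneg (HK_nonneg hs _)]
      rw [integral_const_mul, ww_val hs]

/-- numerator -/
noncomputable def Ph (f h k : S) (p : ℝ × ℝ) : ℝ := (f p.1 - f p.2) ^ 2 * (k p.1 * D h p.2)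

theorem J_int (f h k : S) {s : ℝ} (hs : 0 < s) :
    ∫ z, J f h k s z = ∫ p : ℝ × ℝ, Ph f h k p * HK s (p.1 - p.2) := by
  unfold J
  have n1 := ((U_nice (mu f (mu f k))).mul (U_nice (D h))).integrable hs
  have n2 := ((U_nice (mu f k)).mul (U_nice (mu f (D h)))).integrable hs
  have n3 := ((U_nice k).mul (U_nice (mu f (mu f (D h))))).integrable hs
  have n12 : Integrable (fun z => U (mu f (mu f k)) s z * U (D h) s z
      - 2 * (U (mu f k) s z * U (mu f (D h)) s z)) := n1.sub (n2.const_mul 2)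
  rw [integral_add n12 n3, integral_sub n1 (n2.const_mul 2),
    integral_const_mul, UU _ _ hs, UU _ _ hs, UU _ _ hs]
  have m1 := prodK_int (mu f (mu f k)) (D h) hs
  have m2 := prodK_int (mu f k) (mu f (D h)) hs
  have m3 := prodK_int k (mu f (mu f (D h))) hs
  have m12 := m1.sub (m2.const_mul 2)
  simp only [Pi.sub_def] at m12
  rw [← integral_const_mul, ← integral_sub m1 (m2.const_mul 2),
    ← integral_add m12 m3]
  congr 1; ext p
  simp only [mu_apply, Ph]; ring

theorem Ph_cont (f h k : S) : Continuous (Ph f h k) := by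
  have h1 := f.continuous
  have h2 := k.continuous
  have h3 := (D h).continuous
  unfold Ph; fun_prop

theorem Ph_int (f h k : S) : Integrable (Ph f h k) := by
  obtain ⟨C, h0, hC⟩ := S_bdd f
  refine ((prodint k (D h)).norm.const_mul ((2 * C) ^ 2)).mono'
    (Ph_cont f h k).aestronglyMeasurable (Eventually.of_forall fun p => ?_)
  unfold Ph
  rw [norm_mul]
  refine mul_le_mul_of_nonneg_right ?_ (norm_nonneg _)
  rw [norm_pow, Real.norm_eq_abs]
  have := (abs_sub (f p.1) (f p.2)).trans (add_le_add (hC p.1) (hC p.2))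
  exact pow_le_pow_left₀ (abs_nonneg _) (by linarith) 2

theorem HK_time {ε T σ : ℝ} (hε : 0 < ε) (hT : ε ≤ T) (hσ : σ ≠ 0) :
    ∫ s in ε..T, s⁻¹ ^ 2 * HK s σ = (√Real.pi)⁻¹ * (σ ^ 2)⁻¹ *
      (Real.exp (-σ ^ 2 / (4 * T ^ 2)) - Real.exp (-σ ^ 2 / (4 * ε ^ 2))) := by
  have hp0 : √Real.pi ≠ 0 := by positivity
  have hpos : ∀ s ∈ uIcc ε T, 0 < s := fun s hs => by
    rw [uIcc_of_le hT] at hs; exact hε.trans_le hs.1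
  have hd : ∀ s ∈ uIcc ε T, HasDerivAt (fun s => (√Real.pi)⁻¹ * (σ ^ 2)⁻¹ *
      Real.exp (-σ ^ 2 / (4 * s ^ 2))) (s⁻¹ ^ 2 * HK s σ) s := by
    intro s hs
    have hs0 := (hpos s hs).ne'
    have h1 : HasDerivAt (fun s : ℝ => 4 * s ^ 2) (4 * (2 * s)) s := by
      simpa using (hasDerivAt_pow 2 s).const_mul (4:ℝ)
    have h2 := ((hasDerivAt_const s (-σ ^ 2)).div h1 (by positivity)).exp.const_mul
      ((√Real.pi)⁻¹ * (σ ^ 2)⁻¹)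
    refine h2.congr_deriv ?_
    unfold HK
    simp only [Pi.div_apply]
    field_simp
    ring
  rw [intervalIntegral.integral_eq_sub_of_hasDerivAt hd]
  · ring
  · apply ContinuousOn.intervalIntegrable
    intro s hs
    have hs0 := (hpos s hs).ne'
    have : ContinuousAt (fun s => s⁻¹ ^ 2 * HK s σ) s := by
      unfold HK
      have : 2 * √Real.pi * s ≠ 0 := by positivity
      have : 4 * s ^ 2 ≠ 0 := by positivity
      fun_prop (disch := assumption)
    exact this.continuousWithinAt

/-- the bilinear form density -/
noncomputable def Q (f h k : S) (p : ℝ × ℝ) : ℝ :=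
  ((f p.1 - f p.2) / (p.1 - p.2)) ^ 2 * (k p.1 * D h p.2)

theorem quot_le {f : S} (hf : ∀ x, |D f x| ≤ 1) (x y : ℝ) : |(f x - f y) / (x - y)| ≤ 1 := by
  rw [abs_div]
  exact div_le_one_of_le₀ (lip hf x y) (abs_nonneg _)

theorem Q_meas (f h k : S) : Measurable (Q f h k) := by
  have h1 := f.continuous.measurable
  have h2 := k.continuous.measurable
  have h3 := (D h).continuous.measurable
  unfold Q; fun_prop

theorem Q_le {f : S} (h k : S) (hf : ∀ x, |D f x| ≤ 1) (p : ℝ × ℝ) :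
    ‖Q f h k p‖ ≤ ‖k p.1 * D h p.2‖ := by
  unfold Q
  rw [norm_mul]
  refine mul_le_of_le_one_left (norm_nonneg _) ?_
  rw [norm_pow, Real.norm_eq_abs]
  exact pow_le_one₀ (abs_nonneg _) (quot_le hf _ _)

theorem Q_int {f : S} (h k : S) (hf : ∀ x, |D f x| ≤ 1) : Integrable (Q f h k) :=
  (prodint k (D h)).norm.mono' (Q_meas f h k).aestronglyMeasurable
    (Eventually.of_forall (Q_le h k hf))

theorem II_eq (f h k : S) {ε T : ℝ} (hε : 0 < ε) (hT : ε ≤ T) :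
    II ε T (fun s z => s⁻¹ ^ 2 * J f h k s z) = (√Real.pi)⁻¹ * ∫ p : ℝ × ℝ, Q f h k p *
      (Real.exp (-(p.1 - p.2) ^ 2 / (4 * T ^ 2)) - Real.exp (-(p.1 - p.2) ^ 2 / (4 * ε ^ 2))) := by
  have e1 : II ε T (fun s z => s⁻¹ ^ 2 * J f h k s z)
      = ∫ s in ε..T, ∫ p : ℝ × ℝ, s⁻¹ ^ 2 * (Ph f h k p * HK s (p.1 - p.2)) := by
    unfold II
    refine intervalIntegral.integral_congr (fun s hs => ?_)
    rw [uIcc_of_le hT] at hs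
    simp only
    rw [integral_const_mul, integral_const_mul, J_int _ _ _ (hε.trans_le hs.1)]
  rw [e1, intervalIntegral.integral_of_le hT, integral_integral_swap, ← integral_const_mul]
  · congr 1; ext p
    rw [← intervalIntegral.integral_of_le hT]
    have : ∀ s, s⁻¹ ^ 2 * (Ph f h k p * HK s (p.1 - p.2))
        = Ph f h k p * (s⁻¹ ^ 2 * HK s (p.1 - p.2)) := fun s => by ring
    simp only [this]
    rw [intervalIntegral.integral_const_mul]
    by_cases h0 : p.1 - p.2 = 0
    · have : p.1 = p.2 := sub_eq_zero.1 h0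
      simp [Ph, Q, this]
    · rw [HK_time hε hT h0, Ph, Q]
      field_simp
  · have hb : Integrable (fun q : ℝ × (ℝ × ℝ) => (ε⁻¹ ^ 2 * (2 * √Real.pi * ε)⁻¹) * ‖Ph f h k q.2‖)
        ((volume.restrict (Ioc ε T)).prod volume) :=
      Integrable.mul_prod (integrable_const _) (Ph_int f h k).norm
    refine hb.mono' ?_ ?_
    · have := (Ph_cont f h k).measurable
      simp only [Function.uncurry_def, HK]
      apply Measurable.aestronglyMeasurable
      fun_prop
    · have : (volume.restrict (Ioc ε T)).prod (volume : Measure (ℝ × ℝ))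
          = (volume.prod volume).restrict (Ioc ε T ×ˢ univ) := by
        rw [← Measure.prod_restrict, Measure.restrict_univ]
      rw [this]
      filter_upwards [ae_restrict_mem (measurableSet_Ioc.prod MeasurableSet.univ)] with q hq
      have hq1 : ε < q.1 := hq.1.1
      have hq0 : 0 < q.1 := hε.trans hq1
      simp only [Function.uncurry]
      rw [norm_mul, norm_mul, Real.norm_of_nonneg (HK_nonneg hq0 _),
        Real.norm_of_nonneg (by positivity : 0 ≤ q.1⁻¹ ^ 2)]
      have hk : HK q.1 (q.2.1 - q.2.2) ≤ (2 * √Real.pi * ε)⁻¹ := by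
        refine (HK_le hq0 _).trans ?_
        gcongr
      have hi : q.1⁻¹ ^ 2 ≤ ε⁻¹ ^ 2 := by gcongr
      have hk0 := HK_nonneg hq0 (q.2.1 - q.2.2)
      calc q.1⁻¹ ^ 2 * (‖Ph f h k q.2‖ * HK q.1 (q.2.1 - q.2.2))
          ≤ ε⁻¹ ^ 2 * (‖Ph f h k q.2‖ * (2 * √Real.pi * ε)⁻¹) := by gcongr
        _ = _ := by ring

theorem exp_diff_le (a b : ℝ) (ha : 0 ≤ a) (hb : 0 ≤ b) : |Real.exp (-a) - Real.exp (-b)| ≤ 1 := by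
  have h1 : Real.exp (-a) ≤ 1 := Real.exp_le_one_iff.2 (by linarith)
  have h2 : Real.exp (-b) ≤ 1 := Real.exp_le_one_iff.2 (by linarith)
  have h3 := Real.exp_pos (-a)
  have h4 := Real.exp_pos (-b)
  rw [abs_le]; constructor <;> linarith

theorem form_bound : ∃ C : ℝ, 0 ≤ C ∧ ∀ f h k : S,
    (∀ x, |D f x| ≤ 1) → ∫ x, h x * h x ≤ 1 → ∫ x, k x * k x ≤ 1 →
    |∫ p : ℝ × ℝ, Q f h k p| ≤ C := by
  obtain ⟨C, h0, hC⟩ := main_energy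
  refine ⟨√Real.pi * C, by positivity, fun f h k hf hh hk => ?_⟩
  have hlim : Tendsto (fun n : ℕ => ∫ p : ℝ × ℝ, Q f h k p *
      (Real.exp (-(p.1 - p.2) ^ 2 / (4 * ((n:ℝ) + 1) ^ 2))
        - Real.exp (-(p.1 - p.2) ^ 2 / (4 * (((n:ℝ) + 1)⁻¹) ^ 2)))) atTop
      (𝓝 (∫ p : ℝ × ℝ, Q f h k p)) := by
    refine tendsto_integral_of_dominated_convergence (fun p => ‖Q f h k p‖) ?_
      (Q_int h k hf).norm ?_ ?_
    · intro n
      have := Q_meas f h k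
      apply Measurable.aestronglyMeasurable
      fun_prop
    · refine fun n => Eventually.of_forall fun p => ?_
      rw [norm_mul]
      refine mul_le_of_le_one_right (norm_nonneg _) ?_
      rw [Real.norm_eq_abs, neg_div, neg_div]
      exact exp_diff_le _ _ (by positivity) (by positivity)
    · refine Eventually.of_forall fun p => ?_
      by_cases hp : p.1 - p.2 = 0
      · have : p.1 = p.2 := sub_eq_zero.1 hp
        simp [Q, this]
      · have hn : Tendsto (fun n : ℕ => ((n:ℝ) + 1) ^ 2) atTop atTop :=
          (tendsto_pow_atTop two_ne_zero).comp
            (tendsto_atTop_add_const_right _ 1 tendsto_natCast_atTop_atTop)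
        have hsq : 0 < (p.1 - p.2) ^ 2 := by positivity
        have l1 : Tendsto (fun n : ℕ => Real.exp (-(p.1 - p.2) ^ 2 / (4 * ((n:ℝ) + 1) ^ 2)))
            atTop (𝓝 1) := by
          have hx := Real.continuous_exp.tendsto 0
          rw [Real.exp_zero] at hx
          refine hx.comp ?_
          exact tendsto_const_nhds.div_atTop (hn.const_mul_atTop (by norm_num))
        have l2 : Tendsto (fun n : ℕ => Real.exp (-(p.1 - p.2) ^ 2 / (4 * (((n:ℝ) + 1)⁻¹) ^ 2)))
            atTop (𝓝 0) := by
          refine Real.tendsto_exp_atBot.comp ?_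
          have : ∀ n : ℕ, -(p.1 - p.2) ^ 2 / (4 * (((n:ℝ) + 1)⁻¹) ^ 2)
              = -((p.1 - p.2) ^ 2 / 4 * ((n:ℝ) + 1) ^ 2) := fun n => by
            field_simp
          simp only [this]
          exact tendsto_neg_atTop_atBot.comp (hn.const_mul_atTop (by positivity))
        simpa using (l1.sub l2).const_mul (Q f h k p)
  refine le_of_tendsto hlim.abs (Eventually.of_forall fun n => ?_)
  have hn1 : (1:ℝ) ≤ (n:ℝ) + 1 := by
    have : (0:ℝ) ≤ n := n.cast_nonneg
    linarith
  have hε : (0:ℝ) < ((n:ℝ) + 1)⁻¹ := by positivity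
  have hT : ((n:ℝ) + 1)⁻¹ ≤ (n:ℝ) + 1 := (inv_le_one_of_one_le₀ hn1).trans hn1
  have := hC _ _ hε hT f h k hf hh hk
  rw [II_eq f h k hε hT, abs_mul, abs_of_nonneg (by positivity)] at this
  have hp0 : 0 < √Real.pi := by positivity
  rwa [inv_mul_le_iff₀ hp0] at this

end CC

open MeasureTheory Set Filter Topology

namespace CC

/-- difference quotient -/
noncomputable def q (f : S) (α β : ℝ) : ℝ := (f α - f β) / (α - β)

theorem q_le {f : S} {A : ℝ} (hf : ∀ x, |D f x| ≤ A) (x y : ℝ) : |q f x y| ≤ A := by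
  have hA : 0 ≤ A := (abs_nonneg _).trans (hf 0)
  have := Convex.norm_image_sub_le_of_norm_hasDerivWithin_le (f := f) (f' := D f) (C := A)
    (s := univ) (x := y) (y := x) (fun x _ => (D_has f x).hasDerivWithinAt)
    (fun x _ => hf x) convex_univ (mem_univ _) (mem_univ _)
  unfold q
  rw [abs_div]
  exact div_le_of_le_mul₀ (abs_nonneg _) hA this

theorem q_meas (f : S) : Measurable (fun p : ℝ × ℝ => q f p.1 p.2) := by
  have h1 := f.continuous.measurable
  unfold q; fun_prop

theorem q_add (f g : S) (x y : ℝ) : q (f + g) x y = q f x y + q g x y := by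
  simp only [q, add_apply]; ring

theorem q_sub (f g : S) (x y : ℝ) : q (f - g) x y = q f x y - q g x y := by
  simp only [q, sub_apply]; ring

theorem q_smul (c : ℝ) (f : S) (x y : ℝ) : q (c • f) x y = c * q f x y := by
  simp only [q, smul_apply, smul_eq_mul]; ring

theorem D_smul (c : ℝ) (f : S) (x : ℝ) : D (c • f) x = c * D f x := by
  simp only [D, map_smul, smul_apply, smul_eq_mul]

theorem D_add (f g : S) (x : ℝ) : D (f + g) x = D f x + D g x := by
  simp only [D, map_add, add_apply]

theorem D_sub (f g : S) (x : ℝ) : D (f - g) x = D f x - D g x := by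
  simp only [D, map_sub, sub_apply]

/-- bilinear form density -/
noncomputable def R (f g h k : S) (p : ℝ × ℝ) : ℝ :=
  q f p.1 p.2 * q g p.1 p.2 * (k p.1 * D h p.2)

theorem R_bound1 : ∃ C : ℝ, 0 ≤ C ∧ ∀ f g h k : S,
    (∀ x, |D f x| ≤ 1) → (∀ x, |D g x| ≤ 1) → ∫ x, h x * h x ≤ 1 → ∫ x, k x * k x ≤ 1 →
    |∫ p : ℝ × ℝ, R f g h k p| ≤ C := by
  obtain ⟨C, h0, hC⟩ := form_bound
  refine ⟨2 * C, by positivity, fun f g h k hf hg hh hk => ?_⟩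
  have h1 : ∀ x, |D ((1 / 2 : ℝ) • (f + g)) x| ≤ 1 := fun x => by
    have h1 := abs_le.1 (hf x)
    have h2 := abs_le.1 (hg x)
    rw [D_smul, D_add, abs_le]; constructor <;> linarith
  have h2 : ∀ x, |D ((1 / 2 : ℝ) • (f - g)) x| ≤ 1 := fun x => by
    have h1 := abs_le.1 (hf x)
    have h2 := abs_le.1 (hg x)
    rw [D_smul, D_sub, abs_le]; constructor <;> linarith
  have e : ∀ p, R f g h k p
      = Q ((1 / 2 : ℝ) • (f + g)) h k p - Q ((1 / 2 : ℝ) • (f - g)) h k p := fun p => by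
    change _ = q ((1 / 2 : ℝ) • (f + g)) p.1 p.2 ^ 2 * _ - q ((1 / 2 : ℝ) • (f - g)) p.1 p.2 ^ 2 * _
    rw [q_smul, q_smul, q_add, q_sub, R]; ring
  simp only [e]
  rw [integral_sub (Q_int h k h1) (Q_int h k h2)]
  have a1 := hC _ h k h1 hh hk
  have a2 := hC _ h k h2 hh hk
  exact (abs_sub _ _).trans (by linarith)

theorem nrm_sq (k : S) : ∫ x, k x * k x = ‖k.toLp 2 volume‖ ^ 2 := by
  rw [← real_inner_self_eq_norm_sq, L2.inner_def]
  refine integral_congr_ae ?_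
  filter_upwards [k.coeFn_toLp 2 volume] with x hx
  rw [hx]; rfl

theorem R_bound : ∃ C : ℝ, 0 ≤ C ∧ ∀ f g h k : S, ∀ A B : ℝ,
    (∀ x, |D f x| ≤ A) → (∀ x, |D g x| ≤ B) →
    |∫ p : ℝ × ℝ, R f g h k p| ≤ C * A * B * ‖h.toLp 2 volume‖ * ‖k.toLp 2 volume‖ := by
  obtain ⟨C, h0, hC⟩ := R_bound1
  refine ⟨C, h0, fun f g h k A B hf hg => ?_⟩
  have hA : 0 ≤ A := (abs_nonneg _).trans (hf 0)
  have hB : 0 ≤ B := (abs_nonneg _).trans (hg 0)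
  set a := ‖h.toLp 2 volume‖ with ha
  set b := ‖k.toLp 2 volume‖ with hb
  have ha0 : 0 ≤ a := norm_nonneg _
  have hb0 : 0 ≤ b := norm_nonneg _
  have key : ∀ δ : ℝ, 0 < δ → |∫ p : ℝ × ℝ, R f g h k p|
      ≤ C * (A + δ) * (B + δ) * (a + δ) * (b + δ) := by
    intro δ hδ
    have sc : ∀ (u : S) (L : ℝ), 0 ≤ L → (∀ x, |D u x| ≤ L) →
        ∀ x, |D ((L + δ)⁻¹ • u) x| ≤ 1 := by
      intro u L hL hu x
      have hp : 0 < L + δ := by linarith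
      rw [D_smul, abs_mul, abs_of_pos (inv_pos.2 hp), inv_mul_le_iff₀ hp]
      linarith [hu x]
    have sn : ∀ u : S, ∫ x, ((‖u.toLp 2 volume‖ + δ)⁻¹ • u) x * ((‖u.toLp 2 volume‖ + δ)⁻¹ • u) x
        ≤ 1 := by
      intro u
      have hn : 0 ≤ ‖u.toLp 2 volume‖ := norm_nonneg _
      have hp : 0 < ‖u.toLp 2 volume‖ + δ := by linarith
      have e : ∀ x, ((‖u.toLp 2 volume‖ + δ)⁻¹ • u) x * ((‖u.toLp 2 volume‖ + δ)⁻¹ • u) x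
          = ((‖u.toLp 2 volume‖ + δ) ^ 2)⁻¹ * (u x * u x) := fun x => by
        simp only [smul_apply, smul_eq_mul, ← inv_pow]; ring
      simp only [e]
      rw [integral_const_mul, nrm_sq, inv_mul_le_iff₀ (by positivity), mul_one]
      gcongr
      linarith
    have := hC _ _ _ _ (sc f A hA hf) (sc g B hB hg) (sn h) (sn k)
    have e : ∀ p, R ((A + δ)⁻¹ • f) ((B + δ)⁻¹ • g) ((a + δ)⁻¹ • h) ((b + δ)⁻¹ • k) p
        = ((A + δ) * (B + δ) * (a + δ) * (b + δ))⁻¹ * R f g h k p := fun p => by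
      simp only [R, q_smul, D_smul, smul_apply, smul_eq_mul, mul_inv]; ring
    rw [← ha, ← hb] at this
    simp only [e] at this
    have hp : 0 < (A + δ) * (B + δ) * (a + δ) * (b + δ) := by positivity
    rw [integral_const_mul, abs_mul, abs_of_pos (inv_pos.2 hp), inv_mul_le_iff₀ hp] at this
    linarith
  have ht : Tendsto (fun δ : ℝ => C * (A + δ) * (B + δ) * (a + δ) * (b + δ)) (𝓝[>] 0)
      (𝓝 (C * (A + 0) * (B + 0) * (a + 0) * (b + 0))) :=
    ((by fun_prop : Continuous (fun δ : ℝ => C * (A + δ) * (B + δ) * (a + δ) * (b + δ))).tendsto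
      0).mono_left nhdsWithin_le_nhds
  simp only [add_zero] at ht
  exact ge_of_tendsto ht (by filter_upwards [self_mem_nhdsWithin] with δ hδ using key δ hδ)

/-- the operator -/
noncomputable def T (f g h : S) (α : ℝ) : ℝ := ∫ β, q f α β * q g α β * D h β

theorem qq_decay (f g : S) : ∃ C : ℝ, ∀ α β, |q f α β * q g α β| ≤ C * (1 + (α - β) ^ 2)⁻¹ := by
  obtain ⟨A, hA0, hA⟩ := S_bdd (D f)
  obtain ⟨B, hB0, hB⟩ := S_bdd (D g)
  obtain ⟨F, hF0, hF⟩ := S_bdd f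
  obtain ⟨H, hH0, hH⟩ := S_bdd g
  refine ⟨A * B + 4 * F * H, fun α β => ?_⟩
  rw [← div_eq_mul_inv, le_div_iff₀ (by positivity)]
  have h1 : |q f α β * q g α β| ≤ A * B := by
    rw [abs_mul]
    exact mul_le_mul (q_le hA _ _) (q_le hB _ _) (abs_nonneg _) hA0
  have h2 : ∀ (u : S) (L : ℝ), (∀ x, |u x| ≤ L) → |q u α β * (α - β)| ≤ 2 * L := by
    intro u L hu
    have h0 : 0 ≤ L := (abs_nonneg _).trans (hu 0)
    by_cases h : α - β = 0
    · rw [h]; simpa using h0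
    · rw [q, div_mul_cancel₀ _ h]
      exact (abs_sub _ _).trans (by linarith [hu α, hu β])
  have h3 : |q f α β * q g α β| * (α - β) ^ 2 ≤ (2 * F) * (2 * H) := by
    have : |q f α β * q g α β| * (α - β) ^ 2 = |q f α β * (α - β)| * |q g α β * (α - β)| := by
      rw [← sq_abs (α - β)]
      simp only [abs_mul]; ring
    rw [this]
    exact mul_le_mul (h2 f F hF) (h2 g H hH) (abs_nonneg _) (by positivity)
  linarith

theorem T_prod (f g h : S) :
    Integrable (fun p : ℝ × ℝ => q f p.1 p.2 * q g p.1 p.2 * D h p.2) := by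
  obtain ⟨C, hC⟩ := qq_decay f g
  have h1 : Integrable (fun p : ℝ × ℝ => ‖D h p.2‖ * (C * (1 + (p.1 - p.2) ^ 2)⁻¹)) := by
    have := Integrable.convolution_integrand (μ := volume) (ν := volume)
      (ContinuousLinearMap.mul ℝ ℝ) ((D h).integrable (μ := volume)).norm
      (integrable_inv_one_add_sq.const_mul C)
    simpa [Measure.volume_eq_prod] using this
  have h2 := q_meas f
  have h3 := q_meas g
  have h4 := (D h).continuous.measurable
  refine h1.mono' (Measurable.aestronglyMeasurable (by fun_prop)) (Eventually.of_forall fun p => ?_)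
  rw [norm_mul, mul_comm]
  exact mul_le_mul_of_nonneg_left (hC _ _) (norm_nonneg _)

theorem T_fib (f g h : S) (α : ℝ) : Integrable (fun β => q f α β * q g α β * D h β) := by
  obtain ⟨A, hA0, hA⟩ := S_bdd (D f)
  obtain ⟨B, hB0, hB⟩ := S_bdd (D g)
  have h2 : Measurable (fun β => q f α β) := (q_meas f).comp (by fun_prop : Measurable (fun β => (α, β)))
  have h3 : Measurable (fun β => q g α β) := (q_meas g).comp (by fun_prop : Measurable (fun β => (α, β)))
  have h4 := (D h).continuous.measurable
  refine ((D h).integrable.norm.const_mul (A * B)).mono'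
    (Measurable.aestronglyMeasurable (by fun_prop)) (Eventually.of_forall fun β => ?_)
  rw [norm_mul, norm_mul]
  refine mul_le_mul_of_nonneg_right ?_ (norm_nonneg _)
  exact mul_le_mul (q_le hA _ _) (q_le hB _ _) (abs_nonneg _) hA0

theorem T_integrable (f g h : S) : Integrable (T f g h) := (T_prod f g h).integral_prod_left

theorem T_bdd (f g h : S) : ∃ C : ℝ, ∀ α, |T f g h α| ≤ C := by
  obtain ⟨A, hA0, hA⟩ := S_bdd (D f)
  obtain ⟨B, hB0, hB⟩ := S_bdd (D g)
  refine ⟨∫ β, A * B * ‖D h β‖, fun α => ?_⟩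
  unfold T
  rw [← Real.norm_eq_abs]
  refine norm_integral_le_of_norm_le ((D h).integrable.norm.const_mul (A * B))
    (Eventually.of_forall fun β => ?_)
  rw [norm_mul, norm_mul]
  refine mul_le_mul_of_nonneg_right ?_ (norm_nonneg _)
  exact mul_le_mul (q_le hA _ _) (q_le hB _ _) (abs_nonneg _) hA0

theorem T_memLp (f g h : S) : MemLp (T f g h) 2 volume := by
  obtain ⟨C, hC⟩ := T_bdd f g h
  have hm := (T_integrable f g h).aestronglyMeasurable
  rw [memLp_two_iff_integrable_sq hm]
  refine ((T_integrable f g h).norm.const_mul C).mono' (hm.pow 2) (Eventually.of_forall fun α => ?_)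
  rw [norm_pow, pow_two]
  exact mul_le_mul_of_nonneg_right (hC α) (norm_nonneg _)

theorem T_pair (f g h k : S) : ∫ α, k α * T f g h α = ∫ p : ℝ × ℝ, R f g h k p := by
  obtain ⟨B, hB0, hB⟩ := S_bdd k
  have hk := k.continuous.measurable
  have hi : Integrable (R f g h k) := by
    refine ((T_prod f g h).norm.const_mul B).mono' ?_ (Eventually.of_forall fun p => ?_)
    · have h2 := q_meas f
      have h3 := q_meas g
      have h4 := (D h).continuous.measurable
      unfold R
      exact Measurable.aestronglyMeasurable (by fun_prop)
    · have : R f g h k p = k p.1 * (q f p.1 p.2 * q g p.1 p.2 * D h p.2) := by rw [R]; ring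
      rw [this, norm_mul]
      exact mul_le_mul_of_nonneg_right (hB _) (norm_nonneg _)
  rw [Measure.volume_eq_prod, integral_prod _ hi]
  congr 1; ext α
  rw [T, ← integral_const_mul]
  congr 1; ext β
  rw [R]; ring

theorem T_bound : ∃ C : ℝ, 0 ≤ C ∧ ∀ f g h : S, ∀ A B : ℝ,
    (∀ x, |D f x| ≤ A) → (∀ x, |D g x| ≤ B) →
    eLpNorm (T f g h) 2 volume ≤ ENNReal.ofReal (C * A * B) * eLpNorm h 2 volume := by
  obtain ⟨C, h0, hC⟩ := R_bound
  refine ⟨C, h0, fun f g h A B hf hg => ?_⟩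
  have hA : 0 ≤ A := (abs_nonneg _).trans (hf 0)
  have hB : 0 ≤ B := (abs_nonneg _).trans (hg 0)
  have hm := T_memLp f g h
  set F := hm.toLp with hF
  have h1 : ∀ k : Lp ℝ 2 (volume : Measure ℝ),
      |inner ℝ F k| ≤ C * A * B * ‖h.toLp 2 volume‖ * ‖k‖ := by
    intro k
    refine (SchwartzMap.denseRange_toLpCLM (E := ℝ) (F := ℝ) (μ := volume) (p := 2)
      ENNReal.ofNat_ne_top).induction_on (p := fun k => |inner ℝ F k| ≤ C * A * B * ‖h.toLp 2 volume‖ * ‖k‖)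
      k ?_ ?_
    · exact isClosed_le (by fun_prop) (by fun_prop)
    · intro k
      rw [SchwartzMap.toLpCLM_apply]
      refine le_trans (le_of_eq ?_) (hC f g h k A B hf hg)
      rw [← T_pair, L2.inner_def]
      congr 1
      refine integral_congr_ae ?_
      filter_upwards [k.coeFn_toLp 2 volume, hm.coeFn_toLp] with x hx hx'
      rw [hx, hx']; rfl
  have h2 := h1 F
  rw [real_inner_self_eq_norm_sq, abs_of_nonneg (by positivity)] at h2
  have h3 : ‖F‖ ≤ C * A * B * ‖h.toLp 2 volume‖ := by
    by_contra hcon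
    push Not at hcon
    have : 0 ≤ C * A * B * ‖h.toLp 2 volume‖ := by positivity
    nlinarith
  rw [hF, Lp.norm_toLp, SchwartzMap.norm_toLp] at h3
  have h4 : (ENNReal.ofReal (C * A * B) * eLpNorm h 2 volume).toReal
      = C * A * B * (eLpNorm h 2 volume).toReal := by
    rw [ENNReal.toReal_mul, ENNReal.toReal_ofReal (by positivity)]
  rw [← h4] at h3
  exact (ENNReal.toReal_le_toReal hm.eLpNorm_ne_top
    (ENNReal.mul_ne_top ENNReal.ofReal_ne_top (h.memLp 2 volume).eLpNorm_ne_top)).1 h3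

end CC

open MeasureTheory Set Filter Topology

namespace CC

/-- real or imaginary part map -/
noncomputable def prt (j : Bool) : ℂ →L[ℝ] ℝ := if j then Complex.imCLM else Complex.reCLM

/-- coefficient -/
noncomputable def cf (j : Bool) : ℂ := if j then Complex.I else 1

theorem cf_norm (j : Bool) : ‖cf j‖ = 1 := by cases j <;> simp [cf]

theorem prt_sum (z : ℂ) : z = ∑ j, cf j * ((prt j z : ℝ) : ℂ) := by
  simp [cf, prt]
  rw [add_comm, mul_comm]
  exact (Complex.re_add_im z).symm

theorem prt_le (j : Bool) (z : ℂ) : |prt j z| ≤ ‖z‖ := by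
  cases j
  · simpa [prt] using Complex.abs_re_le_norm z
  · simpa [prt] using Complex.abs_im_le_norm z

/-- real/imaginary part of a Schwartz function -/
noncomputable def pt (j : Bool) (f : SchwartzMap ℝ ℂ) : S := f.postcompCLM (prt j)

theorem pt_apply (j : Bool) (f : SchwartzMap ℝ ℂ) (x : ℝ) : pt j f x = prt j (f x) :=
  SchwartzMap.postcompCLM_apply _ _ _

theorem D_pt (j : Bool) (f : SchwartzMap ℝ ℂ) (x : ℝ) : D (pt j f) x = prt j (deriv f x) := by
  have h1 : HasDerivAt f (deriv f x) x := f.differentiableAt.hasDerivAt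
  have h2 := (prt j).hasFDerivAt.comp_hasDerivAt x h1
  rw [D_apply]
  exact h2.deriv

theorem quot_eq (f : SchwartzMap ℝ ℂ) (α β : ℝ) :
    (f α - f β) / ((α - β : ℝ) : ℂ) = ∑ j, cf j * ((q (pt j f) α β : ℝ) : ℂ) := by
  rw [prt_sum (f α - f β), Finset.sum_div]
  refine Finset.sum_congr rfl fun j _ => ?_
  rw [q, pt_apply, pt_apply, map_sub]
  push_cast
  ring

theorem deriv_le (f : SchwartzMap ℝ ℂ) (x : ℝ) :
    ‖deriv f x‖ ≤ (eLpNorm (deriv f) ⊤ volume).toReal := by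
  have hc : Continuous (deriv f) := by
    have := (SchwartzMap.derivCLM ℝ ℂ f).continuous
    refine this.congr (fun x => SchwartzMap.derivCLM_apply ℝ f x)
  have hm : MemLp (deriv f) ⊤ volume := by
    have := (SchwartzMap.derivCLM ℝ ℂ f).memLp ⊤ volume
    have e : ⇑(SchwartzMap.derivCLM ℝ ℂ f) = deriv f := by
      ext x; exact SchwartzMap.derivCLM_apply ℝ f x
    rwa [e] at this
  have h1 : ∀ᵐ x, ‖deriv f x‖ ≤ (eLpNorm (deriv f) ⊤ volume).toReal := by
    have := ae_le_eLpNormEssSup (f := deriv f) (μ := volume)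
    rw [← eLpNorm_exponent_top] at this
    filter_upwards [this] with x hx
    rw [← toReal_enorm]
    exact ENNReal.toReal_mono hm.eLpNorm_ne_top hx
  have h2 : IsClosed {x | ‖deriv f x‖ ≤ (eLpNorm (deriv f) ⊤ volume).toReal} :=
    isClosed_le hc.norm continuous_const
  have h3 := (Measure.dense_of_ae h1).closure_eq
  rw [h2.closure_eq] at h3
  have : x ∈ {x | ‖deriv f x‖ ≤ (eLpNorm (deriv f) ⊤ volume).toReal} := by rw [h3]; trivial
  exact this

theorem full (f g h : SchwartzMap ℝ ℂ) (α : ℝ) :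
    ∫ β : ℝ, ((f α - f β) / ((α - β : ℝ) : ℂ)) *
          ((g α - g β) / ((α - β : ℝ) : ℂ)) * deriv (⇑h) β
    = ∑ t : Bool × Bool × Bool, cf t.1 * cf t.2.1 * cf t.2.2 *
        ((T (pt t.1 f) (pt t.2.1 g) (pt t.2.2 h) α : ℝ) : ℂ) := by
  have e : ∀ β, ((f α - f β) / ((α - β : ℝ) : ℂ)) *
          ((g α - g β) / ((α - β : ℝ) : ℂ)) * deriv (⇑h) β
      = ∑ t : Bool × Bool × Bool, cf t.1 * cf t.2.1 * cf t.2.2 *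
        ((q (pt t.1 f) α β * q (pt t.2.1 g) α β * D (pt t.2.2 h) β : ℝ) : ℂ) := by
    intro β
    rw [quot_eq, quot_eq, prt_sum (deriv h β)]
    simp only [← D_pt]
    rw [Finset.sum_mul_sum, Finset.sum_mul, Fintype.sum_prod_type]
    refine Finset.sum_congr rfl fun i _ => ?_
    rw [Finset.sum_mul_sum, Fintype.sum_prod_type]
    refine Finset.sum_congr rfl fun j _ => ?_
    refine Finset.sum_congr rfl fun l _ => ?_
    push_cast; ring
  simp only [e]
  rw [integral_finsetSum _ fun t _ => ((T_fib _ _ _ α).ofReal).const_mul _]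
  refine Finset.sum_congr rfl fun t _ => ?_
  rw [integral_const_mul, integral_complex_ofReal, T]

theorem final : ∃ C : ℝ, 0 < C ∧ ∀ f g h : SchwartzMap ℝ ℂ,
    eLpNorm (fun α : ℝ => (1 / (Complex.I * (Real.pi : ℂ))) *
        ∫ β : ℝ, ((f α - f β) / ((α - β : ℝ) : ℂ)) *
          ((g α - g β) / ((α - β : ℝ) : ℂ)) * deriv (⇑h) β) 2 volume
      ≤ ENNReal.ofReal C * eLpNorm (deriv (⇑f)) ⊤ volume *
          eLpNorm (deriv (⇑g)) ⊤ volume * eLpNorm (⇑h) 2 volume := by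
  obtain ⟨C, h0, hC⟩ := T_bound
  refine ⟨8 * C + 1, by positivity, fun f g h => ?_⟩
  have fin : ∀ f : SchwartzMap ℝ ℂ, eLpNorm (deriv f) ⊤ volume ≠ ⊤ := by
    intro f
    have := (SchwartzMap.derivCLM ℝ ℂ f).memLp ⊤ volume
    have e : ⇑(SchwartzMap.derivCLM ℝ ℂ f) = deriv f := by
      ext x; exact SchwartzMap.derivCLM_apply ℝ f x
    rw [e] at this
    exact this.eLpNorm_ne_top
  set A := (eLpNorm (deriv f) ⊤ volume).toReal with hA
  set B := (eLpNorm (deriv g) ⊤ volume).toReal with hB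
  have hA0 : 0 ≤ A := ENNReal.toReal_nonneg
  have hB0 : 0 ≤ B := ENNReal.toReal_nonneg
  have b1 : ∀ t : Bool × Bool × Bool,
      eLpNorm (fun α => |T (pt t.1 f) (pt t.2.1 g) (pt t.2.2 h) α|) 2 volume
        ≤ ENNReal.ofReal (C * A * B) * eLpNorm h 2 volume := by
    intro t
    have e : eLpNorm (fun α => |T (pt t.1 f) (pt t.2.1 g) (pt t.2.2 h) α|) 2 volume
        = eLpNorm (T (pt t.1 f) (pt t.2.1 g) (pt t.2.2 h)) 2 volume :=
      eLpNorm_norm (T (pt t.1 f) (pt t.2.1 g) (pt t.2.2 h))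
    rw [e]
    refine (hC _ _ _ A B (fun x => ?_) (fun x => ?_)).trans ?_
    · rw [D_pt]; exact (prt_le _ _).trans (deriv_le f x)
    · rw [D_pt]; exact (prt_le _ _).trans (deriv_le g x)
    · refine mul_le_mul_right (eLpNorm_mono fun x => ?_) _
      rw [pt_apply]; exact prt_le _ _
  calc _ ≤ eLpNorm (∑ t : Bool × Bool × Bool,
          fun α => |T (pt t.1 f) (pt t.2.1 g) (pt t.2.2 h) α|) 2 volume := by
        refine eLpNorm_mono fun α => ?_
        rw [full, norm_mul]
        have hpi : ‖1 / (Complex.I * (Real.pi : ℂ))‖ ≤ 1 := by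
          rw [norm_div, norm_mul, Complex.norm_I, Complex.norm_real, norm_one, one_mul,
            Real.norm_of_nonneg Real.pi_pos.le]
          exact div_le_one_of_le₀ (by linarith [Real.pi_gt_three]) Real.pi_pos.le
        refine (mul_le_of_le_one_left (norm_nonneg _) hpi).trans ?_
        refine (norm_sum_le _ _).trans ?_
        rw [Finset.sum_apply, Real.norm_of_nonneg (Finset.sum_nonneg fun _ _ => abs_nonneg _)]
        refine Finset.sum_le_sum fun t _ => le_of_eq ?_
        rw [norm_mul, norm_mul, norm_mul, cf_norm, cf_norm, cf_norm, Complex.norm_real]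
        simp
    _ ≤ ∑ t : Bool × Bool × Bool,
          eLpNorm (fun α => |T (pt t.1 f) (pt t.2.1 g) (pt t.2.2 h) α|) 2 volume :=
        eLpNorm_sum_le (fun t _ => (T_integrable _ _ _).aestronglyMeasurable.norm) (by norm_num)
    _ ≤ ∑ t : Bool × Bool × Bool, ENNReal.ofReal (C * A * B) * eLpNorm h 2 volume :=
        Finset.sum_le_sum fun t _ => b1 t
    _ = ENNReal.ofReal (8 * C) * ENNReal.ofReal A * ENNReal.ofReal B * eLpNorm h 2 volume := by
        rw [Finset.sum_const, nsmul_eq_mul, ← mul_assoc, ← ENNReal.ofReal_natCast,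
          ← ENNReal.ofReal_mul (by positivity), ← ENNReal.ofReal_mul (by positivity),
          ← ENNReal.ofReal_mul (by positivity)]
        congr 2
        simp; ring
    _ ≤ _ := by
        rw [hA, hB, ENNReal.ofReal_toReal (fin f), ENNReal.ofReal_toReal (fin g)]
        gcongr
        linarith

end CC

end

/-- there is a universal `C > 0` so that for Schwartz `f, g, h`, the
function `[f, g; h'](α) = (1/(iπ)) ∫ ((f(α)−f(β))/(α−β))((g(α)−g(β))/(α−β)) h'(β) dβ`
satisfies `‖[f, g; h']‖_{L²} ≤ C‖f'‖_{L^∞}‖g'‖_{L^∞}‖h‖_{L²}`. -/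
theorem statement11 : ∃ C : ℝ, 0 < C ∧ ∀ f g h : SchwartzMap ℝ ℂ,
    eLpNorm (fun α : ℝ => (1 / (Complex.I * (Real.pi : ℂ))) *
        ∫ β : ℝ, ((f α - f β) / ((α - β : ℝ) : ℂ)) *
          ((g α - g β) / ((α - β : ℝ) : ℂ)) * deriv (⇑h) β) 2 volume
      ≤ ENNReal.ofReal C * eLpNorm (deriv (⇑f)) ⊤ volume *
          eLpNorm (deriv (⇑g)) ⊤ volume * eLpNorm (⇑h) 2 volume := by
  exact CC.final
end
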